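/- arXiv:2205.07932 — 2 statements merged into one kernel-verified Lean document; each statement's English description precedes it below -/
import Mathlib

section
/- Let V be an n×(p·d) random real matrix uniformly distributed on the Stiefel manifold V(n, p·d), with columns partitioned into p consecutive blocks of d columns, and let K ⊆ {1,…,p} with |K| = q. Suppose (p − 1)·d ≥ n. For t₁₁, t₁₂, t₁₃ > 0 with √(d/n) + t₁₁ < 1, √(1/p) + t₁₂ < 1, √(1/p) + t₁₃ < 1/3, set Δ = (3(√(d/n) + t₁₁) + 3(√(1/p) + t₁₂)) / (1 − 3(√(1/p) + t₁₃)). Then P[ max_{k∈K} ‖√(p d/n)·V_k‖ ≥ (1 + Δ)^{1/2} ] ≤ q·(2·exp(−n t₁₁²/2) + 2·exp(−p d t₁₂²/2) + exp(−p d t₁₃²/2)), and (provided Δ < 1, so that each V_kᵀ V_k is invertible on the complementary event) P[ max_{k∈K} ‖((p d/n)·V_kᵀ V_k)^{−1}‖ ≥ (1 − Δ)^{−1} ] ≤ q·(2·exp(−n t₁₁²/2) + 2·exp(−p d t₁₂²/2) + exp(−p d t₁₃²/2)). -/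
open MeasureTheory ProbabilityTheory Filter Matrix
open scoped ENNReal NNReal

noncomputable section

/-- Euclidean norm of a finite real vector. -/
def euclNorm {ι : Type*} [Fintype ι] (v : ι → ℝ) : ℝ := Real.sqrt (∑ i, v i ^ 2)

/-- Spectral norm (largest singular value) of a real matrix. -/
def specNorm {m n : Type*} [Fintype m] [Fintype n] [DecidableEq n] (A : Matrix m n ℝ) : ℝ :=
  ‖LinearMap.toContinuousLinearMap (Matrix.toEuclideanLin A)‖

instance {m n α : Type*} [MeasurableSpace α] : MeasurableSpace (Matrix m n α) :=
  inferInstanceAs (MeasurableSpace (m → n → α))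

/-- `V` is uniformly distributed on the Stiefel manifold `V(n, ι)`:
`V Vᵀ = I_n` almost surely and `V·O` has the same distribution as `V` for every
fixed orthogonal matrix `O`. -/
def IsUniformStiefel {Ω ι : Type*} [MeasurableSpace Ω] [Fintype ι] [DecidableEq ι]
    (P : Measure Ω) {n : ℕ} (V : Ω → Matrix (Fin n) ι ℝ) : Prop :=
  Measurable V ∧ (∀ᵐ ω ∂P, V ω * (V ω)ᵀ = 1) ∧
    ∀ O : Matrix ι ι ℝ, O * Oᵀ = 1 →
      Measure.map (fun ω => V ω * O) P = Measure.map V P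

/-- The submatrix of a block matrix `V` consisting of the column blocks indexed by `J`. -/
def blockCols {n p d : ℕ} (V : Matrix (Fin n) (Fin p × Fin d) ℝ) (J : Finset (Fin p)) :
    Matrix (Fin n) ({j // j ∈ J} × Fin d) ℝ :=
  fun i jk => V i (jk.1.1, jk.2)

/-- The `k`-th column block of a block matrix `V`. -/
def colBlock {n p d : ℕ} (V : Matrix (Fin n) (Fin p × Fin d) ℝ) (k : Fin p) :
    Matrix (Fin n) (Fin d) ℝ :=
  fun i l => V i (k, l)


/-! ### Part A: Gaussian basics -/

/-- Standard Gaussian measure on `ι → ℝ`. -/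
def gam (ι : Type*) [Fintype ι] : Measure (ι → ℝ) := Measure.pi (fun _ : ι => gaussianReal 0 1)

instance gam_prob (ι : Type*) [Fintype ι] : IsProbabilityMeasure (gam ι) := by
  unfold gam; infer_instance

lemma integrable_exp_abs_gauss (c : ℝ) :
    Integrable (fun s : ℝ => Real.exp (c * |s|)) (gaussianReal 0 1) := by
  have h1 := integrable_exp_mul_gaussianReal (μ := 0) (v := 1) c
  have h2 := integrable_exp_mul_gaussianReal (μ := 0) (v := 1) (-c)
  refine (h1.add h2).mono' (by fun_prop) (ae_of_all _ fun s => ?_)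
  rw [Real.norm_of_nonneg (Real.exp_pos _).le]
  simp only [Pi.add_apply]
  rcases abs_cases s with ⟨h, _⟩ | ⟨h, _⟩ <;> rw [h]
  · linarith [Real.exp_pos (-c * s)]
  · have : c * -s = -c * s := by ring
    rw [this]; linarith [Real.exp_pos (c * s)]

lemma integrable_exp_sum_abs {ι : Type*} [Fintype ι] (c : ℝ) :
    Integrable (fun z : ι → ℝ => Real.exp (c * ∑ i, |z i|)) (gam ι) := by
  have := Integrable.fintype_prod (μ := fun _ : ι => gaussianReal 0 1)
    (f := fun _ s => Real.exp (c * |s|)) (fun _ => integrable_exp_abs_gauss c)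
  refine this.congr (ae_of_all _ fun z => ?_)
  simp only [Finset.mul_sum, Real.exp_sum]

lemma integrable_of_exp_bound {ι : Type*} [Fintype ι] {g : (ι → ℝ) → ℝ} (hg : Measurable g)
    (C c : ℝ) (hb : ∀ z, |g z| ≤ C * Real.exp (c * ∑ i, |z i|)) : Integrable g (gam ι) :=
  ((integrable_exp_sum_abs c).const_mul C).mono' hg.aestronglyMeasurable
    (ae_of_all _ fun z => by rw [Real.norm_eq_abs]; exact hb z)

lemma measurable_update_pair {ι : Type*} [Fintype ι] [DecidableEq ι] (i : ι) :
    Measurable (fun q : (ι → ℝ) × ℝ => Function.update q.1 i q.2) := by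
  refine measurable_pi_lambda _ fun j => ?_
  by_cases h : j = i
  · subst h; simpa using measurable_snd
  · simp only [Function.update_of_ne h]
    exact (measurable_pi_apply j).comp measurable_fst

lemma mp_update {ι : Type*} [Fintype ι] [DecidableEq ι] (i : ι) :
    ((gam ι).prod (gaussianReal 0 1)).map (fun q : (ι → ℝ) × ℝ => Function.update q.1 i q.2)
      = gam ι := by
  symm
  refine Measure.pi_eq fun s hs => ?_
  rw [Measure.map_apply (measurable_update_pair i) (MeasurableSet.univ_pi hs)]
  have : (fun q : (ι → ℝ) × ℝ => Function.update q.1 i q.2) ⁻¹' (Set.univ.pi s)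
      = (Set.univ.pi (Function.update s i Set.univ)) ×ˢ s i := by
    ext ⟨z, t⟩
    simp only [Set.mem_preimage, Set.mem_pi, Set.mem_univ, true_imp_iff, Set.mem_prod]
    constructor
    · intro h
      refine ⟨fun j => ?_, by simpa using h i⟩
      by_cases hj : j = i
      · subst hj; simp
      · simpa [Function.update_of_ne hj] using h j
    · rintro ⟨h1, h2⟩ j
      by_cases hj : j = i
      · subst hj; simpa using h2
      · simpa [Function.update_of_ne hj] using h1 j
  rw [this, Measure.prod_prod, gam, Measure.pi_pi]
  rw [← Finset.mul_prod_erase _ _ (Finset.mem_univ i), ← Finset.mul_prod_erase (a := i) _ (fun j => (gaussianReal 0 1) (s j)) (Finset.mem_univ i)]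
  simp only [Function.update_self, measure_univ, one_mul]
  rw [mul_comm]
  congr 1
  refine Finset.prod_congr rfl fun j hj => ?_
  rw [Function.update_of_ne (Finset.ne_of_mem_erase hj)]

lemma integral_update {ι : Type*} [Fintype ι] [DecidableEq ι] (i : ι) {g : (ι → ℝ) → ℝ}
    (hg : Integrable g (gam ι)) :
    Integrable (fun q : (ι → ℝ) × ℝ => g (Function.update q.1 i q.2))
      ((gam ι).prod (gaussianReal 0 1)) ∧
    ∫ z, g z ∂(gam ι) = ∫ z, ∫ s, g (Function.update z i s) ∂(gaussianReal 0 1) ∂(gam ι) := by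
  have hm := (measurable_update_pair i).aemeasurable (μ := (gam ι).prod (gaussianReal 0 1))
  have hI : Integrable (fun q : (ι → ℝ) × ℝ => g (Function.update q.1 i q.2))
      ((gam ι).prod (gaussianReal 0 1)) := by
    have h2 : Integrable g (((gam ι).prod (gaussianReal 0 1)).map
      (fun q : (ι → ℝ) × ℝ => Function.update q.1 i q.2)) := by rw [mp_update]; exact hg
    exact h2.comp_aemeasurable hm
  refine ⟨hI, ?_⟩
  rw [← integral_prod _ hI]
  conv_lhs => rw [← mp_update i]
  rw [integral_map hm]
  rw [mp_update]; exact hg.1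

lemma stein1d {k k' : ℝ → ℝ} (hk : ∀ s, HasDerivAt k (k' s) s) 
    (h1 : Integrable (fun s => s * k s) (gaussianReal 0 1))
    (h2 : Integrable k' (gaussianReal 0 1)) (h3 : Integrable k (gaussianReal 0 1)) :
    ∫ s, s * k s ∂(gaussianReal 0 1) = ∫ s, k' s ∂(gaussianReal 0 1) := by
  have hone : (1 : ℝ≥0) ≠ 0 := one_ne_zero
  have tr : ∀ f : ℝ → ℝ, Integrable f (gaussianReal 0 1) →
      Integrable (fun s => gaussianPDFReal 0 1 s * f s) := by
    intro f hf
    rw [gaussianReal_of_var_ne_zero _ hone] at hf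
    rw [integrable_withDensity_iff_integrable_smul' (by fun_prop)
      (ae_of_all _ fun x => by simp [gaussianPDF])] at hf
    refine hf.congr (ae_of_all _ fun s => ?_)
    simp [gaussianPDF, ENNReal.toReal_ofReal (gaussianPDFReal_nonneg 0 1 s)]
  rw [integral_gaussianReal_eq_integral_smul hone, integral_gaussianReal_eq_integral_smul hone]
  simp only [smul_eq_mul]
  have hd : ∀ s, HasDerivAt (fun s => gaussianPDFReal 0 1 s * k s)
      (gaussianPDFReal 0 1 s * k' s - gaussianPDFReal 0 1 s * (s * k s)) s := by
    intro s
    have hp : HasDerivAt (gaussianPDFReal 0 1) (gaussianPDFReal 0 1 s * (-s)) s := by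
      unfold gaussianPDFReal
      have : HasDerivAt (fun x : ℝ => -(x - 0) ^ 2 / (2 * ((1:ℝ≥0) : ℝ))) (-s) s := by
        have h := (((hasDerivAt_id s).sub_const 0).pow 2).neg.div_const (2 * ((1:ℝ≥0) : ℝ))
        refine h.congr_deriv ?_
        simp
        ring
      refine (this.exp.const_mul ((√(2 * Real.pi * ((1:ℝ≥0):ℝ)))⁻¹)).congr_deriv ?_
      ring
    refine (hp.mul (hk s)).congr_deriv ?_
    ring
  have := integral_eq_zero_of_hasDerivAt_of_integrable hd ((tr _ h2).sub (tr _ h1)) (tr _ h3)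
  rw [integral_sub (tr _ h2) (tr _ h1)] at this
  linarith

lemma stein {ι : Type*} [Fintype ι] [DecidableEq ι] (i : ι) {g g' : (ι → ℝ) → ℝ}
    (hg : Measurable g) (hg' : Measurable g')
    (hd : ∀ z, HasDerivAt (fun s => g (Function.update z i s)) (g' z) (z i))
    (C c C' c' : ℝ) (hb : ∀ z, |g z| ≤ C * Real.exp (c * ∑ i, |z i|))
    (hb' : ∀ z, |g' z| ≤ C' * Real.exp (c' * ∑ i, |z i|)) :
    Integrable (fun z => z i * g z) (gam ι) ∧ ∫ z, z i * g z ∂(gam ι) = ∫ z, g' z ∂(gam ι) := by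
  have I0 := integrable_of_exp_bound hg C c hb
  have I1 := integrable_of_exp_bound hg' C' c' hb'
  have I2 : Integrable (fun z => z i * g z) (gam ι) := by
    refine integrable_of_exp_bound ((measurable_pi_apply i).mul hg) C (c + 1) fun z => ?_
    rw [abs_mul, add_mul, Real.exp_add, one_mul]
    have h1 : |z i| ≤ Real.exp (∑ i, |z i|) := by
      have := Finset.single_le_sum (f := fun i => |z i|) (fun _ _ => abs_nonneg _)
        (Finset.mem_univ i)
      linarith [Real.add_one_le_exp (∑ i, |z i|)]
    calc |z i| * |g z| ≤ Real.exp (∑ i, |z i|) * (C * Real.exp (c * ∑ i, |z i|)) :=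
          mul_le_mul h1 (hb z) (abs_nonneg _) (Real.exp_pos _).le
      _ = _ := by ring
  refine ⟨I2, ?_⟩
  obtain ⟨J0, -⟩ := integral_update i I0
  obtain ⟨J1, E1⟩ := integral_update i I1
  obtain ⟨J2, E2⟩ := integral_update i I2
  rw [E1, E2]
  refine integral_congr_ae ?_
  filter_upwards [J0.prod_right_ae, J1.prod_right_ae, J2.prod_right_ae] with z a0 a1 a2
  simp only [Function.update_self] at a2 ⊢
  refine stein1d (fun s => ?_) a2 a1 a0
  have := hd (Function.update z i s)
  simpa using this

/-! ### Part B: Gaussian interpolation -/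

/-- The interpolating matrix. -/
def interpMat {ι J : Type*} (A B : Matrix J ι ℝ) (θ : ℝ) : Matrix J ι ℝ :=
  Real.sin θ • A + Real.cos θ • B

lemma interpMat_sum_le {ι J : Type*} [Fintype ι] [Fintype J] (A B : Matrix J ι ℝ) :
    ∃ M : ℝ, 0 ≤ M ∧ ∀ (a b : ℝ), |a| ≤ 1 → |b| ≤ 1 → ∀ z : ι → ℝ,
      ∑ j, |((a • A + b • B) *ᵥ z) j| ≤ M * ∑ i, |z i| := by
  refine ⟨∑ j, ∑ i, (|A j i| + |B j i|), by positivity, fun a b ha hb z => ?_⟩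
  rw [Finset.sum_mul]
  refine Finset.sum_le_sum fun j _ => ?_
  simp only [Matrix.mulVec, dotProduct]
  refine (Finset.abs_sum_le_sum_abs _ _).trans ?_
  rw [Finset.sum_mul]
  refine Finset.sum_le_sum fun i _ => ?_
  rw [abs_mul]
  have h1 : |z i| ≤ ∑ i, |z i| :=
    Finset.single_le_sum (f := fun i => |z i|) (fun _ _ => abs_nonneg _) (Finset.mem_univ i)
  refine mul_le_mul ?_ h1 (abs_nonneg _) (by positivity)
  simp only [Matrix.add_apply, Matrix.smul_apply, smul_eq_mul]
  refine (abs_add_le _ _).trans ?_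
  rw [abs_mul, abs_mul]
  have := mul_le_mul_of_nonneg_right ha (abs_nonneg (A j i))
  have := mul_le_mul_of_nonneg_right hb (abs_nonneg (B j i))
  linarith

lemma integral_sum_sum {Z J I : Type*} [MeasurableSpace Z] [Fintype J] [Fintype I] (μ : Measure Z)
    (c : J → I → ℝ) (f : J → I → Z → ℝ) (hf : ∀ j i, Integrable (f j i) μ) :
    ∫ z, ∑ j, ∑ i, c j i * f j i z ∂μ = ∑ j, ∑ i, c j i * ∫ z, f j i z ∂μ := by
  rw [integral_finsetSum _ fun j _ => integrable_finsetSum _ fun i _ => ((hf j i).const_mul _)]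
  refine Finset.sum_congr rfl fun j _ => ?_
  rw [integral_finsetSum _ fun i _ => ((hf j i).const_mul _)]
  simp_rw [integral_const_mul]

lemma gauss_interp {ι J : Type*} [Fintype ι] [DecidableEq ι] [Fintype J]
    (A B : Matrix J ι ℝ) (hAB : A * Bᵀ = 0)
    (F : (J → ℝ) → ℝ) (F1 : J → (J → ℝ) → ℝ) (F2 : J → J → (J → ℝ) → ℝ)
    (hF : ∀ x, HasFDerivAt F (∑ j, F1 j x • (ContinuousLinearMap.proj j : (J → ℝ) →L[ℝ] ℝ)) x)
    (hF1 : ∀ j x, HasFDerivAt (F1 j)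
      (∑ k, F2 j k x • (ContinuousLinearMap.proj k : (J → ℝ) →L[ℝ] ℝ)) x)
    (hF2 : ∀ j k, Measurable (F2 j k))
    (C : ℝ) (hC : 0 ≤ C) (b0 : ∀ x, |F x| ≤ C * Real.exp (∑ j, |x j|))
    (b1 : ∀ j x, |F1 j x| ≤ C * Real.exp (∑ j, |x j|))
    (b2 : ∀ j k x, |F2 j k x| ≤ C * Real.exp (∑ j, |x j|))
    (hneg : ∀ x, ∑ j, ∑ k, ((A * Aᵀ) j k - (B * Bᵀ) j k) * F2 j k x ≤ 0) :
    ∫ z, F (A *ᵥ z) ∂(gam ι) ≤ ∫ z, F (B *ᵥ z) ∂(gam ι) := by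
  obtain ⟨M, hM, hMb⟩ := interpMat_sum_le A B
  have cF : Continuous F := continuous_iff_continuousAt.2 fun x => (hF x).continuousAt
  have cF1 : ∀ j, Continuous (F1 j) :=
    fun j => continuous_iff_continuousAt.2 fun x => (hF1 j x).continuousAt
  have cmv : ∀ D : Matrix J ι ℝ, Continuous (fun z : ι → ℝ => D *ᵥ z) := fun D => by fun_prop
  set D : ℝ → Matrix J ι ℝ := fun θ => Real.sin θ • A + Real.cos θ • B with hD
  set D' : ℝ → Matrix J ι ℝ := fun θ => Real.cos θ • A + (-Real.sin θ) • B with hD'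
  have eb : ∀ θ z, Real.exp (∑ j, |(D θ *ᵥ z) j|) ≤ Real.exp (M * ∑ i, |z i|) := fun θ z =>
    Real.exp_le_exp.2 (hMb _ _ (Real.abs_sin_le_one θ) (Real.abs_cos_le_one θ) z)
  have eb' : ∀ θ z j, |(D' θ *ᵥ z) j| ≤ Real.exp (M * ∑ i, |z i|) := fun θ z j => by
    have h1 := hMb (Real.cos θ) (-Real.sin θ) (Real.abs_cos_le_one θ)
      (by rw [abs_neg]; exact Real.abs_sin_le_one θ) z
    have h2 : |(D' θ *ᵥ z) j| ≤ ∑ j, |(D' θ *ᵥ z) j| :=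
      Finset.single_le_sum (f := fun j => |(D' θ *ᵥ z) j|) (fun _ _ => abs_nonneg _)
        (Finset.mem_univ j)
    linarith [Real.add_one_le_exp (M * ∑ i, |z i|)]
  have eD : ∀ θ z j, HasDerivAt (fun t => (D t *ᵥ z) j) ((D' θ *ᵥ z) j) θ := by
    intro θ z j
    simp only [hD, hD', Matrix.add_mulVec, Matrix.smul_mulVec, Pi.add_apply, Pi.smul_apply,
      smul_eq_mul]
    exact ((Real.hasDerivAt_sin θ).mul_const _).add ((Real.hasDerivAt_cos θ).mul_const _)
  set φ : ℝ → ℝ := fun θ => ∫ z, F (D θ *ᵥ z) ∂(gam ι) with hφ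
  have hder : ∀ θ, HasDerivAt φ (∫ z, ∑ j, F1 j (D θ *ᵥ z) * (D' θ *ᵥ z) j ∂(gam ι)) θ := by
    intro θ
    refine (hasDerivAt_integral_of_dominated_loc_of_deriv_le (μ := gam ι) (𝕜 := ℝ)
      (F := fun t z => F (D t *ᵥ z)) (F' := fun t z => ∑ j, F1 j (D t *ᵥ z) * (D' t *ᵥ z) j)
      (bound := fun z : ι → ℝ => (∑ j : J, C) * Real.exp (2 * M * ∑ i, |z i|))
      (s := Set.univ) Filter.univ_mem ?_ ?_ ?_ ?_ ?_ ?_).2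
    · exact Eventually.of_forall fun t => (cF.comp (cmv _)).aestronglyMeasurable
    · exact integrable_of_exp_bound (cF.comp (cmv _)).measurable C M fun z =>
        (b0 _).trans (mul_le_mul_of_nonneg_left (eb _ _) hC)
    · refine (continuous_finsetSum _ fun j _ => ((cF1 j).comp (cmv _)).mul
        ((continuous_apply j).comp (cmv _))).aestronglyMeasurable
    · refine ae_of_all _ fun z t _ => ?_
      rw [Real.norm_eq_abs, Finset.sum_mul]
      refine (Finset.abs_sum_le_sum_abs _ _).trans (Finset.sum_le_sum fun j _ => ?_)
      rw [abs_mul]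
      calc _ ≤ (C * Real.exp (M * ∑ i, |z i|)) * Real.exp (M * ∑ i, |z i|) :=
            mul_le_mul ((b1 j _).trans (mul_le_mul_of_nonneg_left (eb _ _) hC)) (eb' _ _ _)
              (abs_nonneg _) (by positivity)
        _ = _ := by rw [mul_assoc, ← Real.exp_add]; congr 2; ring
    · exact (integrable_exp_sum_abs (2 * M)).const_mul _
    · refine ae_of_all _ fun z t _ => ?_
      have h1 : HasDerivAt (fun t => D t *ᵥ z) (D' t *ᵥ z) t :=
        hasDerivAt_pi.2 fun j => eD t z j
      have := (hF (D t *ᵥ z)).comp_hasDerivAt t h1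
      refine this.congr_deriv ?_
      simp
  have hst : ∀ θ j i, Integrable (fun z => z i * F1 j (D θ *ᵥ z)) (gam ι) ∧
      ∫ z, z i * F1 j (D θ *ᵥ z) ∂(gam ι) = ∫ z, ∑ k, F2 j k (D θ *ᵥ z) * D θ k i ∂(gam ι) := by
    intro θ j i
    refine stein i ((cF1 j).comp (cmv _)).measurable ?_ ?_ C M
      (C * ∑ k, |D θ k i|) M ?_ ?_
    · exact Finset.measurable_sum _ fun k _ => ((hF2 j k).comp (cmv _).measurable).mul_const _
    · intro z
      have h1 : HasDerivAt (fun s => D θ *ᵥ Function.update z i s) (fun k => D θ k i) (z i) := by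
        refine hasDerivAt_pi.2 fun k => ?_
        simp only [Matrix.mulVec, dotProduct]
        have : ∀ i' ∈ (Finset.univ : Finset ι), HasDerivAt (fun s => D θ k i' * Function.update z i s i')
            (if i' = i then D θ k i' else 0) (z i) := by
          intro i' _
          by_cases h : i' = i
          · subst h; simpa using (hasDerivAt_id (z i')).const_mul (D θ k i')
          · simp only [Function.update_of_ne h, if_neg h]; exact hasDerivAt_const _ _
        refine (HasDerivAt.fun_sum this).congr_deriv ?_
        simp
      have h2 := hF1 j (D θ *ᵥ z)
      have h3 : D θ *ᵥ z = D θ *ᵥ Function.update z i (z i) := by simp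
      rw [h3] at h2
      have := h2.comp_hasDerivAt (z i) h1
      refine this.congr_deriv ?_
      simp
    · exact fun z => (b1 _ _).trans (mul_le_mul_of_nonneg_left (eb _ _) hC)
    · intro z
      refine (Finset.abs_sum_le_sum_abs _ _).trans ?_
      rw [mul_comm C, mul_assoc, Finset.sum_mul]
      refine Finset.sum_le_sum fun k _ => ?_
      rw [abs_mul, mul_comm]
      exact mul_le_mul_of_nonneg_left
        ((b2 _ _ _).trans (mul_le_mul_of_nonneg_left (eb _ _) hC)) (abs_nonneg _)
  have iF2 : ∀ θ j k, Integrable (fun z => F2 j k (D θ *ᵥ z)) (gam ι) := fun θ j k =>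
    integrable_of_exp_bound ((hF2 j k).comp (cmv _).measurable) C M fun z =>
      (b2 _ _ _).trans (mul_le_mul_of_nonneg_left (eb _ _) hC)
  have hDD : ∀ θ j k, ∑ i, D' θ j i * D θ k i
      = Real.sin θ * Real.cos θ * ((A * Aᵀ) j k - (B * Bᵀ) j k) := by
    intro θ j k
    have h1 : ∑ i, D' θ j i * D θ k i = (D' θ * (D θ)ᵀ) j k := by simp [Matrix.mul_apply]
    have hBA : B * Aᵀ = 0 := by
      have := congrArg Matrix.transpose hAB
      simpa [Matrix.transpose_mul] using this
    rw [h1]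
    simp only [hD, hD', Matrix.transpose_add, Matrix.transpose_smul, Matrix.add_mul,
      Matrix.mul_add, Matrix.smul_mul, Matrix.mul_smul, hAB, hBA, Matrix.add_apply,
      Matrix.smul_apply, smul_eq_mul, Matrix.zero_apply]
    ring
  have hval : ∀ θ, ∫ z, ∑ j, F1 j (D θ *ᵥ z) * (D' θ *ᵥ z) j ∂(gam ι)
      = Real.sin θ * Real.cos θ *
        ∫ z, ∑ j, ∑ k, ((A * Aᵀ) j k - (B * Bᵀ) j k) * F2 j k (D θ *ᵥ z) ∂(gam ι) := by
    intro θ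
    have e1 : ∀ z, ∑ j, F1 j (D θ *ᵥ z) * (D' θ *ᵥ z) j
        = ∑ j, ∑ i, D' θ j i * (z i * F1 j (D θ *ᵥ z)) := by
      intro z
      refine Finset.sum_congr rfl fun j _ => ?_
      simp only [Matrix.mulVec, dotProduct, Finset.mul_sum]
      refine Finset.sum_congr rfl fun i _ => by ring
    have e2 : ∀ j i, ∫ z, ∑ k, F2 j k (D θ *ᵥ z) * D θ k i ∂(gam ι)
        = ∑ k, (∫ z, F2 j k (D θ *ᵥ z) ∂(gam ι)) * D θ k i := by
      intro j i
      rw [integral_finsetSum _ fun k _ => ((iF2 θ j k).mul_const _)]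
      simp_rw [integral_mul_const]
    have e3 := integral_sum_sum (gam ι) (fun j i => D' θ j i)
      (fun j i z => z i * F1 j (D θ *ᵥ z)) (fun j i => (hst θ j i).1)
    have e4 := integral_sum_sum (gam ι) (fun j k => (A * Aᵀ) j k - (B * Bᵀ) j k)
      (fun j k z => F2 j k (D θ *ᵥ z)) (fun j i => iF2 θ j i)
    rw [integral_congr_ae (ae_of_all _ e1), e3, e4, Finset.mul_sum]
    refine Finset.sum_congr rfl fun j _ => ?_
    simp_rw [(hst θ j _).2, e2, Finset.mul_sum]
    rw [Finset.sum_comm]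
    refine Finset.sum_congr rfl fun k _ => ?_
    rw [← mul_assoc, ← hDD θ j k, Finset.sum_mul]
    refine Finset.sum_congr rfl fun i _ => by ring
  have hanti : AntitoneOn φ (Set.Icc 0 (Real.pi / 2)) := by
    refine antitoneOn_of_deriv_nonpos (convex_Icc _ _)
      (fun θ _ => (hder θ).continuousAt.continuousWithinAt)
      (fun θ _ => (hder θ).differentiableAt.differentiableWithinAt) fun θ hθ => ?_
    rw [interior_Icc] at hθ
    rw [(hder θ).deriv, hval]
    refine mul_nonpos_of_nonneg_of_nonpos (mul_nonneg ?_ ?_)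
      (integral_nonpos fun z => hneg _)
    · exact Real.sin_nonneg_of_nonneg_of_le_pi hθ.1.le (by linarith [hθ.2, Real.pi_pos])
    · exact Real.cos_nonneg_of_neg_pi_div_two_le_of_le (by linarith [hθ.1, Real.pi_pos]) hθ.2.le
  have h0 := hanti (Set.left_mem_Icc.2 (by positivity)) (Set.right_mem_Icc.2 (by positivity))
    (by positivity : (0:ℝ) ≤ Real.pi / 2)
  simpa [hφ, hD] using h0

set_option linter.unusedSectionVars false
/-! ### Part C: the soft min-max functional -/

/-- `f` has gradient `d` at `x`. -/
def HG {J : Type*} [Fintype J] (f : (J → ℝ) → ℝ) (d : J → ℝ) (x : J → ℝ) : Prop :=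
  HasFDerivAt f (∑ k, d k • (ContinuousLinearMap.proj k : (J → ℝ) →L[ℝ] ℝ)) x

section HGsec
variable {J : Type*} [Fintype J]

lemma HG.congr {f : (J → ℝ) → ℝ} {d d' : J → ℝ} {x : J → ℝ} (h : HG f d x)
    (e : ∀ k, d k = d' k) : HG f d' x := by
  have : d = d' := funext e
  rwa [← this]

lemma HG.proj [DecidableEq J] (j : J) (x : J → ℝ) :
    HG (fun x => x j) (fun k => if k = j then 1 else 0) x := by
  have h : HasFDerivAt (fun x : J → ℝ => x j)
    (ContinuousLinearMap.proj j : (J → ℝ) →L[ℝ] ℝ) x := hasFDerivAt_apply j x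
  refine h.congr_fderiv ?_
  ext y
  simp

lemma HG.exp {f : (J → ℝ) → ℝ} {d : J → ℝ} {x : J → ℝ} (h : HG f d x) :
    HG (fun x => Real.exp (f x)) (fun k => Real.exp (f x) * d k) x := by
  refine (HasFDerivAt.exp h).congr_fderiv ?_
  ext y
  simp [Finset.mul_sum, mul_assoc]

lemma HG.log {f : (J → ℝ) → ℝ} {d : J → ℝ} {x : J → ℝ} (h : HG f d x) (h0 : f x ≠ 0) :
    HG (fun x => Real.log (f x)) (fun k => (f x)⁻¹ * d k) x := by
  refine (HasFDerivAt.log h h0).congr_fderiv ?_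
  ext y
  simp [Finset.mul_sum, mul_assoc]

lemma HG.const_mul {f : (J → ℝ) → ℝ} {d : J → ℝ} {x : J → ℝ} (h : HG f d x) (c : ℝ) :
    HG (fun x => c * f x) (fun k => c * d k) x := by
  refine (HasFDerivAt.const_mul h c).congr_fderiv ?_
  ext y
  simp [Finset.mul_sum, mul_assoc]

lemma HG.mul {f g : (J → ℝ) → ℝ} {d e : J → ℝ} {x : J → ℝ} (h : HG f d x) (h' : HG g e x) :
    HG (fun x => f x * g x) (fun k => f x * e k + g x * d k) x := by
  refine (HasFDerivAt.mul h h').congr_fderiv ?_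
  ext y
  simp [Finset.mul_sum, mul_assoc, add_mul, Finset.sum_add_distrib]

lemma HG.inv {g : (J → ℝ) → ℝ} {e : J → ℝ} {x : J → ℝ} (h : HG g e x)
    (h0 : g x ≠ 0) : HG (fun x => (g x)⁻¹) (fun k => -(g x ^ 2)⁻¹ * e k) x := by
  have := (hasDerivAt_inv h0).comp_hasFDerivAt x h
  refine this.congr_fderiv ?_
  ext y
  simp [Finset.mul_sum, mul_assoc]

lemma HG.sum {I : Type*} [Fintype I] {f : I → (J → ℝ) → ℝ} {d : I → J → ℝ} {x : J → ℝ}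
    (h : ∀ i, HG (f i) (d i) x) :
    HG (fun x => ∑ i, f i x) (fun k => ∑ i, d i k) x := by
  refine (HasFDerivAt.fun_sum fun i _ => h i).congr_fderiv ?_
  ext y
  simp only [FunLike.coe_sum, Finset.sum_apply, FunLike.coe_smul, Pi.smul_apply,
    ContinuousLinearMap.proj_apply, smul_eq_mul, Finset.sum_mul]
  rw [Finset.sum_comm]

end HGsec

section gordon
variable {U W : Type*} [Fintype U] [Fintype W] [DecidableEq U] [DecidableEq W]

def gS (u : U) (x : U × W → ℝ) : ℝ := ∑ w, Real.exp (x (u, w))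
def gR (a : ℝ) (u : U) (x : U × W → ℝ) : ℝ := Real.exp (a * Real.log (gS u x))
def gT (a : ℝ) (x : U × W → ℝ) : ℝ := ∑ u, gR a u x
def gF (a b : ℝ) (x : U × W → ℝ) : ℝ := Real.exp (b * Real.log (gT a x))
def gP (j : U × W) (x : U × W → ℝ) : ℝ := Real.exp (x j) * (gS j.1 x)⁻¹
def gQ (a : ℝ) (u : U) (x : U × W → ℝ) : ℝ := gR a u x * (gT a x)⁻¹
def gF1 (a b : ℝ) (j : U × W) (x : U × W → ℝ) : ℝ :=
  a * b * (gF a b x * (gQ a j.1 x * gP j x))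
def gF2 (a b : ℝ) (j k : U × W) (x : U × W → ℝ) : ℝ :=
  a * b * (gF a b x * (gQ a j.1 x * gP j x)) *
    ((if k.1 = j.1 then a * gP k x else 0) - a * (gQ a k.1 x * gP k x) + (if k = j then 1 else 0)
      - (if k.1 = j.1 then gP k x else 0) + a * b * (gQ a k.1 x * gP k x))

variable [Nonempty U] [Nonempty W]

lemma gS_pos (u : U) (x : U × W → ℝ) : 0 < gS u x :=
  Finset.sum_pos (fun _ _ => Real.exp_pos _) Finset.univ_nonempty

lemma gT_pos (a : ℝ) (x : U × W → ℝ) : 0 < gT a x :=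
  Finset.sum_pos (fun _ _ => Real.exp_pos _) Finset.univ_nonempty

lemma gP_mem (j : U × W) (x : U × W → ℝ) : 0 ≤ gP j x ∧ gP j x ≤ 1 := by
  have h := gS_pos j.1 x
  refine ⟨mul_nonneg (Real.exp_pos _).le (inv_nonneg.2 h.le), ?_⟩
  rw [gP, ← div_eq_mul_inv, div_le_one h]
  exact Finset.single_le_sum (f := fun w => Real.exp (x (j.1, w))) (fun _ _ => (Real.exp_pos _).le)
    (Finset.mem_univ j.2)

lemma gQ_mem (a : ℝ) (u : U) (x : U × W → ℝ) : 0 ≤ gQ a u x ∧ gQ a u x ≤ 1 := by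
  have h := gT_pos a x
  refine ⟨mul_nonneg (Real.exp_pos _).le (inv_nonneg.2 h.le), ?_⟩
  rw [gQ, ← div_eq_mul_inv, div_le_one h]
  exact Finset.single_le_sum (f := fun u => gR a u x) (fun _ _ => (Real.exp_pos _).le)
    (Finset.mem_univ u)

lemma gS_HG (u : U) (x : U × W → ℝ) :
    HG (gS u) (fun k => if k.1 = u then Real.exp (x k) else 0) x := by
  have h := HG.sum (x := x) (f := fun (w : W) (x : U × W → ℝ) => Real.exp (x (u, w)))
    (fun w => (HG.proj (u, w) x).exp)
  refine HG.congr h fun k => ?_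
  obtain ⟨k1, k2⟩ := k
  by_cases hk : k1 = u
  · subst hk; simp
  · simp [hk]

lemma gR_HG (a : ℝ) (u : U) (x : U × W → ℝ) :
    HG (gR a u) (fun k => gR a u x * (if k.1 = u then a * gP k x else 0)) x := by
  refine HG.congr (((gS_HG u x).log (gS_pos u x).ne').const_mul a).exp fun k => ?_
  unfold gR
  by_cases hk : k.1 = u
  · simp only [hk, if_true, gP]; ring
  · simp [hk]

lemma gT_HG (a : ℝ) (x : U × W → ℝ) :
    HG (gT a) (fun k => a * (gR a k.1 x * gP k x)) x := by
  refine HG.congr (HG.sum fun u => gR_HG a u x) fun k => ?_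
  simp; ring

lemma gF_HG (a b : ℝ) (x : U × W → ℝ) :
    HG (gF a b) (fun k => gF1 a b k x) x := by
  refine HG.congr (((gT_HG a x).log (gT_pos a x).ne').const_mul b).exp fun k => ?_
  simp only [gF1, gF, gQ]; ring

lemma gP_HG (j : U × W) (x : U × W → ℝ) :
    HG (gP j) (fun k => gP j x * ((if k = j then 1 else 0)
      - (if k.1 = j.1 then gP k x else 0))) x := by
  refine HG.congr ((HG.proj j x).exp.mul ((gS_HG j.1 x).inv (gS_pos j.1 x).ne')) fun k => ?_
  have h := (gS_pos j.1 x).ne'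
  by_cases hk : k.1 = j.1
  · simp only [hk, if_true, gP]
    field_simp
    ring
  · have hk' : k ≠ j := fun e => hk (by rw [e])
    simp [hk, hk', gP]

lemma gQ_HG (a : ℝ) (u : U) (x : U × W → ℝ) :
    HG (gQ a u) (fun k => gQ a u x * ((if k.1 = u then a * gP k x else 0)
      - a * (gQ a k.1 x * gP k x))) x := by
  refine HG.congr ((gR_HG a u x).mul ((gT_HG a x).inv (gT_pos a x).ne')) fun k => ?_
  have h := (gT_pos a x).ne'
  simp only [gQ]
  field_simp
  ring

lemma gF1_HG (a b : ℝ) (j : U × W) (x : U × W → ℝ) :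
    HG (gF1 a b j) (fun k => gF2 a b j k x) x := by
  refine HG.congr (((gF_HG a b x).mul ((gQ_HG a j.1 x).mul (gP_HG j x))).const_mul (a * b))
    fun k => ?_
  simp only [gF2, gF1]; ring

lemma gF_le (a b : ℝ) (ha : |a| ≤ 1) (hb : 0 ≤ b) (hb1 : b ≤ 1) (x : U × W → ℝ) :
    gF a b x ≤ (Fintype.card U * Fintype.card W : ℝ) * Real.exp (∑ j, |x j|) := by
  set s := ∑ j, |x j| with hs
  have hs0 : 0 ≤ s := by positivity
  have hx : ∀ j, |x j| ≤ s := fun j =>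
    Finset.single_le_sum (f := fun j => |x j|) (fun _ _ => abs_nonneg _) (Finset.mem_univ j)
  have hU : (1:ℝ) ≤ Fintype.card U := by exact_mod_cast Fintype.card_pos
  have hW : (1:ℝ) ≤ Fintype.card W := by exact_mod_cast Fintype.card_pos
  have hlW : 0 ≤ Real.log (Fintype.card W) := Real.log_nonneg hW
  have hR : ∀ u, gR a u x ≤ Fintype.card W * Real.exp s := by
    intro u
    have h1 : gS u x ≤ Fintype.card W * Real.exp s := by
      calc gS u x ≤ ∑ _w : W, Real.exp s := Finset.sum_le_sum fun w _ =>
            Real.exp_le_exp.2 ((le_abs_self _).trans (hx _))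
        _ = _ := by simp
    have h2 : Real.exp (-s) ≤ gS u x := by
      obtain ⟨w⟩ := ‹Nonempty W›
      calc Real.exp (-s) ≤ Real.exp (x (u, w)) := Real.exp_le_exp.2 (by
            linarith [neg_abs_le (x (u, w)), hx (u, w)])
        _ ≤ _ := Finset.single_le_sum (f := fun w => Real.exp (x (u, w)))
          (fun _ _ => (Real.exp_pos _).le) (Finset.mem_univ w)
    have l1 : Real.log (gS u x) ≤ Real.log (Fintype.card W) + s := by
      have := Real.log_le_log (gS_pos u x) h1
      rwa [Real.log_mul (by positivity) (Real.exp_pos _).ne', Real.log_exp] at this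
    have l2 : -s ≤ Real.log (gS u x) := by
      have := Real.log_le_log (Real.exp_pos _) h2
      rwa [Real.log_exp] at this
    have l3 : |Real.log (gS u x)| ≤ Real.log (Fintype.card W) + s := abs_le.2 ⟨by linarith, l1⟩
    have l4 : a * Real.log (gS u x) ≤ Real.log (Fintype.card W) + s := by
      calc a * Real.log (gS u x) ≤ |a * Real.log (gS u x)| := le_abs_self _
        _ = |a| * |Real.log (gS u x)| := abs_mul _ _
        _ ≤ 1 * |Real.log (gS u x)| := mul_le_mul_of_nonneg_right ha (abs_nonneg _)
        _ ≤ _ := by rw [one_mul]; exact l3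
    calc gR a u x ≤ Real.exp (Real.log (Fintype.card W) + s) := Real.exp_le_exp.2 l4
      _ = _ := by rw [Real.exp_add, Real.exp_log (by positivity)]
  have hT : gT a x ≤ (Fintype.card U * Fintype.card W : ℝ) * Real.exp s := by
    calc gT a x ≤ ∑ _u : U, Fintype.card W * Real.exp s := Finset.sum_le_sum fun u _ => hR u
      _ = _ := by simp; ring
  have h1 : 1 ≤ (Fintype.card U * Fintype.card W : ℝ) * Real.exp s := by
    have := Real.one_le_exp hs0
    nlinarith [mul_le_mul hU hW (by norm_num) (by positivity)]
  have l0 := Real.log_nonneg h1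
  have l1 := Real.log_le_log (gT_pos a x) hT
  calc gF a b x ≤ Real.exp (Real.log ((Fintype.card U * Fintype.card W : ℝ) * Real.exp s)) :=
        Real.exp_le_exp.2 (by nlinarith)
    _ = _ := Real.exp_log (by linarith)

lemma gordon {ι : Type*} [Fintype ι] [DecidableEq ι] (A B : Matrix (U × W) ι ℝ)
    (hAB : A * Bᵀ = 0) (h1 : ∀ j k : U × W, k.1 = j.1 → (A * Aᵀ) j k = (B * Bᵀ) j k)
    (h2 : ∀ j k : U × W, (B * Bᵀ) j k ≤ (A * Aᵀ) j k)
    (a b : ℝ) (ha : |a| ≤ 1) (hb : 0 ≤ b) (hb1 : b ≤ 1) :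
    ∫ z, gF a b (A *ᵥ z) ∂(gam ι) ≤ ∫ z, gF a b (B *ᵥ z) ∂(gam ι) := by
  have habs : |b| ≤ 1 := by rwa [abs_of_nonneg hb]
  have hab : |a * b| ≤ 1 := by
    rw [abs_mul]; nlinarith [abs_nonneg a, abs_nonneg b]
  have hFp : ∀ x : U × W → ℝ, 0 < gF a b x := fun x => Real.exp_pos _
  have cg : ∀ {f : (U × W → ℝ) → ℝ} {d : (U × W → ℝ) → (U × W) → ℝ}, (∀ x, HG f (d x) x) →
      Continuous f := fun h => continuous_iff_continuousAt.2 fun x => (h x).continuousAt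
  have cP : ∀ j : U × W, Continuous (gP j) := fun j => cg fun x => gP_HG j x
  have cQ : ∀ u : U, Continuous (gQ (W := W) a u) := fun j => cg fun x => gQ_HG a j x
  have cF : Continuous (gF (U := U) (W := W) a b) := cg fun x => gF_HG a b x
  have hqp : ∀ (j : U × W) (x : U × W → ℝ), 0 ≤ gQ a j.1 x * gP j x ∧ gQ a j.1 x * gP j x ≤ 1 := by
    intro j x
    obtain ⟨p0, p1⟩ := gP_mem j x
    obtain ⟨q0, q1⟩ := gQ_mem a j.1 x
    exact ⟨by positivity, by nlinarith⟩
  have hF1b : ∀ (j : U × W) (x : U × W → ℝ), |gF1 a b j x| ≤ gF a b x := by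
    intro j x
    obtain ⟨p0, p1⟩ := hqp j x
    rw [gF1, abs_mul, abs_of_nonneg (mul_nonneg (hFp x).le p0)]
    have := hFp x
    calc |a * b| * (gF a b x * (gQ a j.1 x * gP j x)) ≤ 1 * (gF a b x * 1) := by gcongr
      _ = _ := by ring
  have hF2b : ∀ (j k : U × W) (x : U × W → ℝ), |gF2 a b j k x| ≤ 5 * gF a b x := by
    intro j k x
    obtain ⟨p0, p1⟩ := hqp k x
    obtain ⟨r0, r1⟩ := gP_mem k x
    have e : gF2 a b j k x = gF1 a b j x * ((if k.1 = j.1 then a * gP k x else 0)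
      - a * (gQ a k.1 x * gP k x) + (if k = j then 1 else 0)
      - (if k.1 = j.1 then gP k x else 0) + a * b * (gQ a k.1 x * gP k x)) := rfl
    rw [e, abs_mul, mul_comm]
    refine mul_le_mul ?_ (hF1b j x) (abs_nonneg _) (by norm_num)
    have t1 : |(if k.1 = j.1 then a * gP k x else 0)| ≤ 1 := by
      split_ifs
      · rw [abs_mul, abs_of_nonneg r0]; nlinarith [abs_nonneg a]
      · simp
    have t2 : |a * (gQ a k.1 x * gP k x)| ≤ 1 := by
      rw [abs_mul, abs_of_nonneg p0]; nlinarith [abs_nonneg a]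
    have t3 : |(if k = j then (1:ℝ) else 0)| ≤ 1 := by split_ifs <;> simp
    have t4 : |(if k.1 = j.1 then gP k x else 0)| ≤ 1 := by
      split_ifs
      · rw [abs_of_nonneg r0]; exact r1
      · simp
    have t5 : |a * b * (gQ a k.1 x * gP k x)| ≤ 1 := by
      rw [abs_mul, abs_of_nonneg p0]; nlinarith [abs_nonneg (a * b)]
    rw [abs_le] at *
    constructor <;> linarith [t1.1, t2.1, t3.1, t4.1, t5.1, t1.2, t2.2, t3.2, t4.2, t5.2]
  set C := (Fintype.card U * Fintype.card W : ℝ) with hC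
  have hC0 : 0 ≤ C := by positivity
  have hFC : ∀ x : U × W → ℝ, gF a b x ≤ C * Real.exp (∑ j, |x j|) :=
    fun x => gF_le a b ha hb hb1 x
  have hFC5 : ∀ x : U × W → ℝ, gF a b x ≤ 5 * C * Real.exp (∑ j, |x j|) := fun x => by
    have : 0 ≤ C * Real.exp (∑ j, |x j|) := by positivity
    linarith [hFC x]
  refine gauss_interp A B hAB (gF a b) (gF1 a b) (gF2 a b) (fun x => gF_HG a b x)
    (fun j x => gF1_HG a b j x) (fun j k => ?_) (5 * C) (by positivity)
    (fun x => ?_) (fun j x => ?_) (fun j k x => ?_) (fun x => ?_)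
  · refine Continuous.measurable ?_
    unfold gF2
    have := cP j
    have := cP k
    have := cQ j.1
    have := cQ k.1
    have c1 : Continuous fun x : U × W → ℝ => (if k.1 = j.1 then a * gP k x else 0) := by
      split_ifs <;> fun_prop
    have c2 : Continuous fun x : U × W → ℝ => (if k.1 = j.1 then gP k x else 0) := by
      split_ifs <;> fun_prop
    fun_prop
  · rw [abs_of_pos (hFp x)]; exact hFC5 x
  · exact (hF1b j x).trans (hFC5 x)
  · exact (hF2b j k x).trans (by linarith [hFC x])
  · refine Finset.sum_nonpos fun j _ => Finset.sum_nonpos fun k _ => ?_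
    by_cases hk : k.1 = j.1
    · rw [h1 j k hk]; simp
    · refine mul_nonpos_of_nonneg_of_nonpos (sub_nonneg.2 (h2 j k)) ?_
      have hk' : k ≠ j := fun e => hk (by rw [e])
      have e : gF2 a b j k x = -((1 - b) * b * a ^ 2 * gF a b x * (gQ a j.1 x * gP j x)
          * (gQ a k.1 x * gP k x)) := by
        simp only [gF2, hk, hk', if_false]; ring
      rw [e, neg_nonpos]
      have := (hqp j x).1
      have := (hqp k x).1
      have := hFp x
      have : 0 ≤ 1 - b := by linarith
      positivity

end gordon

/-! ### Part D: norm of a Gaussian vector -/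

section chi
variable {ι : Type*} [Fintype ι]

lemma euclNorm_nonneg (z : ι → ℝ) : 0 ≤ euclNorm z := Real.sqrt_nonneg _

lemma euclNorm_sq (z : ι → ℝ) : euclNorm z ^ 2 = ∑ i, z i ^ 2 :=
  Real.sq_sqrt (Finset.sum_nonneg fun _ _ => sq_nonneg _)

lemma continuous_euclNorm : Continuous (euclNorm : (ι → ℝ) → ℝ) := by
  unfold euclNorm; fun_prop

lemma abs_le_euclNorm (z : ι → ℝ) (i : ι) : |z i| ≤ euclNorm z := by
  refine Real.le_sqrt_of_sq_le ?_
  rw [sq_abs]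
  exact Finset.single_le_sum (f := fun i => z i ^ 2) (fun _ _ => sq_nonneg _) (Finset.mem_univ i)

lemma euclNorm_le_sum (z : ι → ℝ) : euclNorm z ≤ ∑ i, |z i| := by
  refine Real.sqrt_le_iff.2 ⟨by positivity, ?_⟩
  have := Finset.sum_sq_le_sq_sum_of_nonneg (s := Finset.univ) (f := fun i => |z i|)
    (fun _ _ => abs_nonneg _)
  simpa using this

lemma euclNorm_eq_zero {z : ι → ℝ} (h : euclNorm z = 0) : z = 0 := by
  funext i
  have := abs_le_euclNorm z i
  rw [h] at this
  exact abs_nonpos_iff.1 this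

lemma hasDerivAt_mul_of_continuousAt {κ : ℝ → ℝ} (h : ContinuousAt κ 0) :
    HasDerivAt (fun s => s * κ s) (κ 0) 0 := by
  rw [hasDerivAt_iff_tendsto_slope]
  have : Tendsto κ (nhdsWithin 0 {0}ᶜ) (nhds (κ 0)) := h.tendsto.mono_left nhdsWithin_le_nhds
  refine this.congr' ?_
  filter_upwards [self_mem_nhdsWithin] with s hs
  simp only [Set.mem_compl_iff, Set.mem_singleton_iff] at hs
  simp [slope, hs]

lemma chi_stein [DecidableEq ι] {k k' : ℝ → ℝ} (hk : ∀ r, HasDerivAt k (k' r) r)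
    (mk' : Measurable k') (C c : ℝ) (hC : 0 ≤ C) (hc : 0 ≤ c)
    (b : ∀ r, 0 ≤ r → |k r| ≤ C * Real.exp (c * r))
    (b' : ∀ r, 0 ≤ r → |k' r| ≤ C * Real.exp (c * r)) :
    ∫ z : ι → ℝ, euclNorm z ^ 2 * k (euclNorm z) ∂(gam ι)
      = Fintype.card ι * ∫ z : ι → ℝ, k (euclNorm z) ∂(gam ι)
        + ∫ z : ι → ℝ, euclNorm z * k' (euclNorm z) ∂(gam ι) := by
  have ck : Continuous k := continuous_iff_continuousAt.2 fun r => (hk r).continuousAt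
  have cN := continuous_euclNorm (ι := ι)
  have hexp : ∀ z : ι → ℝ, C * Real.exp (c * euclNorm z) ≤ C * Real.exp (c * ∑ i, |z i|) :=
    fun z => mul_le_mul_of_nonneg_left (Real.exp_le_exp.2
      (mul_le_mul_of_nonneg_left (euclNorm_le_sum z) hc)) hC
  have hNe : ∀ z : ι → ℝ, euclNorm z ≤ Real.exp (∑ i, |z i|) := fun z => by
    linarith [euclNorm_le_sum z, Real.add_one_le_exp (∑ i, |z i|)]
  have hst : ∀ i : ι, Integrable (fun z : ι → ℝ => z i * (z i * k (euclNorm z))) (gam ι) ∧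
      ∫ z : ι → ℝ, z i * (z i * k (euclNorm z)) ∂(gam ι) =
      ∫ z : ι → ℝ, (k (euclNorm z) + z i ^ 2 / euclNorm z * k' (euclNorm z)) ∂(gam ι) := by
    intro i
    refine stein i ?_ ?_ ?_ C (c + 1) (2 * C) (c + 1) ?_ ?_
    · exact ((continuous_apply i).mul (ck.comp cN)).measurable
    · have h1 : Measurable fun z : ι → ℝ => k (euclNorm z) := (ck.comp cN).measurable
      have h2 : Measurable fun z : ι → ℝ => k' (euclNorm z) := mk'.comp cN.measurable
      exact h1.add ((((measurable_pi_apply i).pow_const 2).div cN.measurable).mul h2)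
    · intro z
      by_cases hz : euclNorm z = 0
      · have hz' := euclNorm_eq_zero hz
        subst hz'
        have := hasDerivAt_mul_of_continuousAt
          (κ := fun s => k (euclNorm (Function.update (0 : ι → ℝ) i s)))
          ((ck.comp (cN.comp (continuous_const.update i continuous_id))).continuousAt)
        have e : Function.update (0 : ι → ℝ) i 0 = 0 := by simp
        simp only [e] at this
        simpa [hz] using this
      · have hsq : HasDerivAt (fun s => ∑ j, (Function.update z i s j) ^ 2) (2 * z i) (z i) := by
          have : ∀ j ∈ (Finset.univ : Finset ι), HasDerivAt (fun s => Function.update z i s j ^ 2)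
            (if j = i then 2 * z i else 0) (z i) := by
            intro j _
            by_cases h : j = i
            · subst h; simpa using (hasDerivAt_id (z j)).fun_pow 2
            · simp only [Function.update_of_ne h, if_neg h]; exact hasDerivAt_const _ _
          refine (HasDerivAt.fun_sum this).congr_deriv ?_
          simp
        have hne : ∑ j, (Function.update z i (z i) j) ^ 2 ≠ 0 := by
          rw [Function.update_eq_self, ← euclNorm_sq]; positivity
        have hN : HasDerivAt (fun s => euclNorm (Function.update z i s)) (z i / euclNorm z) (z i) := by
          refine (hsq.sqrt hne).congr_deriv ?_
          rw [Function.update_eq_self]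
          change 2 * z i / (2 * euclNorm z) = _
          field_simp
        have hkk : HasDerivAt k (k' (euclNorm z)) (euclNorm (Function.update z i (z i))) := by
          rw [Function.update_eq_self]; exact hk _
        have := (hasDerivAt_id (z i)).mul (hkk.comp (z i) hN)
        simp only [Function.update_self]
        refine this.congr_deriv ?_
        simp
        ring
    · intro z
      rw [abs_mul, add_mul, one_mul, Real.exp_add]
      calc |z i| * |k (euclNorm z)| ≤ Real.exp (∑ i, |z i|) * (C * Real.exp (c * ∑ i, |z i|)) :=
            mul_le_mul ((abs_le_euclNorm z i).trans (hNe z))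
              ((b _ (euclNorm_nonneg z)).trans (hexp z)) (abs_nonneg _) (Real.exp_pos _).le
        _ = _ := by ring
    · intro z
      have h1 : |z i ^ 2 / euclNorm z| ≤ Real.exp (∑ i, |z i|) := by
        rw [abs_of_nonneg (div_nonneg (sq_nonneg _) (euclNorm_nonneg z))]
        refine (div_le_of_le_mul₀ (euclNorm_nonneg z) (euclNorm_nonneg z) ?_).trans (hNe z)
        have := abs_le_euclNorm z i
        rw [← sq_abs]; nlinarith [abs_nonneg (z i)]
      have h2 := (b _ (euclNorm_nonneg z)).trans (hexp z)
      have h3 := (b' _ (euclNorm_nonneg z)).trans (hexp z)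
      have h4 : 1 ≤ Real.exp (∑ i, |z i|) := Real.one_le_exp (by positivity)
      have h5 : |z i ^ 2 / euclNorm z| * |k' (euclNorm z)| ≤
        Real.exp (∑ i, |z i|) * (C * Real.exp (c * ∑ i, |z i|)) :=
        mul_le_mul h1 h3 (abs_nonneg _) (Real.exp_pos _).le
      refine (abs_add_le _ _).trans ?_
      rw [abs_mul, add_mul, one_mul, Real.exp_add]
      have h6 : 0 ≤ C * Real.exp (c * ∑ i, |z i|) := by positivity
      nlinarith
  have intk : Integrable (fun z : ι → ℝ => k (euclNorm z)) (gam ι) :=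
    integrable_of_exp_bound (ck.comp cN).measurable C c fun z =>
      (b _ (euclNorm_nonneg z)).trans (hexp z)
  have e1 : ∀ z : ι → ℝ, euclNorm z ^ 2 * k (euclNorm z) = ∑ i, z i * (z i * k (euclNorm z)) := by
    intro z
    rw [euclNorm_sq, Finset.sum_mul]
    refine Finset.sum_congr rfl fun i _ => by ring
  have e2 : ∀ z : ι → ℝ, euclNorm z * k' (euclNorm z)
      = ∑ i, z i ^ 2 / euclNorm z * k' (euclNorm z) := by
    intro z
    rw [← Finset.sum_mul, ← Finset.sum_div, ← euclNorm_sq]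
    congr 1
    by_cases h : euclNorm z = 0
    · simp [h]
    · field_simp
  have intk' : ∀ i, Integrable (fun z : ι → ℝ => z i ^ 2 / euclNorm z * k' (euclNorm z)) (gam ι) := by
    intro i
    have h2 : Measurable fun z : ι → ℝ => k' (euclNorm z) := mk'.comp cN.measurable
    refine integrable_of_exp_bound ((((measurable_pi_apply i).pow_const 2).div
      cN.measurable).mul h2) C (c + 1) fun z => ?_
    have h1 : |z i ^ 2 / euclNorm z| ≤ Real.exp (∑ i, |z i|) := by
      rw [abs_of_nonneg (div_nonneg (sq_nonneg _) (euclNorm_nonneg z))]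
      refine (div_le_of_le_mul₀ (euclNorm_nonneg z) (euclNorm_nonneg z) ?_).trans (hNe z)
      have := abs_le_euclNorm z i
      rw [← sq_abs]; nlinarith [abs_nonneg (z i)]
    rw [abs_mul, add_mul, one_mul, Real.exp_add]
    calc _ ≤ Real.exp (∑ i, |z i|) * (C * Real.exp (c * ∑ i, |z i|)) :=
          mul_le_mul h1 ((b' _ (euclNorm_nonneg z)).trans (hexp z)) (abs_nonneg _) (Real.exp_pos _).le
      _ = _ := by ring
  simp_rw [e1, e2]
  rw [integral_finsetSum _ fun i _ => (hst i).1, integral_finsetSum _ fun i _ => intk' i]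
  simp_rw [(hst _).2]
  rw [Finset.sum_congr rfl fun i _ => integral_add intk (intk' i), Finset.sum_add_distrib]
  simp

/-- Exponential moments of the norm. -/
def cM (ι : Type*) [Fintype ι] (m : ℕ) (l : ℝ) : ℝ :=
  ∫ z : ι → ℝ, euclNorm z ^ m * Real.exp (l * euclNorm z) ∂(gam ι)

lemma cM_int (m : ℕ) (l : ℝ) :
    Integrable (fun z : ι → ℝ => euclNorm z ^ m * Real.exp (l * euclNorm z)) (gam ι) := by
  have cN := continuous_euclNorm (ι := ι)
  refine integrable_of_exp_bound (by fun_prop) 1 (m + |l|) fun z => ?_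
  have h0 := euclNorm_nonneg z
  rw [abs_of_nonneg (by positivity), one_mul, add_mul, Real.exp_add]
  have h1 : euclNorm z ≤ Real.exp (∑ i, |z i|) := by
    linarith [euclNorm_le_sum z, Real.add_one_le_exp (∑ i, |z i|)]
  have h2 : l * euclNorm z ≤ |l| * ∑ i, |z i| :=
    mul_le_mul (le_abs_self _) (euclNorm_le_sum z) h0 (abs_nonneg _)
  refine mul_le_mul ?_ (Real.exp_le_exp.2 h2) (Real.exp_pos _).le (Real.exp_pos _).le
  rw [Real.exp_nat_mul]
  exact pow_le_pow_left₀ h0 h1 m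

lemma cM_cs (m : ℕ) (l : ℝ) (h : 0 < cM ι m l) : 
    cM ι (m + 1) l ^ 2 ≤ cM ι m l * cM ι (m + 2) l := by
  set t := cM ι (m + 1) l / cM ι m l with ht
  have key : 0 ≤ cM ι (m + 2) l - 2 * t * cM ι (m + 1) l + t ^ 2 * cM ι m l := by
    have e : cM ι (m + 2) l - 2 * t * cM ι (m + 1) l + t ^ 2 * cM ι m l
        = ∫ z : ι → ℝ, euclNorm z ^ m * (euclNorm z - t) ^ 2 * Real.exp (l * euclNorm z) ∂(gam ι) := by
      unfold cM
      have hsub : Integrable (fun z : ι → ℝ => euclNorm z ^ (m + 2) * Real.exp (l * euclNorm z)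
          - 2 * t * (euclNorm z ^ (m + 1) * Real.exp (l * euclNorm z))) (gam ι) :=
        (cM_int _ _).sub ((cM_int _ _).const_mul _)
      rw [← integral_const_mul, ← integral_const_mul, ← integral_sub (cM_int _ _)
        ((cM_int _ _).const_mul _), ← integral_add hsub
        ((cM_int _ _).const_mul _)]
      refine integral_congr_ae (ae_of_all _ fun z => ?_)
      simp only
      ring
    rw [e]
    refine integral_nonneg fun z => ?_
    have := euclNorm_nonneg z
    positivity
  have e2 : cM ι (m + 2) l - 2 * t * cM ι (m + 1) l + t ^ 2 * cM ι m l
      = (cM ι m l * cM ι (m + 2) l - cM ι (m + 1) l ^ 2) / cM ι m l := by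
    rw [ht]; field_simp; ring
  rw [e2] at key
  have := (div_nonneg_iff.1 key)
  rcases this with h1 | h1
  · linarith [h1.1]
  · linarith [h1.2]

lemma cM0_pos (l : ℝ) : 0 < cM ι 0 l := by
  have h := cM_int (ι := ι) 0 l
  unfold cM
  simp only [pow_zero, one_mul] at h ⊢
  exact integral_exp_pos h

lemma cM2 (l : ℝ) : cM ι 2 l = Fintype.card ι * cM ι 0 l + l * cM ι 1 l := by
  classical
  have h := chi_stein (ι := ι) (k := fun r => Real.exp (l * r)) (k' := fun r => l * Real.exp (l * r))
    (fun r => by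
      refine ((hasDerivAt_id r).const_mul l).exp.congr_deriv ?_
      simp; ring) (by fun_prop) (1 + |l|) |l| (by positivity) (by positivity)
    (fun r hr => by
      have h1 : Real.exp (l * r) ≤ Real.exp (|l| * r) :=
        Real.exp_le_exp.2 (mul_le_mul_of_nonneg_right (le_abs_self _) hr)
      rw [abs_of_pos (Real.exp_pos _)]
      nlinarith [abs_nonneg l, Real.exp_pos (|l| * r)])
    (fun r hr => by
      have h1 : Real.exp (l * r) ≤ Real.exp (|l| * r) :=
        Real.exp_le_exp.2 (mul_le_mul_of_nonneg_right (le_abs_self _) hr)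
      rw [abs_mul, abs_of_pos (Real.exp_pos _)]
      nlinarith [abs_nonneg l, Real.exp_pos (|l| * r)])
  unfold cM
  rw [h, ← integral_const_mul l]
  simp only [pow_zero, one_mul, pow_one]
  congr 1
  refine integral_congr_ae (ae_of_all _ fun z => ?_)
  simp only
  ring

lemma cM3 (l : ℝ) : cM ι 3 l = (Fintype.card ι + 1) * cM ι 1 l + l * cM ι 2 l := by
  classical
  have h := chi_stein (ι := ι) (k := fun r => r * Real.exp (l * r))
    (k' := fun r => Real.exp (l * r) + l * (r * Real.exp (l * r)))
    (fun r => by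
      refine ((hasDerivAt_id r).mul ((hasDerivAt_id r).const_mul l).exp).congr_deriv ?_
      simp; ring) (by fun_prop) (1 + |l|) (|l| + 1) (by positivity) (by positivity)
    (fun r hr => by
      have h1 : Real.exp (l * r) ≤ Real.exp (|l| * r) :=
        Real.exp_le_exp.2 (mul_le_mul_of_nonneg_right (le_abs_self _) hr)
      have h2 : r ≤ Real.exp r := by linarith [Real.add_one_le_exp r]
      have he : Real.exp ((|l| + 1) * r) = Real.exp (|l| * r) * Real.exp r := by
        rw [add_mul, one_mul, Real.exp_add]
      rw [abs_of_nonneg (by positivity), he, mul_comm r]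
      have h3 := mul_le_mul h1 h2 hr (Real.exp_pos _).le
      have : 0 ≤ |l| * (Real.exp (|l| * r) * Real.exp r) := by positivity
      nlinarith)
    (fun r hr => by
      have h1 : Real.exp (l * r) ≤ Real.exp (|l| * r) :=
        Real.exp_le_exp.2 (mul_le_mul_of_nonneg_right (le_abs_self _) hr)
      have h2 : r ≤ Real.exp r := by linarith [Real.add_one_le_exp r]
      have h4 : 1 ≤ Real.exp r := Real.one_le_exp hr
      have he : Real.exp ((|l| + 1) * r) = Real.exp (|l| * r) * Real.exp r := by
        rw [add_mul, one_mul, Real.exp_add]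
      refine (abs_add_le _ _).trans ?_
      rw [abs_mul, abs_of_nonneg (by positivity : 0 ≤ r * Real.exp (l * r)),
        abs_of_pos (Real.exp_pos _), he, mul_comm r]
      have h3 := mul_le_mul h1 h2 hr (Real.exp_pos _).le
      have h5 := mul_le_mul_of_nonneg_left h3 (abs_nonneg l)
      have h6 := mul_le_mul h1 h4 zero_le_one (Real.exp_pos _).le
      linarith)
  have e0 : cM ι 3 l = ∫ z : ι → ℝ, euclNorm z ^ 2 * (euclNorm z * Real.exp (l * euclNorm z)) ∂(gam ι) := by
    unfold cM
    refine integral_congr_ae (ae_of_all _ fun z => ?_)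
    simp only
    ring
  have e1 : ∫ z : ι → ℝ, euclNorm z * (Real.exp (l * euclNorm z) + l * (euclNorm z * Real.exp (l * euclNorm z))) ∂(gam ι)
      = cM ι 1 l + l * cM ι 2 l := by
    unfold cM
    rw [← integral_const_mul, ← integral_add (cM_int _ _) ((cM_int _ _).const_mul _)]
    refine integral_congr_ae (ae_of_all _ fun z => ?_)
    simp only
    ring
  rw [e0, h, e1]
  unfold cM
  simp only [pow_one]
  ring

lemma cM0_deriv (l : ℝ) : HasDerivAt (cM ι 0) (cM ι 1 l) l := by
  have h0 : ∀ l, Integrable (fun z : ι → ℝ => Real.exp (l * euclNorm z)) (gam ι) := fun l => by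
    simpa using cM_int (ι := ι) 0 l
  have hs : integrableExpSet (euclNorm : (ι → ℝ) → ℝ) (gam ι) = Set.univ :=
    Set.eq_univ_of_forall fun l => h0 l
  have := hasDerivAt_mgf (X := (euclNorm : (ι → ℝ) → ℝ)) (μ := gam ι) (t := l) (by rw [hs]; simp)
  have e : cM ι 0 = mgf euclNorm (gam ι) := by
    funext l; simp [cM, mgf]
  rw [e]
  refine this.congr_deriv ?_
  simp [cM]

lemma chi_upper (l : ℝ) (hl : 0 ≤ l) :
    cM ι 0 l ≤ Real.exp (l * √(Fintype.card ι) + l ^ 2 / 2) := by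
  set n : ℝ := (Fintype.card ι : ℝ) with hn
  have hr : ∀ l, 0 ≤ l → cM ι 1 l / cM ι 0 l ≤ √n + l := by
    intro l hl
    have h0 := cM0_pos (ι := ι) l
    have hcs := cM_cs (ι := ι) 0 l h0
    rw [zero_add, zero_add, cM2] at hcs
    set r := cM ι 1 l / cM ι 0 l with hr
    have e1 : cM ι 1 l = r * cM ι 0 l := by rw [hr]; field_simp
    rw [e1] at hcs
    have : r ^ 2 ≤ n + l * r := by
      by_contra hcon
      push Not at hcon
      have := mul_lt_mul_of_pos_right hcon (pow_pos h0 2)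
      nlinarith
    by_contra hcon
    push Not at hcon
    have hs := Real.sq_sqrt (show 0 ≤ n by positivity)
    nlinarith [Real.sqrt_nonneg n]
  have hanti : AntitoneOn (fun l => Real.log (cM ι 0 l) - (l * √n + l ^ 2 / 2)) (Set.Ici 0) := by
    have hd : ∀ l, HasDerivAt (fun l => Real.log (cM ι 0 l) - (l * √n + l ^ 2 / 2))
        (cM ι 1 l / cM ι 0 l - (√n + l)) l := by
      intro l
      refine (((cM0_deriv l).log (cM0_pos l).ne').sub (((hasDerivAt_id l).mul_const √n).add
        (((hasDerivAt_id l).fun_pow 2).div_const 2))).congr_deriv ?_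
      simp
    refine antitoneOn_of_deriv_nonpos (convex_Ici _)
      (fun l _ => (hd l).continuousAt.continuousWithinAt)
      (fun l _ => (hd l).differentiableAt.differentiableWithinAt) fun l hl => ?_
    rw [interior_Ici] at hl
    rw [(hd l).deriv]
    linarith [hr l (le_of_lt hl)]
  have h := hanti (Set.mem_Ici.2 le_rfl) (Set.mem_Ici.2 hl) hl
  have e0 : cM ι 0 0 = 1 := by simp [cM]
  simp only [e0, Real.log_one] at h
  rw [← Real.log_le_iff_le_exp (cM0_pos l)]
  linarith

lemma chi_lower (l : ℝ) (hl : 0 ≤ l) :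
    cM ι 0 (-l) ≤ Real.exp (-l * (Fintype.card ι / √(Fintype.card ι + 1)) + l ^ 2 / 2) := by
  set n : ℝ := (Fintype.card ι : ℝ) with hn
  have hn0 : 0 ≤ n := by positivity
  set c := n / √(n + 1) with hc
  have hc2 : c ^ 2 * (n + 1) = n ^ 2 := by
    rw [hc, div_pow, Real.sq_sqrt (by positivity)]; field_simp
  have hc0 : 0 ≤ c := by positivity
  have hr : ∀ l, 0 ≤ l → c - l ≤ cM ι 1 (-l) / cM ι 0 (-l) := by
    intro l hl
    have h0 := cM0_pos (ι := ι) (-l)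
    have h1n : 0 ≤ cM ι 1 (-l) := integral_nonneg fun z => by
      have := euclNorm_nonneg z
      positivity
    rcases h1n.eq_or_lt with h1 | h1
    · -- degenerate case
      have h2 := cM2 (ι := ι) (-l)
      have h3 := cM3 (ι := ι) (-l)
      have hp : 0 ≤ cM ι 2 (-l) := integral_nonneg fun z => by
        have := euclNorm_nonneg z
        positivity
      have hp3 : 0 ≤ cM ι 3 (-l) := integral_nonneg fun z => by
        have := euclNorm_nonneg z
        positivity
      rw [← h1] at h2 h3 ⊢
      by_contra hcon
      push Not at hcon
      simp only [zero_div] at hcon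
      have hnp : 0 < n := by
        rcases hn0.eq_or_lt with e | e
        · exfalso
          rw [← e] at hc; simp at hc; linarith
        · exact e
      -- second moment positive forces contradiction through a.e. vanishing
      have hz : (fun z : ι → ℝ => euclNorm z ^ 1 * Real.exp (-l * euclNorm z)) =ᵐ[gam ι] 0 := by
        refine (integral_eq_zero_iff_of_nonneg (fun z => ?_) (cM_int 1 (-l))).1 h1.symm
        have := euclNorm_nonneg z
        simp only [Pi.zero_apply]
        positivity
      have hz2 : cM ι 2 (-l) = 0 := by
        unfold cM
        rw [← integral_zero (α := ι → ℝ) (G := ℝ) (μ := gam ι)]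
        refine integral_congr_ae ?_
        filter_upwards [hz] with z hz
        have : euclNorm z = 0 := by
          simpa [(Real.exp_pos _).ne'] using hz
        simp [this]
      have := mul_pos hnp h0
      linarith
    · have hcs := cM_cs (ι := ι) 1 (-l) h1
      have e2 := cM2 (ι := ι) (-l)
      have e3 := cM3 (ι := ι) (-l)
      rw [show 1 + 1 = 2 from rfl, show 1 + 2 = 3 from rfl, e3] at hcs
      rw [← hn] at e2 hcs
      set M1 := cM ι 1 (-l)
      set M0 := cM ι 0 (-l)
      set M2 := cM ι 2 (-l)
      set r := M1 / M0 with hr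
      have hrp : 0 ≤ r := by positivity
      have e1 : M1 = r * M0 := by rw [hr]; field_simp
      have k1 : n * (n - l * r) ≤ (n + 1) * r ^ 2 := by
        rw [e1] at e2 hcs
        have : M2 = M0 * (n - l * r) := by rw [e2]; ring
        rw [this] at hcs
        by_contra hcon
        push Not at hcon
        have := mul_lt_mul_of_pos_right hcon (pow_pos h0 2)
        nlinarith
      by_contra hcon
      push Not at hcon
      have k2 : (r + l) ^ 2 < c ^ 2 := by nlinarith
      have k3 : (n + 1) * (r + l) ^ 2 < n ^ 2 := by nlinarith
      nlinarith [mul_nonneg hl hrp, mul_nonneg hn0 (mul_nonneg hl hrp), sq_nonneg l,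
        mul_nonneg hn0 (sq_nonneg l)]
  have hanti : AntitoneOn (fun l => Real.log (cM ι 0 (-l)) - (-l * c + l ^ 2 / 2)) (Set.Ici 0) := by
    have hd : ∀ l, HasDerivAt (fun l => Real.log (cM ι 0 (-l)) - (-l * c + l ^ 2 / 2))
        (-(cM ι 1 (-l) / cM ι 0 (-l)) - (-c + l)) l := by
      intro l
      have h1 : HasDerivAt (fun l => cM ι 0 (-l)) (cM ι 1 (-l) * -1) l :=
        (cM0_deriv (-l)).comp l (hasDerivAt_neg l)
      refine ((h1.log (cM0_pos (-l)).ne').sub (((hasDerivAt_neg l).mul_const c).add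
        (((hasDerivAt_id l).fun_pow 2).div_const 2))).congr_deriv ?_
      simp
      ring
    refine antitoneOn_of_deriv_nonpos (convex_Ici _)
      (fun l _ => (hd l).continuousAt.continuousWithinAt)
      (fun l _ => (hd l).differentiableAt.differentiableWithinAt) fun l hl => ?_
    rw [interior_Ici] at hl
    rw [(hd l).deriv]
    linarith [hr l (le_of_lt hl)]
  have h := hanti (Set.mem_Ici.2 le_rfl) (Set.mem_Ici.2 hl) hl
  have e0 : cM ι 0 0 = 1 := by simp [cM]
  simp only [neg_zero, e0, Real.log_one] at h
  rw [← Real.log_le_iff_le_exp (cM0_pos (-l))]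
  linarith

end chi

/-! ### Part E: Gaussian matrix comparison, finite index sets -/

section splitting
variable {ι κ : Type*} [Fintype ι] [Fintype κ]

lemma gam_sum_map : (gam (ι ⊕ κ)).map (MeasurableEquiv.sumPiEquivProdPi (fun _ : ι ⊕ κ => ℝ))
    = (gam ι).prod (gam κ) := by
  have := (measurePreserving_sumPiEquivProdPi (fun _ : ι ⊕ κ => gaussianReal 0 1)).map_eq
  simpa [gam] using this

lemma gam_sum_mul (f : (ι → ℝ) → ℝ) (g : (κ → ℝ) → ℝ) :
    ∫ z : ι ⊕ κ → ℝ, f (fun i => z (Sum.inl i)) * g (fun i => z (Sum.inr i)) ∂(gam (ι ⊕ κ))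
      = (∫ x, f x ∂(gam ι)) * ∫ y, g y ∂(gam κ) := by
  rw [← integral_prod_mul, ← gam_sum_map, integral_map_equiv]
  rfl

lemma gam_sum_inr (g : (κ → ℝ) → ℝ) :
    ∫ z : ι ⊕ κ → ℝ, g (fun i => z (Sum.inr i)) ∂(gam (ι ⊕ κ)) = ∫ y, g y ∂(gam κ) := by
  have := gam_sum_mul (ι := ι) (fun _ => 1) g
  simpa using this

lemma gam_sum_inl (f : (ι → ℝ) → ℝ) :
    ∫ z : ι ⊕ κ → ℝ, f (fun i => z (Sum.inl i)) ∂(gam (ι ⊕ κ)) = ∫ y, f y ∂(gam ι) := by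
  have := gam_sum_mul (κ := κ) f (fun _ => 1)
  simpa using this

lemma gam_unit_exp (l : ℝ) : ∫ z : Unit → ℝ, Real.exp (l * z ()) ∂(gam Unit) = Real.exp (l ^ 2 / 2) := by
  have h := integral_fintype_prod_eq_prod (ι := Unit) (𝕜 := ℝ) (E := fun _ => ℝ)
    (μ := fun _ => gaussianReal 0 1) (fun _ s => Real.exp (l * s))
  have h2 := congrFun (mgf_id_gaussianReal (μ := 0) (v := 1)) l
  simp only [mgf, id] at h2
  simp only [Finset.univ_unique, PUnit.default_eq_unit, Finset.prod_singleton] at h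
  unfold gam
  rw [h, h2]
  simp
end splitting

section matcmp
variable {ν κ : Type*} [Fintype ν] [Fintype κ]

lemma ip_le (x y : ν → ℝ) : ∑ i, x i * y i ≤ euclNorm x * euclNorm y :=
  Real.sum_mul_le_sqrt_mul_sqrt _ _ _

lemma ip_ge (x y : ν → ℝ) : -(euclNorm x * euclNorm y) ≤ ∑ i, x i * y i := by
  have h := ip_le (fun i => - x i) y
  have : euclNorm (fun i => - x i) = euclNorm x := by unfold euclNorm; simp
  rw [this] at h
  simp only [neg_mul, Finset.sum_neg_distrib] at h
  linarith

/-- matrix-vector product for an array indexed by pairs. -/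
def mv (G : κ × ν → ℝ) (u : ν → ℝ) : κ → ℝ := fun i => ∑ k, G (i, k) * u k

variable {U W : Type*} [Fintype U] [Fintype W] [DecidableEq U] [DecidableEq W]
  [Nonempty U] [Nonempty W]

lemma gF_shift (a b c : ℝ) (x : U × W → ℝ) :
    gF a b (fun j => x j + c) = Real.exp (a * b * c) * gF a b x := by
  have hS : ∀ u, gS u (fun j => x j + c) = gS u x * Real.exp c := by
    intro u; simp only [gS, Real.exp_add, Finset.sum_mul]
  have hR : ∀ u, gR a u (fun j => x j + c) = gR a u x * Real.exp (a * c) := by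
    intro u
    unfold gR
    rw [hS, Real.log_mul (gS_pos u x).ne' (Real.exp_pos _).ne', Real.log_exp, mul_add, Real.exp_add]
  have hT : gT a (fun j => x j + c) = gT a x * Real.exp (a * c) := by
    unfold gT; simp only [hR, Finset.sum_mul]
  unfold gF
  rw [hT, Real.log_mul (gT_pos a x).ne' (Real.exp_pos _).ne', Real.log_exp, mul_add, Real.exp_add,
    mul_comm]
  congr 2; ring

variable [DecidableEq ν] [DecidableEq κ]

lemma gordon_fin (a : ℝ) (ha : a ^ 2 = 1) (l β : ℝ) (hl : 0 ≤ l) (hβ : 0 < β) (hlβ : l ≤ β)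
    (uu : U → ν → ℝ) (ww : W → κ → ℝ) (hu : ∀ u, euclNorm (uu u) = 1) (hw : ∀ w, euclNorm (ww w) = 1) :
    Real.exp (l ^ 2 / 2) * ∫ G : κ × ν → ℝ, gF a (l / β)
        (fun j : U × W => β * ∑ i, mv G (uu j.1) i * ww j.2 i) ∂(gam (κ × ν))
      ≤ ∫ z : ν ⊕ κ → ℝ, gF a (l / β) (fun j : U × W => β * (∑ k, z (Sum.inl k) * uu j.1 k
          + ∑ i, z (Sum.inr i) * ww j.2 i)) ∂(gam (ν ⊕ κ)) := by
  let A : Matrix (U × W) (((κ × ν) ⊕ Unit) ⊕ (ν ⊕ κ)) ℝ := Matrix.of fun j =>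
    Sum.elim (Sum.elim (fun q => β * (uu j.1 q.2 * ww j.2 q.1)) (fun _ => β)) (fun _ => 0)
  let B : Matrix (U × W) (((κ × ν) ⊕ Unit) ⊕ (ν ⊕ κ)) ℝ := Matrix.of fun j =>
    Sum.elim (fun _ => 0) (Sum.elim (fun k => β * uu j.1 k) (fun i => β * ww j.2 i))
  have hAA : ∀ j k, (A * Aᵀ) j k = β ^ 2 * ((∑ i, uu j.1 i * uu k.1 i) * (∑ i, ww j.2 i * ww k.2 i) + 1) := by
    intro j k
    simp only [A, Matrix.mul_apply, Matrix.transpose_apply, Matrix.of_apply, Fintype.sum_sum_type,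
      Sum.elim_inl, Sum.elim_inr, Fintype.sum_prod_type, mul_zero, Finset.sum_const_zero, add_zero,
      Finset.univ_unique, Finset.sum_singleton, mul_add, Finset.mul_sum, Finset.sum_mul]
    congr 1
    · refine Finset.sum_congr rfl fun i _ => Finset.sum_congr rfl fun k _ => ?_
      ring
    · ring
  have hBB : ∀ j k, (B * Bᵀ) j k = β ^ 2 * ((∑ i, uu j.1 i * uu k.1 i) + (∑ i, ww j.2 i * ww k.2 i)) := by
    intro j k
    simp only [B, Matrix.mul_apply, Matrix.transpose_apply, Matrix.of_apply, Fintype.sum_sum_type,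
      Sum.elim_inl, Sum.elim_inr, mul_zero, Finset.sum_const_zero, zero_add,
      mul_add, Finset.mul_sum]
    congr 1 <;>
    · refine Finset.sum_congr rfl fun i _ => ?_
      ring
  have hAB : A * Bᵀ = 0 := by
    ext j k
    simp [A, B, Matrix.mul_apply, Fintype.sum_sum_type]
  have hu1 : ∀ u, ∑ i, uu u i * uu u i = 1 := fun u => by
    have := euclNorm_sq (uu u); rw [hu] at this; simp only [pow_two] at this; linarith
  have hul : ∀ u u', ∑ i, uu u i * uu u' i ≤ 1 := fun u u' => by
    have := ip_le (uu u) (uu u'); rw [hu, hu] at this; linarith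
  have hwl : ∀ u u', ∑ i, ww u i * ww u' i ≤ 1 := fun u u' => by
    have := ip_le (ww u) (ww u'); rw [hw, hw] at this; linarith
  have ha1 : |a| ≤ 1 := by
    rw [← sq_le_one_iff_abs_le_one, ha]
  have hg := gordon A B hAB
    (fun j k hjk => by rw [hAA, hBB, hjk, hu1]; ring)
    (fun j k => by
      rw [hAA, hBB]
      refine mul_le_mul_of_nonneg_left ?_ (sq_nonneg _)
      nlinarith [hul j.1 k.1, hwl j.2 k.2]) a (l / β) ha1 (by positivity)
      ((div_le_one hβ).2 hlβ)
  have eA : ∀ z, A *ᵥ z = fun j => β * (∑ i, mv (fun q => z (Sum.inl (Sum.inl q))) (uu j.1) i * ww j.2 i)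
      + β * z (Sum.inl (Sum.inr ())) := by
    intro z; funext j
    simp only [A, Matrix.mulVec, dotProduct, Matrix.of_apply, Fintype.sum_sum_type,
      Sum.elim_inl, Sum.elim_inr, Fintype.sum_prod_type, zero_mul, Finset.sum_const_zero, add_zero,
      Finset.univ_unique, Finset.sum_singleton, Finset.mul_sum, mv, Finset.sum_mul]
    congr 1
    refine Finset.sum_congr rfl fun i _ => Finset.sum_congr rfl fun k _ => ?_
    ring
  have eB : ∀ z, B *ᵥ z = fun j => β * (∑ k, z (Sum.inr (Sum.inl k)) * uu j.1 k
          + ∑ i, z (Sum.inr (Sum.inr i)) * ww j.2 i) := by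
    intro z; funext j
    simp only [B, Matrix.mulVec, dotProduct, Matrix.of_apply, Fintype.sum_sum_type,
      Sum.elim_inl, Sum.elim_inr, zero_mul, Finset.sum_const_zero, zero_add, mul_add, Finset.mul_sum]
    congr 1 <;>
    · refine Finset.sum_congr rfl fun i _ => ?_
      ring
  simp only [eA, eB, gF_shift] at hg
  rw [gam_sum_inr (ι := (κ × ν) ⊕ Unit) (fun z : ν ⊕ κ → ℝ => gF a (l / β) (fun j : U × W => β * (∑ k, z (Sum.inl k) * uu j.1 k
          + ∑ i, z (Sum.inr i) * ww j.2 i))),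
    gam_sum_inl (fun z : (κ × ν) ⊕ Unit → ℝ => Real.exp (a * (l / β) * (β * z (Sum.inr ()))) *
      gF a (l / β) (fun j : U × W => β * ∑ i, mv (fun q => z (Sum.inl q)) (uu j.1) i * ww j.2 i))] at hg
  refine le_trans (le_of_eq ?_) hg
  have h2 := gam_sum_mul (fun G : κ × ν → ℝ => gF a (l / β) (fun j : U × W => β * ∑ i, mv G (uu j.1) i * ww j.2 i))
    (fun y : Unit → ℝ => Real.exp (a * l * y ()))
  rw [gam_unit_exp] at h2
  have e3 : (a * l) ^ 2 / 2 = l ^ 2 / 2 := by rw [mul_pow, ha, one_mul]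
  rw [e3] at h2
  rw [mul_comm, ← h2]
  refine integral_congr_ae (ae_of_all _ fun z => ?_)
  simp only
  rw [mul_comm]
  congr 2
  field_simp

lemma continuous_gF (a b : ℝ) : Continuous (gF (U := U) (W := W) a b) := by
  have hS : ∀ u : U, Continuous (fun x : U × W → ℝ => gS u x) := fun u => by unfold gS; fun_prop
  have hR : ∀ u : U, Continuous (fun x : U × W → ℝ => gR a u x) := fun u => by
    unfold gR
    exact ((hS u).log fun x => (gS_pos u x).ne').const_smul a |>.rexp
  have hT : Continuous (fun x : U × W → ℝ => gT a x) := by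
    unfold gT
    exact continuous_finsetSum _ fun u _ => hR u
  unfold gF
  exact (hT.log fun x => (gT_pos a x).ne').const_smul b |>.rexp

end matcmp

/-! ### Part F: tails over finite index sets -/

section fintails
variable {ν κ : Type*} [Fintype ν] [Fintype κ]
variable {U W : Type*} [Fintype U] [Fintype W] [DecidableEq U] [DecidableEq W]
  [Nonempty U] [Nonempty W]

lemma continuous_mv (u : ν → ℝ) : Continuous (fun G : κ × ν → ℝ => mv G u) := by
  unfold mv; fun_prop

lemma abs_bil_le (G : κ × ν → ℝ) (u : ν → ℝ) (w : κ → ℝ) (hu : euclNorm u = 1) (hw : euclNorm w = 1) :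
    |∑ i, mv G u i * w i| ≤ ∑ q, |G q| := by
  rw [Fintype.sum_prod_type]
  refine (Finset.abs_sum_le_sum_abs _ _).trans (Finset.sum_le_sum fun i _ => ?_)
  rw [abs_mul]
  have h1 : |w i| ≤ 1 := hw ▸ abs_le_euclNorm w i
  have h2 : |mv G u i| ≤ ∑ k, |G (i, k)| := by
    unfold mv
    refine (Finset.abs_sum_le_sum_abs _ _).trans (Finset.sum_le_sum fun k _ => ?_)
    rw [abs_mul]
    have h1 : |u k| ≤ 1 := hu ▸ abs_le_euclNorm u k
    exact mul_le_of_le_one_right (abs_nonneg _) h1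
  exact (mul_le_of_le_one_right (abs_nonneg _) h1).trans h2

lemma gFX_int (a : ℝ) (ha : |a| ≤ 1) (b β : ℝ) (hb : 0 ≤ b) (hb1 : b ≤ 1)
    (uu : U → ν → ℝ) (ww : W → κ → ℝ) (hu : ∀ u, euclNorm (uu u) = 1) (hw : ∀ w, euclNorm (ww w) = 1) :
    Integrable (fun G : κ × ν → ℝ => gF a b
        (fun j : U × W => β * ∑ i, mv G (uu j.1) i * ww j.2 i)) (gam (κ × ν)) := by
  refine integrable_of_exp_bound (C := Fintype.card U * Fintype.card W)
    (c := Fintype.card (U × W) * |β|) ?_ fun G => ?_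
  · have := continuous_gF (U := U) (W := W) a b
    have h2 : ∀ u : ν → ℝ, Continuous (fun G : κ × ν → ℝ => mv G u) := continuous_mv
    refine (this.comp (continuous_pi fun j => continuous_const.mul
      (continuous_finsetSum _ fun i _ => ?_))).measurable
    exact ((continuous_apply i).comp (h2 _)).mul continuous_const
  · rw [abs_of_pos (show 0 < gF a b _ from Real.exp_pos _)]
    refine (gF_le a b ha hb hb1 _).trans ?_
    gcongr
    calc ∑ j : U × W, |β * ∑ i, mv G (uu j.1) i * ww j.2 i|
        ≤ ∑ j : U × W, |β| * ∑ q, |G q| := Finset.sum_le_sum fun j _ => by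
          rw [abs_mul]
          exact mul_le_mul_of_nonneg_left (abs_bil_le G _ _ (hu _) (hw _)) (abs_nonneg _)
      _ = _ := by simp [mul_assoc]

lemma eN_mul_int (l m : ℝ) : Integrable (fun z : ν ⊕ κ → ℝ =>
    Real.exp (l * euclNorm (fun k => z (Sum.inl k))) * Real.exp (m * euclNorm (fun k => z (Sum.inr k))))
    (gam (ν ⊕ κ)) := by
  have h1 : Integrable (fun z : ν → ℝ => Real.exp (l * euclNorm z)) (gam ν) := by
    simpa using cM_int (ι := ν) 0 l
  have h2 : Integrable (fun z : κ → ℝ => Real.exp (m * euclNorm z)) (gam κ) := by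
    simpa using cM_int (ι := κ) 0 m
  have := h1.mul_prod h2
  rw [← gam_sum_map] at this
  exact (integrable_map_equiv _ _).1 this

lemma tendsto_beta (l c : ℝ) : Tendsto (fun β : ℝ => Real.exp ((l / β) * c)) atTop (nhds 1) := by
  have : Tendsto (fun β : ℝ => l / β * c) atTop (nhds (0 * c)) :=
    (tendsto_const_nhds.div_atTop tendsto_id).mul_const c
  have := (Real.continuous_exp.tendsto _).comp this
  rw [zero_mul, Real.exp_zero] at this
  exact this

variable [DecidableEq ν] [DecidableEq κ]

lemma fin_upper (l s : ℝ) (hl : 0 ≤ l)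
    (uu : U → ν → ℝ) (ww : W → κ → ℝ) (hu : ∀ u, euclNorm (uu u) = 1) (hw : ∀ w, euclNorm (ww w) = 1) :
    (gam (κ × ν)).real {G | ∃ u w, s ≤ ∑ i, mv G (uu u) i * ww w i} * Real.exp (l * s + l ^ 2 / 2)
      ≤ cM ν 0 l * cM κ 0 l := by
  set E := {G : κ × ν → ℝ | ∃ u w, s ≤ ∑ i, mv G (uu u) i * ww w i} with hE
  have hlim := (tendsto_beta l (Real.log (Fintype.card U * Fintype.card W : ℝ))).mul_const
    (cM ν 0 l * cM κ 0 l)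
  rw [one_mul] at hlim
  refine ge_of_tendsto hlim ?_
  filter_upwards [eventually_ge_atTop (max l 1)] with β hβ
  have hβ0 : 0 < β := lt_of_lt_of_le one_pos ((le_max_right _ _).trans hβ)
  have hlβ : l ≤ β := (le_max_left _ _).trans hβ
  have hg := gordon_fin 1 (by norm_num) l β hl hβ0 hlβ uu ww hu hw
  have hI := gFX_int 1 (by norm_num) (l / β) β (by positivity) ((div_le_one hβ0).2 hlβ) uu ww hu hw
  have hM := mul_meas_ge_le_integral_of_nonneg (ae_of_all _ fun G => (Real.exp_pos _).le) hI
    (Real.exp (l * s))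
  have hsub : E ⊆ {G | Real.exp (l * s) ≤ gF 1 (l / β)
        (fun j : U × W => β * ∑ i, mv G (uu j.1) i * ww j.2 i)} := by
    rintro G ⟨u, w, h⟩
    simp only [Set.mem_ofPred_eq]
    unfold gF
    refine Real.exp_le_exp.2 ?_
    set x : U × W → ℝ := fun j : U × W => β * ∑ i, mv G (uu j.1) i * ww j.2 i with hx
    have h1 : Real.exp (β * s) ≤ gS u x := by
      refine le_trans (Real.exp_le_exp.2 (mul_le_mul_of_nonneg_left h hβ0.le)) ?_
      exact Finset.single_le_sum (f := fun w => Real.exp (x (u, w))) (fun _ _ => (Real.exp_pos _).le)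
        (Finset.mem_univ w)
    have h2 : Real.exp (β * s) ≤ gT 1 x := by
      refine h1.trans ?_
      have : gR 1 u x = gS u x := by unfold gR; rw [one_mul, Real.exp_log (gS_pos u x)]
      rw [← this]
      exact Finset.single_le_sum (f := fun u => gR 1 u x) (fun _ _ => (Real.exp_pos _).le)
        (Finset.mem_univ u)
    have h3 : β * s ≤ Real.log (gT 1 x) := by
      rw [Real.le_log_iff_exp_le (gT_pos 1 x)]; exact h2
    calc l * s = l / β * (β * s) := by field_simp
      _ ≤ _ := mul_le_mul_of_nonneg_left h3 (by positivity)
  have hY : ∫ z : ν ⊕ κ → ℝ, gF 1 (l / β) (fun j : U × W => β * (∑ k, z (Sum.inl k) * uu j.1 k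
          + ∑ i, z (Sum.inr i) * ww j.2 i)) ∂(gam (ν ⊕ κ)) ≤
      Real.exp (l / β * Real.log (Fintype.card U * Fintype.card W : ℝ)) * (cM ν 0 l * cM κ 0 l) := by
    have e : cM ν 0 l * cM κ 0 l = ∫ z : ν ⊕ κ → ℝ, Real.exp (l * euclNorm (fun k => z (Sum.inl k)))
        * Real.exp (l * euclNorm (fun k => z (Sum.inr k))) ∂(gam (ν ⊕ κ)) := by
      rw [gam_sum_mul (fun z : ν → ℝ => Real.exp (l * euclNorm z)) (fun z : κ → ℝ => Real.exp (l * euclNorm z))]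
      simp [cM]
    rw [e, ← integral_const_mul]
    refine integral_mono_of_nonneg (ae_of_all _ fun G => (Real.exp_pos _).le)
      ((eN_mul_int l l).const_mul _) (ae_of_all _ fun z => ?_)
    simp only
    set g : ν → ℝ := fun k => z (Sum.inl k)
    set h : κ → ℝ := fun k => z (Sum.inr k)
    set x : U × W → ℝ := fun j : U × W => β * (∑ k, z (Sum.inl k) * uu j.1 k
          + ∑ i, z (Sum.inr i) * ww j.2 i) with hx
    have hxb : ∀ j, x j ≤ β * (euclNorm g + euclNorm h) := fun j => by
      refine mul_le_mul_of_nonneg_left (add_le_add ?_ ?_) hβ0.le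
      · have := ip_le g (uu j.1); rwa [hu, mul_one] at this
      · have := ip_le h (ww j.2); rwa [hw, mul_one] at this
    have hT : gT 1 x ≤ Fintype.card U * Fintype.card W * Real.exp (β * (euclNorm g + euclNorm h)) := by
      have e1 : gT 1 x = ∑ u, ∑ w, Real.exp (x (u, w)) := by
        refine Finset.sum_congr rfl fun u _ => ?_
        unfold gR; rw [one_mul, Real.exp_log (gS_pos u x)]; rfl
      rw [e1]
      calc _ ≤ ∑ _u : U, ∑ _w : W, Real.exp (β * (euclNorm g + euclNorm h)) :=
            Finset.sum_le_sum fun u _ => Finset.sum_le_sum fun w _ => Real.exp_le_exp.2 (hxb _)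
        _ = _ := by simp [mul_assoc]
    have hc : (0:ℝ) < Fintype.card U * Fintype.card W := by
      have := Fintype.card_pos (α := U); have := Fintype.card_pos (α := W); positivity
    have hl2 := Real.log_le_log (gT_pos 1 x) hT
    rw [Real.log_mul hc.ne' (Real.exp_pos _).ne', Real.log_exp] at hl2
    unfold gF
    rw [← Real.exp_add, ← Real.exp_add]
    refine Real.exp_le_exp.2 ?_
    calc l / β * Real.log (gT 1 x) ≤ l / β * _ := mul_le_mul_of_nonneg_left hl2 (by positivity)
      _ = _ := by field_simp
  calc (gam (κ × ν)).real E * Real.exp (l * s + l ^ 2 / 2)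
      = Real.exp (l ^ 2 / 2) * (Real.exp (l * s) * (gam (κ × ν)).real E) := by
        rw [Real.exp_add]; ring
    _ ≤ Real.exp (l ^ 2 / 2) * ∫ G : κ × ν → ℝ, gF 1 (l / β)
        (fun j : U × W => β * ∑ i, mv G (uu j.1) i * ww j.2 i) ∂(gam (κ × ν)) := by
        refine mul_le_mul_of_nonneg_left (le_trans ?_ hM) (Real.exp_pos _).le
        exact mul_le_mul_of_nonneg_left (measureReal_mono hsub) (Real.exp_pos _).le
    _ ≤ _ := hg.trans hY

lemma fin_lower (l s δ : ℝ) (hl : 0 ≤ l)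
    (uu : U → ν → ℝ) (ww : W → κ → ℝ) (hu : ∀ u, euclNorm (uu u) = 1) (hw : ∀ w, euclNorm (ww w) = 1)
    (hnet : ∀ x : κ → ℝ, ∃ w, (1 - δ) * euclNorm x ≤ ∑ i, x i * ww w i) :
    (gam (κ × ν)).real {G | ∃ u, euclNorm (mv G (uu u)) ≤ s} * Real.exp (-(l * s) + l ^ 2 / 2)
      ≤ cM ν 0 l * cM κ 0 (-(l * (1 - δ))) := by
  set E := {G : κ × ν → ℝ | ∃ u, euclNorm (mv G (uu u)) ≤ s} with hE
  have hlim := (tendsto_beta l (Real.log (Fintype.card U : ℝ) + Real.log (Fintype.card W : ℝ))).mul_const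
    (cM ν 0 l * cM κ 0 (-(l * (1 - δ))))
  rw [one_mul] at hlim
  refine ge_of_tendsto hlim ?_
  filter_upwards [eventually_ge_atTop (max l 1)] with β hβ
  have hβ0 : 0 < β := lt_of_lt_of_le one_pos ((le_max_right _ _).trans hβ)
  have hlβ : l ≤ β := (le_max_left _ _).trans hβ
  have hcU : (0:ℝ) < Fintype.card U := by exact_mod_cast Fintype.card_pos (α := U)
  have hcW : (0:ℝ) < Fintype.card W := by exact_mod_cast Fintype.card_pos (α := W)
  have hg := gordon_fin (-1) (by norm_num) l β hl hβ0 hlβ uu ww hu hw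
  have hI := gFX_int (-1) (by norm_num) (l / β) β (by positivity) ((div_le_one hβ0).2 hlβ) uu ww hu hw
  have hM := mul_meas_ge_le_integral_of_nonneg (ae_of_all _ fun G => (Real.exp_pos _).le) hI
    (Real.exp (-(l / β * Real.log (Fintype.card W)) - l * s))
  have hsub : E ⊆ {G | Real.exp (-(l / β * Real.log (Fintype.card W)) - l * s) ≤ gF (-1) (l / β)
        (fun j : U × W => β * ∑ i, mv G (uu j.1) i * ww j.2 i)} := by
    rintro G ⟨u, h⟩
    simp only [Set.mem_ofPred_eq]
    unfold gF
    refine Real.exp_le_exp.2 ?_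
    set x : U × W → ℝ := fun j : U × W => β * ∑ i, mv G (uu j.1) i * ww j.2 i with hx
    have h1 : gS u x ≤ Fintype.card W * Real.exp (β * s) := by
      calc gS u x ≤ ∑ _w : W, Real.exp (β * s) := Finset.sum_le_sum fun w _ => by
            refine Real.exp_le_exp.2 (mul_le_mul_of_nonneg_left ?_ hβ0.le)
            have := ip_le (mv G (uu u)) (ww w)
            rw [hw, mul_one] at this
            exact this.trans h
        _ = _ := by simp
    have h1' := Real.log_le_log (gS_pos u x) h1
    rw [Real.log_mul hcW.ne' (Real.exp_pos _).ne', Real.log_exp] at h1'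
    have h3 : -(Real.log (Fintype.card W) + β * s) ≤ Real.log (gT (-1) x) := by
      rw [Real.le_log_iff_exp_le (gT_pos (-1) x)]
      refine le_trans ?_ (Finset.single_le_sum (f := fun u => gR (-1) u x)
        (fun _ _ => (Real.exp_pos _).le) (Finset.mem_univ u))
      unfold gR
      refine Real.exp_le_exp.2 ?_
      linarith
    calc -(l / β * Real.log (Fintype.card W)) - l * s
        = l / β * -(Real.log (Fintype.card W) + β * s) := by field_simp; ring
      _ ≤ _ := mul_le_mul_of_nonneg_left h3 (by positivity)
  have hY : ∫ z : ν ⊕ κ → ℝ, gF (-1) (l / β) (fun j : U × W => β * (∑ k, z (Sum.inl k) * uu j.1 k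
          + ∑ i, z (Sum.inr i) * ww j.2 i)) ∂(gam (ν ⊕ κ)) ≤
      Real.exp (l / β * Real.log (Fintype.card U : ℝ)) * (cM ν 0 l * cM κ 0 (-(l * (1 - δ)))) := by
    have e : cM ν 0 l * cM κ 0 (-(l * (1 - δ))) = ∫ z : ν ⊕ κ → ℝ, Real.exp (l * euclNorm (fun k => z (Sum.inl k)))
        * Real.exp (-(l * (1 - δ)) * euclNorm (fun k => z (Sum.inr k))) ∂(gam (ν ⊕ κ)) := by
      rw [gam_sum_mul (fun z : ν → ℝ => Real.exp (l * euclNorm z))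
        (fun z : κ → ℝ => Real.exp (-(l * (1 - δ)) * euclNorm z))]
      simp [cM]
    rw [e, ← integral_const_mul]
    refine integral_mono_of_nonneg (ae_of_all _ fun G => (Real.exp_pos _).le)
      ((eN_mul_int l _).const_mul _) (ae_of_all _ fun z => ?_)
    simp only
    set g : ν → ℝ := fun k => z (Sum.inl k)
    set h : κ → ℝ := fun k => z (Sum.inr k)
    set x : U × W → ℝ := fun j : U × W => β * (∑ k, z (Sum.inl k) * uu j.1 k
          + ∑ i, z (Sum.inr i) * ww j.2 i) with hx
    obtain ⟨w0, hw0⟩ := hnet h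
    have hS : ∀ u, β * (-euclNorm g + (1 - δ) * euclNorm h) ≤ Real.log (gS u x) := fun u => by
      rw [Real.le_log_iff_exp_le (gS_pos u x)]
      refine le_trans (Real.exp_le_exp.2 ?_) (Finset.single_le_sum (f := fun w => Real.exp (x (u, w)))
        (fun _ _ => (Real.exp_pos _).le) (Finset.mem_univ w0))
      refine mul_le_mul_of_nonneg_left (add_le_add ?_ hw0) hβ0.le
      have := ip_ge g (uu u); rwa [hu, mul_one] at this
    have hT : gT (-1) x ≤ Fintype.card U * Real.exp (β * (euclNorm g - (1 - δ) * euclNorm h)) := by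
      calc _ ≤ ∑ _u : U, Real.exp (β * (euclNorm g - (1 - δ) * euclNorm h)) :=
            Finset.sum_le_sum fun u _ => Real.exp_le_exp.2 (by linarith [hS u])
        _ = _ := by simp
    have hl2 := Real.log_le_log (gT_pos (-1) x) hT
    rw [Real.log_mul hcU.ne' (Real.exp_pos _).ne', Real.log_exp] at hl2
    unfold gF
    rw [← Real.exp_add, ← Real.exp_add]
    refine Real.exp_le_exp.2 ?_
    calc l / β * Real.log (gT (-1) x) ≤ l / β * _ := mul_le_mul_of_nonneg_left hl2 (by positivity)
      _ = _ := by field_simp; ring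
  have hfin : Real.exp (l ^ 2 / 2) * (Real.exp (-(l / β * Real.log (Fintype.card W)) - l * s) *
      (gam (κ × ν)).real E) ≤
      Real.exp (l / β * Real.log (Fintype.card U : ℝ)) * (cM ν 0 l * cM κ 0 (-(l * (1 - δ)))) := by
    refine le_trans ?_ (hg.trans hY)
    refine mul_le_mul_of_nonneg_left (le_trans ?_ hM) (Real.exp_pos _).le
    exact mul_le_mul_of_nonneg_left (measureReal_mono hsub) (Real.exp_pos _).le
  have h5 := mul_le_mul_of_nonneg_left hfin (Real.exp_pos (l / β * Real.log (Fintype.card W))).le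
  refine le_trans (le_of_eq ?_) (h5.trans (le_of_eq ?_))
  · have : Real.exp (-(l * s) + l ^ 2 / 2) = Real.exp (l / β * Real.log (Fintype.card W)) *
        (Real.exp (l ^ 2 / 2) * Real.exp (-(l / β * Real.log (Fintype.card W)) - l * s)) := by
      rw [← Real.exp_add, ← Real.exp_add]; congr 1; ring
    rw [this]; ring
  · rw [mul_add, Real.exp_add]; ring

end fintails

/-! ### Part G: tails over the sphere -/

section tails
variable {ν κ : Type*} [Fintype ν] [Fintype κ] 

lemma euclNorm_smul (c : ℝ) (x : ν → ℝ) : euclNorm (fun i => c * x i) = |c| * euclNorm x := by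
  unfold euclNorm
  simp only [mul_pow, ← Finset.mul_sum]
  rw [Real.sqrt_mul (sq_nonneg _), Real.sqrt_sq_eq_abs]

lemma euclNorm_zero : euclNorm (0 : ν → ℝ) = 0 := by simp [euclNorm]

lemma euclNorm_pos {x : ν → ℝ} (h : x ≠ 0) : 0 < euclNorm x :=
  lt_of_le_of_ne (euclNorm_nonneg x) fun h' => h (euclNorm_eq_zero h'.symm)

lemma euclNorm_normalize {x : ν → ℝ} (h : x ≠ 0) :
    euclNorm (fun i => (euclNorm x)⁻¹ * x i) = 1 := by
  rw [euclNorm_smul, abs_of_pos (inv_pos.2 (euclNorm_pos h)), inv_mul_cancel₀ (euclNorm_pos h).ne']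

lemma mv_smul (G : κ × ν → ℝ) (c : ℝ) (x : ν → ℝ) :
    mv G (fun i => c * x i) = fun i => c * mv G x i := by
  funext i
  simp only [mv, Finset.mul_sum]
  exact Finset.sum_congr rfl fun k _ => by ring

lemma mv_zero (G : κ × ν → ℝ) : mv G 0 = 0 := by
  funext i; simp [mv]

lemma continuous_mv' (G : κ × ν → ℝ) : Continuous (fun u => mv G u) := by
  unfold mv; fun_prop

/-- The unit sphere. -/
abbrev Sph (ν : Type*) [Fintype ν] := {u : ν → ℝ // euclNorm u = 1}

instance sph_nonempty [Nonempty ν] : Nonempty (Sph ν) := by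
  have : (fun _ => 1 : ν → ℝ) ≠ 0 := fun h => by
    have := congrFun h (Classical.arbitrary ν)
    simp at this
  exact ⟨⟨_, euclNorm_normalize this⟩⟩

lemma sph_compact : CompactSpace (Sph ν) := by
  have : IsCompact {u : ν → ℝ | euclNorm u = 1} := by
    refine Metric.isCompact_of_isClosed_isBounded ?_ ?_
    · exact isClosed_eq continuous_euclNorm continuous_const
    · refine (Metric.isBounded_closedBall (x := (0 : ν → ℝ)) (r := 1)).subset fun u hu => ?_
      rw [mem_closedBall_zero_iff, pi_norm_le_iff_of_nonneg zero_le_one]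
      intro i
      rw [Real.norm_eq_abs]
      exact (abs_le_euclNorm u i).trans (le_of_eq hu)
  exact isCompact_iff_compactSpace.1 this

lemma ip_self (x : ν → ℝ) : ∑ i, x i * x i = euclNorm x ^ 2 := by
  rw [euclNorm_sq]; simp only [pow_two]

lemma exists_net [Nonempty ν] (δ : ℝ) (hδ : 0 < δ) (hδ1 : δ ≤ 1) : ∃ t : Finset (Sph ν), t.Nonempty ∧
    ∀ x : ν → ℝ, ∃ w ∈ t, (1 - δ) * euclNorm x ≤ ∑ i, x i * w.1 i := by
  have := sph_compact (ν := ν)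
  obtain ⟨t, ht⟩ := isCompact_univ.elim_finite_subcover
    (fun w : Sph ν => {x : Sph ν | 1 - δ < ∑ i, x.1 i * w.1 i})
    (fun w => isOpen_lt continuous_const (continuous_finsetSum _ fun i _ =>
      ((continuous_apply i).comp continuous_subtype_val).mul continuous_const))
    (fun x _ => Set.mem_iUnion.2 ⟨x, by
      change 1 - δ < ∑ i, x.1 i * x.1 i
      rw [ip_self, x.2]; linarith⟩)
  have key : ∀ x : Sph ν, ∃ w ∈ t, 1 - δ < ∑ i, x.1 i * w.1 i := fun x => by
    have := ht (Set.mem_univ x)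
    simp only [Set.mem_iUnion] at this
    obtain ⟨w, hw, h⟩ := this
    exact ⟨w, hw, h⟩
  obtain ⟨w0, hw0, _⟩ := key (Classical.arbitrary _)
  refine ⟨t, ⟨w0, hw0⟩, fun x => ?_⟩
  by_cases hx : x = 0
  · exact ⟨w0, hw0, by subst hx; simp [euclNorm_zero]⟩
  · obtain ⟨w, hw, h⟩ := key ⟨_, euclNorm_normalize hx⟩
    refine ⟨w, hw, ?_⟩
    have hp := euclNorm_pos hx
    simp only [mul_assoc, ← Finset.mul_sum] at h
    rw [← div_eq_inv_mul, lt_div_iff₀ hp] at h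
    exact h.le

variable [DecidableEq ν] [DecidableEq κ] [Nonempty ν] [Nonempty κ]

theorem tail_upper (τ s : ℝ) (hτ : 0 < τ)
    (hs : s = √(Fintype.card κ) + √(Fintype.card ν) + τ) :
    gam (κ × ν) {G | ∃ y, s * euclNorm y < euclNorm (mv G y)} ≤ ENNReal.ofReal (Real.exp (-τ ^ 2 / 2)) := by
  have hs0 : 0 ≤ s := by rw [hs]; positivity
  let q : ℕ → Sph ν × Sph κ := TopologicalSpace.denseSeq _
  have hq : DenseRange q := TopologicalSpace.denseRange_denseSeq _
  let E : ℕ → Set (κ × ν → ℝ) := fun m => {G | ∃ u w : Fin (m + 1), s ≤ ∑ i, mv G (q u).1.1 i * (q w).2.1 i}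
  have hmono : Monotone E := by
    intro m m' hm G hG
    obtain ⟨u, w, h⟩ := hG
    exact ⟨⟨u, by omega⟩, ⟨w, by omega⟩, h⟩
  have hsub : {G : κ × ν → ℝ | ∃ y, s * euclNorm y < euclNorm (mv G y)} ⊆ ⋃ m, E m := by
    rintro G ⟨y, hy⟩
    have hy0 : y ≠ 0 := by
      rintro rfl
      rw [mv_zero, euclNorm_zero, euclNorm_zero] at hy
      simp at hy
    have hp := euclNorm_pos hy0
    have hG0 : mv G y ≠ 0 := by
      intro h
      rw [h, euclNorm_zero] at hy
      nlinarith
    have hG := euclNorm_pos hG0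
    have ho : IsOpen {r : Sph ν × Sph κ | s < ∑ i, mv G r.1.1 i * r.2.1 i} := by
      have := continuous_mv' G
      refine isOpen_lt continuous_const (continuous_finsetSum _ fun i _ => ?_)
      exact ((continuous_apply i).comp (this.comp (continuous_subtype_val.comp continuous_fst))).mul
        ((continuous_apply i).comp (continuous_subtype_val.comp continuous_snd))
    obtain ⟨m, hm⟩ := hq.exists_mem_open ho ⟨(⟨_, euclNorm_normalize hy0⟩, ⟨_, euclNorm_normalize hG0⟩), by
      change s < ∑ i, mv G (fun i => (euclNorm y)⁻¹ * y i) i * ((euclNorm (mv G y))⁻¹ * mv G y i)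
      rw [mv_smul]
      have e : ∑ i, (euclNorm y)⁻¹ * mv G y i * ((euclNorm (mv G y))⁻¹ * mv G y i)
          = (euclNorm y)⁻¹ * ((euclNorm (mv G y))⁻¹ * ∑ i, mv G y i * mv G y i) := by
        simp only [Finset.mul_sum]
        exact Finset.sum_congr rfl fun i _ => by ring
      rw [e, ip_self, ← div_eq_inv_mul, lt_div_iff₀ hp, pow_two, ← mul_assoc, inv_mul_cancel₀ hG.ne',
        one_mul]
      exact hy⟩
    exact Set.mem_iUnion.2 ⟨m, ⟨m, by omega⟩, ⟨m, by omega⟩, le_of_lt hm⟩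
  refine (measure_mono hsub).trans ?_
  rw [hmono.measure_iUnion]
  refine iSup_le fun m => ?_
  have h := fin_upper (κ := κ) (ν := ν) τ s hτ.le (fun u : Fin (m + 1) => (q u).1.1) (fun w : Fin (m + 1) => (q w).2.1)
    (fun u => (q u).1.2) (fun u => (q u).2.2)
  have h1 := chi_upper (ι := ν) τ hτ.le
  have h2 := chi_upper (ι := κ) τ hτ.le
  have h3 := mul_le_mul h1 h2 (cM0_pos τ).le (Real.exp_pos _).le
  rw [← ofReal_measureReal]
  refine ENNReal.ofReal_le_ofReal ?_
  have h4 := h.trans h3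
  rw [← le_div_iff₀ (Real.exp_pos _), ← Real.exp_add, ← Real.exp_sub] at h4
  refine h4.trans (Real.exp_le_exp.2 (le_of_eq ?_))
  rw [hs]; ring

lemma sqrt_aux (n : ℝ) (hn : 1 ≤ n) : √n - 1 / 2 ≤ n / √(n + 1) ∧ n / √(n + 1) ≤ √n := by
  have hr1 : 1 ≤ √n := Real.one_le_sqrt.2 hn
  have hr2 : √n ^ 2 = n := Real.sq_sqrt (by linarith)
  have ht : 0 < √(n + 1) := Real.sqrt_pos.2 (by linarith)
  have ht2 : √(n + 1) ^ 2 = n + 1 := Real.sq_sqrt (by linarith)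
  constructor
  · rw [le_div_iff₀ ht]
    refine abs_le_of_sq_le_sq' ?_ (by linarith) |>.2
    rw [mul_pow, ht2]
    set r := √n
    rw [← hr2]
    nlinarith [mul_nonneg (sub_nonneg.2 hr1) (sq_nonneg (r - 1)), mul_nonneg (sub_nonneg.2 hr1) (sub_nonneg.2 hr1)]
  · rw [div_le_iff₀ ht]
    have : √n ≤ √(n + 1) := Real.sqrt_le_sqrt (by linarith)
    nlinarith

theorem tail_lower (τ s : ℝ) (hτ : 0 < τ)
    (hs : s = √(Fintype.card κ) - 3 / 2 * (√(Fintype.card ν) + τ)) :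
    gam (κ × ν) {G | ∃ y, euclNorm (mv G y) < s * euclNorm y} ≤ ENNReal.ofReal (Real.exp (-τ ^ 2 / 2)) := by
  set n : ℝ := (Fintype.card κ : ℝ) with hn
  set d : ℝ := (Fintype.card ν : ℝ) with hd
  have hn1 : 1 ≤ n := by rw [hn]; exact_mod_cast Fintype.card_pos (α := κ)
  have hd1 : 1 ≤ d := by rw [hd]; exact_mod_cast Fintype.card_pos (α := ν)
  have hrn : 1 ≤ √n := Real.one_le_sqrt.2 hn1
  have hrd : 1 ≤ √d := Real.one_le_sqrt.2 hd1
  let δ : ℝ := τ / (2 * √n + τ)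
  have hδ0 : 0 < δ := by positivity
  have hδ1 : δ ≤ 1 := by
    rw [div_le_one (by positivity)]; linarith
  have hδn : δ * √n ≤ τ / 2 := by
    rw [div_mul_eq_mul_div, div_le_iff₀ (by positivity)]
    nlinarith
  obtain ⟨t, htn, ht⟩ := exists_net (ν := κ) δ hδ0 hδ1
  have : Nonempty t := htn.to_subtype
  let q : ℕ → Sph ν := TopologicalSpace.denseSeq _
  have hq : DenseRange q := TopologicalSpace.denseRange_denseSeq _
  let E : ℕ → Set (κ × ν → ℝ) := fun m => {G | ∃ u : Fin (m + 1), euclNorm (mv G (q u).1) ≤ s}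
  have hmono : Monotone E := by
    intro m m' hm G hG
    obtain ⟨u, h⟩ := hG
    exact ⟨⟨u, by omega⟩, h⟩
  have hsub : {G : κ × ν → ℝ | ∃ y, euclNorm (mv G y) < s * euclNorm y} ⊆ ⋃ m, E m := by
    rintro G ⟨y, hy⟩
    have hy0 : y ≠ 0 := by
      rintro rfl
      rw [mv_zero, euclNorm_zero, euclNorm_zero] at hy
      simp at hy
    have hp := euclNorm_pos hy0
    have ho : IsOpen {r : Sph ν | euclNorm (mv G r.1) < s} := by
      refine isOpen_lt (continuous_euclNorm.comp ((continuous_mv' G).comp continuous_subtype_val))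
        continuous_const
    obtain ⟨m, hm⟩ := hq.exists_mem_open ho ⟨⟨_, euclNorm_normalize hy0⟩, by
      change euclNorm (mv G (fun i => (euclNorm y)⁻¹ * y i)) < s
      rw [mv_smul, euclNorm_smul, abs_of_pos (inv_pos.2 hp), ← div_eq_inv_mul, div_lt_iff₀ hp]
      exact hy⟩
    exact Set.mem_iUnion.2 ⟨m, ⟨m, by omega⟩, le_of_lt hm⟩
  refine (measure_mono hsub).trans ?_
  rw [hmono.measure_iUnion]
  refine iSup_le fun m => ?_
  have h := fin_lower (κ := κ) (ν := ν) τ s δ hτ.le (fun u : Fin (m + 1) => (q u).1) (fun w : t => w.1.1)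
    (fun u => (q u).2) (fun u => u.1.2) (fun x => by
      obtain ⟨w, hw, h⟩ := ht x
      exact ⟨⟨w, hw⟩, h⟩)
  have h1 := chi_upper (ι := ν) τ hτ.le
  have h2 := chi_lower (ι := κ) (τ * (1 - δ)) (mul_nonneg hτ.le (by linarith))
  have h3 := mul_le_mul h1 h2 (cM0_pos _).le (Real.exp_pos _).le
  rw [← ofReal_measureReal]
  refine ENNReal.ofReal_le_ofReal ?_
  have h4 := h.trans h3
  rw [← le_div_iff₀ (Real.exp_pos _), ← Real.exp_add, ← Real.exp_sub] at h4
  refine h4.trans (Real.exp_le_exp.2 ?_)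
  rw [← hn, ← hd]
  obtain ⟨ha, hb⟩ := sqrt_aux n hn1
  set c := n / √(n + 1)
  have hc0 : 0 ≤ c := by positivity
  have hδc : δ * c ≤ τ / 2 := (mul_le_mul_of_nonneg_left hb hδ0.le).trans hδn
  have h5 : (1 - δ) ^ 2 ≤ 1 := by nlinarith
  have h6 : (τ * (1 - δ)) ^ 2 ≤ τ ^ 2 := by
    rw [mul_pow]; nlinarith [sq_nonneg τ]
  have h7 : s + √d - (1 - δ) * c + τ / 2 ≤ - τ / 2 := by rw [hs]; nlinarith
  have h8 := mul_le_mul_of_nonneg_left h7 hτ.le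
  nlinarith

end tails

/-! ### Part H: rotation invariance and reduction of Stiefel matrices to Gaussian matrices -/

section rotation
variable {ι κ : Type*} [Fintype ι] [Fintype κ] [DecidableEq ι] [DecidableEq κ]

lemma gam_charFun (t : ι → ℝ) :
    ∫ z : ι → ℝ, Complex.exp (((∑ i, z i * t i : ℝ) : ℂ) * Complex.I) ∂(gam ι)
      = Complex.exp (((-(∑ i, t i ^ 2) / 2 : ℝ) : ℂ)) := by
  have h := charFun_stdGaussian (WithLp.toLp 2 t : EuclideanSpace ℝ ι)
  rw [← map_pi_eq_stdGaussian, charFun_apply, integral_map (by fun_prop)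
    (Measurable.aestronglyMeasurable (by fun_prop))] at h
  have e : ‖(WithLp.toLp 2 t : EuclideanSpace ℝ ι)‖ ^ 2 = ∑ i, t i ^ 2 := by
    rw [EuclideanSpace.real_norm_sq_eq]
  have e2 : Complex.exp (-(‖(WithLp.toLp 2 t : EuclideanSpace ℝ ι)‖ : ℂ) ^ 2 / 2)
      = Complex.exp (((-(∑ i, t i ^ 2) / 2 : ℝ) : ℂ)) := by
    rw [← e]; push_cast; rfl
  rw [← e2, ← h]
  unfold gam
  refine integral_congr_ae (ae_of_all _ fun z => ?_)
  simp only [PiLp.inner_apply, Real.inner_apply]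

lemma gam_map_orth (L : Matrix κ ι ℝ) (hL : L * Lᵀ = 1) :
    (gam ι).map (fun z => L *ᵥ z) = gam κ := by
  have hm : Measurable (fun z : ι → ℝ => L *ᵥ z) := by
    have : Continuous (fun z : ι → ℝ => L *ᵥ z) := by fun_prop
    exact this.measurable
  have hpm : IsProbabilityMeasure ((gam ι).map (fun z => L *ᵥ z)) :=
    Measure.isProbabilityMeasure_map hm.aemeasurable
  have mt : Measurable (WithLp.toLp 2 : (κ → ℝ) → EuclideanSpace ℝ κ) := by fun_prop
  have mo : Measurable (WithLp.ofLp : EuclideanSpace ℝ κ → (κ → ℝ)) := by fun_prop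
  have i1 : IsProbabilityMeasure (((gam ι).map (fun z => L *ᵥ z)).map (WithLp.toLp 2 : (κ → ℝ) → EuclideanSpace ℝ κ)) :=
    Measure.isProbabilityMeasure_map mt.aemeasurable
  have i2 : IsProbabilityMeasure ((gam κ).map (WithLp.toLp 2 : (κ → ℝ) → EuclideanSpace ℝ κ)) :=
    Measure.isProbabilityMeasure_map mt.aemeasurable
  have key : ((gam ι).map (fun z => L *ᵥ z)).map (WithLp.toLp 2 : (κ → ℝ) → EuclideanSpace ℝ κ)
      = (gam κ).map (WithLp.toLp 2) := by
    refine Measure.ext_of_charFun ?_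
    funext t
    rw [charFun_apply, charFun_apply, integral_map (by fun_prop)
      (Measurable.aestronglyMeasurable (by fun_prop)), integral_map (by fun_prop)
      (Measurable.aestronglyMeasurable (by fun_prop)), integral_map (by fun_prop)
      (Measurable.aestronglyMeasurable (by fun_prop))]
    simp only [PiLp.inner_apply, Real.inner_apply]
    rw [gam_charFun (fun i => t i)]
    have e : ∀ z : ι → ℝ, ∑ i, (L *ᵥ z) i * t i = ∑ i, z i * (Lᵀ *ᵥ (fun i => t i)) i := by
      intro z
      have := Matrix.dotProduct_mulVec (fun i => t i) L z
      rw [← Matrix.mulVec_transpose] at this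
      rw [dotProduct_comm, dotProduct_comm _ z] at this
      exact this
    simp only [e]
    rw [gam_charFun]
    have e2 : ∑ i, (Lᵀ *ᵥ (fun i => t i)) i ^ 2 = ∑ i, t i ^ 2 := by
      have h1 : (Lᵀ *ᵥ (fun i => t i)) ⬝ᵥ (Lᵀ *ᵥ (fun i => t i)) = (fun i => t i) ⬝ᵥ (fun i => t i) := by
        rw [Matrix.dotProduct_mulVec, Matrix.vecMul_transpose, Matrix.mulVec_mulVec, hL, Matrix.one_mulVec]
      simp only [dotProduct, ← pow_two] at h1
      exact h1
    rw [e2]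
  have := congrArg (Measure.map (WithLp.ofLp : EuclideanSpace ℝ κ → (κ → ℝ))) key
  rw [Measure.map_map mo mt, Measure.map_map mo mt] at this
  have e3 : (WithLp.ofLp : EuclideanSpace ℝ κ → (κ → ℝ)) ∘ (WithLp.toLp 2) = id := rfl
  rwa [e3, Measure.map_id, Measure.map_id] at this

variable {ν : Type*} [Fintype ν] [DecidableEq ν]

/-- product of a matrix with an array. -/
def vG (v : Matrix κ ι ℝ) (G : ι × ν → ℝ) : κ × ν → ℝ := fun q => ∑ r, v q.1 r * G (r, q.2)

lemma mv_vG (v : Matrix κ ι ℝ) (G : ι × ν → ℝ) (y : ν → ℝ) : mv (vG v G) y = v *ᵥ (mv G y) := by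
  funext i
  simp only [mv, vG, Matrix.mulVec, dotProduct, Finset.sum_mul, Finset.mul_sum]
  rw [Finset.sum_comm]
  exact Finset.sum_congr rfl fun r _ => Finset.sum_congr rfl fun k _ => by ring

lemma gam_map_vG (v : Matrix κ ι ℝ) (hv : v * vᵀ = 1) :
    (gam (ι × ν)).map (vG v) = gam (κ × ν) := by
  have h := gam_map_orth (Matrix.kroneckerMap (· * ·) v (1 : Matrix ν ν ℝ)) (by
    rw [← Matrix.kroneckerMap_transpose, ← Matrix.mul_kronecker_mul, hv]
    simp)
  rw [← h]
  congr 1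
  funext G q
  simp only [vG, Matrix.mulVec, dotProduct, Fintype.sum_prod_type, Matrix.kroneckerMap_apply]
  refine Finset.sum_congr rfl fun r _ => ?_
  simp [Matrix.one_apply]

end rotation

section frame

lemma exists_orth {p d : ℕ} (G : (Fin p × Fin d) × Fin d → ℝ) (hG : ∀ y, mv G y = 0 → y = 0)
    (k : Fin p) : ∃ O : Matrix (Fin p × Fin d) (Fin p × Fin d) ℝ, O * Oᵀ = 1 ∧
      ∀ x : Fin d → ℝ, ∃ y, (fun r => ∑ l, O r (k, l) * x l) = mv G y := by
  classical
  let T : (Fin d → ℝ) →ₗ[ℝ] EuclideanSpace ℝ (Fin p × Fin d) :=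
    { toFun := fun y => WithLp.toLp 2 (mv G y)
      map_add' := fun x y => by
        ext i; simp [mv, mul_add, Finset.sum_add_distrib]
      map_smul' := fun c x => by
        ext i
        have := congrFun (mv_smul G c x) i
        exact this }
  have hT : Function.Injective T := by
    rw [injective_iff_map_eq_zero]
    intro y hy
    apply hG
    have := congrArg WithLp.ofLp hy
    exact this
  have hf : Module.finrank ℝ (LinearMap.range T) = d := by
    rw [LinearMap.finrank_range_of_inj hT]; simp
  let b := (stdOrthonormalBasis ℝ (LinearMap.range T)).reindex (finCongr hf)
  have hb : Orthonormal ℝ (fun l => (b l : EuclideanSpace ℝ (Fin p × Fin d))) :=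
    b.orthonormal.comp_linearIsometry (LinearMap.range T).subtypeₗᵢ
  let v : Fin p × Fin d → EuclideanSpace ℝ (Fin p × Fin d) := fun r => b r.2
  have hv : Orthonormal ℝ (({r | r.1 = k} : Set (Fin p × Fin d)).domRestrict v) := by
    refine hb.comp (fun r : ({r | r.1 = k} : Set (Fin p × Fin d)) => r.1.2) ?_
    rintro ⟨⟨r1, r2⟩, hr⟩ ⟨⟨s1, s2⟩, hs⟩ h
    simp only [Set.mem_ofPred_eq] at hr hs h
    subst hr; subst hs; subst h; rfl
  obtain ⟨B, hB⟩ := hv.exists_orthonormalBasis_extension_of_card_eq (by simp)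
  have h1 : (Matrix.of fun r r' => B r' r : Matrix (Fin p × Fin d) (Fin p × Fin d) ℝ)ᵀ *
      (Matrix.of fun r r' => B r' r) = 1 := by
    ext r s
    have := orthonormal_iff_ite.1 B.orthonormal s r
    rw [PiLp.inner_apply] at this
    simp only [Real.inner_apply] at this
    simp only [Matrix.mul_apply, Matrix.transpose_apply, Matrix.of_apply, Matrix.one_apply]
    rw [show (if r = s then (1:ℝ) else 0) = if s = r then 1 else 0 by simp only [eq_comm], ← this]
    exact Finset.sum_congr rfl fun i _ => by ring
  refine ⟨Matrix.of fun r r' => B r' r, mul_eq_one_comm.1 h1, fun x => ?_⟩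
  have hmem : (∑ l, x l • B (k, l)) ∈ LinearMap.range T := by
    refine Submodule.sum_mem _ fun l _ => Submodule.smul_mem _ _ ?_
    rw [hB (k, l) rfl]
    exact (b l).2
  obtain ⟨y, hy⟩ := hmem
  refine ⟨y, ?_⟩
  have h2 := congrArg WithLp.ofLp hy
  funext r
  have h3 := congrFun h2 r
  change mv G y r = _ at h3
  rw [h3]
  simp [Matrix.of_apply, mul_comm]

lemma orth_norm {R : Type*} [Fintype R] [DecidableEq R] (O : Matrix R R ℝ) (hO : O * Oᵀ = 1)
    (z : R → ℝ) : euclNorm (O *ᵥ z) = euclNorm z := by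
  have h1 : (O *ᵥ z) ⬝ᵥ (O *ᵥ z) = z ⬝ᵥ z := by
    rw [Matrix.dotProduct_mulVec, ← Matrix.mulVec_transpose, Matrix.mulVec_mulVec,
      mul_eq_one_comm.1 hO, Matrix.one_mulVec]
  unfold euclNorm
  simp only [dotProduct, ← pow_two] at h1
  rw [h1]

lemma exists_orth' {n p d : ℕ} (G : (Fin p × Fin d) × Fin d → ℝ) (hG : ∀ y, mv G y = 0 → y = 0)
    (k : Fin p) : ∃ O : Matrix (Fin p × Fin d) (Fin p × Fin d) ℝ, O * Oᵀ = 1 ∧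
      ∀ (v : Matrix (Fin n) (Fin p × Fin d) ℝ) (x : Fin d → ℝ), ∃ y, euclNorm (mv G y) = euclNorm x ∧
        colBlock (v * O) k *ᵥ x = mv (vG v G) y := by
  obtain ⟨O, hO, h⟩ := exists_orth G hG k
  refine ⟨O, hO, fun v x => ?_⟩
  obtain ⟨y, hy⟩ := h x
  let z : Fin p × Fin d → ℝ := fun r => if r.1 = k then x r.2 else 0
  have hz : O *ᵥ z = mv G y := by
    rw [← hy]
    funext r
    simp only [Matrix.mulVec, dotProduct, z, Fintype.sum_prod_type]
    rw [Finset.sum_eq_single k (fun b _ hb => by simp [hb]) (by simp)]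
    simp
  refine ⟨y, ?_, ?_⟩
  · rw [← hz, orth_norm O hO]
    unfold euclNorm
    congr 1
    simp only [z, Fintype.sum_prod_type]
    rw [Finset.sum_eq_single k (fun b _ hb => by simp [hb]) (by simp)]
    simp
  · rw [mv_vG, ← hz, Matrix.mulVec_mulVec]
    funext i
    simp only [Matrix.mulVec, dotProduct, z, Fintype.sum_prod_type, colBlock]
    rw [Finset.sum_eq_single (f := fun a => ∑ l, (v * O) i (a, l) * (if a = k then x l else 0)) k
      (fun b _ hb => by simp [hb]) (by simp)]
    simp

end frame

section fubini
variable {Ω : Type*} [MeasurableSpace Ω]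

instance matrix_borel {m n : Type*} [Fintype m] [Fintype n] : BorelSpace (Matrix m n ℝ) :=
  inferInstanceAs (BorelSpace (m → n → ℝ))

lemma stiefel_fubini {n : ℕ} {R X : Type*} [Fintype R] [DecidableEq R] [MeasurableSpace X]
    (P : Measure Ω) [IsProbabilityMeasure P] (γ : Measure X) [IsProbabilityMeasure γ]
    (V : Ω → Matrix (Fin n) R ℝ) (hV : IsUniformStiefel P V)
    (B : Set (Matrix (Fin n) R ℝ)) (hB : MeasurableSet B)
    (D : Set (Matrix (Fin n) R ℝ × X)) (hD : MeasurableSet D) (𝒢 : Set X) (h𝒢 : MeasurableSet 𝒢)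
    (h : ∀ G ∈ 𝒢, ∃ O : Matrix R R ℝ, O * Oᵀ = 1 ∧ ∀ v, v * O ∈ B → (v, G) ∈ D)
    (β : ℝ≥0∞) (hβ : ∀ v : Matrix (Fin n) R ℝ, v * vᵀ = 1 → γ {G | (v, G) ∈ D} ≤ β) :
    P {ω | V ω ∈ B} ≤ γ 𝒢ᶜ + β := by
  obtain ⟨mV, h1, h2⟩ := hV
  set μ := P.map V with hμ
  have : IsProbabilityMeasure μ := Measure.isProbabilityMeasure_map mV.aemeasurable
  have hπ : P {ω | V ω ∈ B} = μ B := (Measure.map_apply mV hB).symm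
  set π := P {ω | V ω ∈ B} with hπd
  have hG : ∀ G ∈ 𝒢, π ≤ μ {v | (v, G) ∈ D} := by
    intro G hG
    obtain ⟨O, hO, hO2⟩ := h G hG
    have mO : Measurable (fun v : Matrix (Fin n) R ℝ => v * O) := by
      have : Continuous (fun v : Matrix (Fin n) R ℝ => v * O) := by fun_prop
      exact this.measurable
    have e1 : μ B = P {ω | V ω * O ∈ B} := by
      rw [← h2 O hO]
      exact Measure.map_apply (mO.comp mV) hB
    have e2 : μ {v | (v, G) ∈ D} = P {ω | (V ω, G) ∈ D} :=
      Measure.map_apply mV (measurable_prodMk_right hD)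
    rw [hπ, e1, e2]
    exact measure_mono fun ω hω => hO2 _ hω
  have hI : π * γ 𝒢 ≤ β := by
    calc π * γ 𝒢 = ∫⁻ _ in 𝒢, π ∂γ := by simp
      _ ≤ ∫⁻ G in 𝒢, μ {v | (v, G) ∈ D} ∂γ := setLIntegral_mono' h𝒢 hG
      _ ≤ ∫⁻ G, μ {v | (v, G) ∈ D} ∂γ := setLIntegral_le_lintegral _ _
      _ = (μ.prod γ) D := (Measure.prod_apply_symm hD).symm
      _ = ∫⁻ v, γ {G | (v, G) ∈ D} ∂μ := Measure.prod_apply hD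
      _ = ∫⁻ ω, γ {G | (V ω, G) ∈ D} ∂P := lintegral_map (measurable_measure_prodMk_left hD) mV
      _ ≤ ∫⁻ _, β ∂P := lintegral_mono_ae (h1.mono fun ω hω => hβ _ hω)
      _ = β := by simp
  calc π = π * (γ 𝒢ᶜ + γ 𝒢) := by
        rw [add_comm, measure_add_measure_compl h𝒢, measure_univ, mul_one]
    _ = π * γ 𝒢ᶜ + π * γ 𝒢 := mul_add _ _ _
    _ ≤ 1 * γ 𝒢ᶜ + β := by gcongr; exact prob_le_one
    _ = _ := by rw [one_mul]

end fubini

/-! ### Part I: single block tails -/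

section block
variable {Ω : Type*} [MeasurableSpace Ω]

lemma continuous_mv_vG {n : ℕ} {R ν : Type*} [Fintype R] [Fintype ν] (y : ν → ℝ) :
    Continuous (fun q : Matrix (Fin n) R ℝ × (R × ν → ℝ) => euclNorm (mv (vG q.1 q.2) y)) := by
  refine continuous_euclNorm.comp ?_
  refine continuous_pi fun i => ?_
  unfold mv vG
  refine continuous_finsetSum _ fun k _ => Continuous.mul (continuous_finsetSum _ fun r _ => ?_)
    continuous_const
  exact (continuous_fst.matrix_elem i r).mul ((continuous_apply (r, k)).comp continuous_snd)

lemma continuous_block {n p d : ℕ} (k : Fin p) (x : Fin d → ℝ) :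
    Continuous (fun v : Matrix (Fin n) (Fin p × Fin d) ℝ => euclNorm (colBlock v k *ᵥ x)) := by
  refine continuous_euclNorm.comp ?_
  refine continuous_pi fun i => ?_
  simp only [Matrix.mulVec, dotProduct, colBlock]
  refine continuous_finsetSum _ fun l _ => Continuous.mul ?_ continuous_const
  exact continuous_id.matrix_elem i (k, l)

lemma ex_open_lt {X Y : Type*} [TopologicalSpace X] {f g : Y → X → ℝ} (hf : ∀ y, Continuous (f y))
    (hg : ∀ y, Continuous (g y)) : IsOpen {x | ∃ y, f y x < g y x} := by
  have : {x | ∃ y, f y x < g y x} = ⋃ y, {x | f y x < g y x} := by ext x; simp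
  rw [this]
  exact isOpen_iUnion fun y => isOpen_lt (hf y) (hg y)

variable {n p d : ℕ} (P : Measure Ω) [IsProbabilityMeasure P]
    (V : Ω → Matrix (Fin n) (Fin p × Fin d) ℝ) (k : Fin p)

lemma block_upper (hV : IsUniformStiefel P V) (hn : 0 < n) (hd : 0 < d) (c τ₁ τ₂ c₂ : ℝ) (hτ₁ : 0 < τ₁) (hτ₂ : 0 < τ₂) (hc : 0 ≤ c)
    (hc₂ : c₂ = √(p * d : ℕ) - 3 / 2 * (√d + τ₂)) (hc₂0 : 0 < c₂)
    (h : √n + √d + τ₁ ≤ c * c₂) :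
    P {ω | ∃ x, c * euclNorm x < euclNorm (colBlock (V ω) k *ᵥ x)} ≤
      ENNReal.ofReal (Real.exp (-τ₂ ^ 2 / 2)) + ENNReal.ofReal (Real.exp (-τ₁ ^ 2 / 2)) := by
  have : Nonempty (Fin n) := ⟨⟨0, hn⟩⟩
  have : Nonempty (Fin d) := ⟨⟨0, hd⟩⟩
  have : Nonempty (Fin p) := ⟨k⟩
  have hGo : IsOpen {G : (Fin p × Fin d) × Fin d → ℝ | ∃ y, euclNorm (mv G y) < c₂ * euclNorm y} :=
    ex_open_lt (fun y => continuous_euclNorm.comp (continuous_mv y)) (fun y => continuous_const)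
  refine (stiefel_fubini P (gam ((Fin p × Fin d) × Fin d)) V hV
    {v | ∃ x, c * euclNorm x < euclNorm (colBlock v k *ᵥ x)}
    (ex_open_lt (fun x => continuous_const) (fun x => continuous_block k x)).measurableSet
    {q | ∃ y, (√n + √d + τ₁) * euclNorm y < euclNorm (mv (vG q.1 q.2) y)}
    (ex_open_lt (fun x => continuous_const) (fun x => continuous_mv_vG x)).measurableSet
    {G | ∃ y, euclNorm (mv G y) < c₂ * euclNorm y}ᶜ hGo.measurableSet.compl ?_
    (ENNReal.ofReal (Real.exp (-τ₁ ^ 2 / 2))) ?_).trans ?_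
  · intro G hG
    have hG' : ∀ y, c₂ * euclNorm y ≤ euclNorm (mv G y) := by
      intro y
      by_contra hy
      exact hG ⟨y, not_le.1 hy⟩
    obtain ⟨O, hO, hO2⟩ := exists_orth' (n := n) G (fun y hy => by
      have := hG' y
      rw [hy, euclNorm_zero] at this
      exact euclNorm_eq_zero (le_antisymm (by nlinarith [euclNorm_nonneg y]) (euclNorm_nonneg y))) k
    refine ⟨O, hO, ?_⟩
    rintro v ⟨x, hx⟩
    obtain ⟨y, hy1, hy2⟩ := hO2 v x
    refine ⟨y, ?_⟩
    rw [hy2, ← hy1] at hx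
    refine lt_of_le_of_lt ?_ hx
    calc _ ≤ c * c₂ * euclNorm y := mul_le_mul_of_nonneg_right h (euclNorm_nonneg y)
      _ = c * (c₂ * euclNorm y) := by ring
      _ ≤ _ := mul_le_mul_of_nonneg_left (hG' y) hc
  · intro v hv
    have h1 := tail_upper (κ := Fin n) (ν := Fin d) τ₁ (√n + √d + τ₁) hτ₁ (by simp)
    rw [← gam_map_vG v hv] at h1
    have hm : AEMeasurable (vG (ν := Fin d) v) (gam ((Fin p × Fin d) × Fin d)) := by
      refine Measurable.aemeasurable (measurable_pi_lambda _ fun q => ?_)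
      unfold vG
      fun_prop
    exact (Measure.le_map_apply hm _).trans h1
  · rw [compl_compl]
    gcongr
    exact tail_lower (κ := Fin p × Fin d) (ν := Fin d) τ₂ c₂ hτ₂ (by rw [hc₂]; simp)

lemma block_lower (hV : IsUniformStiefel P V) (hn : 0 < n) (hd : 0 < d) (c τ₁ τ₂ τ₃ c₂ c₃ : ℝ) (hτ₁ : 0 < τ₁) (hτ₂ : 0 < τ₂)
    (hτ₃ : 0 < τ₃) (hc : 0 ≤ c)
    (hc₂ : c₂ = √(p * d : ℕ) - 3 / 2 * (√d + τ₃)) (hc₂0 : 0 < c₂)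
    (hc₃ : c₃ = √(p * d : ℕ) + √d + τ₂)
    (h : c * c₃ ≤ √n - 3 / 2 * (√d + τ₁)) :
    P {ω | ∃ x, euclNorm (colBlock (V ω) k *ᵥ x) < c * euclNorm x} ≤
      ENNReal.ofReal (Real.exp (-τ₃ ^ 2 / 2)) + ENNReal.ofReal (Real.exp (-τ₂ ^ 2 / 2))
        + ENNReal.ofReal (Real.exp (-τ₁ ^ 2 / 2)) := by
  have : Nonempty (Fin n) := ⟨⟨0, hn⟩⟩
  have : Nonempty (Fin d) := ⟨⟨0, hd⟩⟩
  have : Nonempty (Fin p) := ⟨k⟩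
  have hGo : IsOpen {G : (Fin p × Fin d) × Fin d → ℝ | ∃ y, euclNorm (mv G y) < c₂ * euclNorm y} :=
    ex_open_lt (fun y => continuous_euclNorm.comp (continuous_mv y)) (fun y => continuous_const)
  have hGo2 : IsOpen {G : (Fin p × Fin d) × Fin d → ℝ | ∃ y, c₃ * euclNorm y < euclNorm (mv G y)} :=
    ex_open_lt (fun y => continuous_const) (fun y => continuous_euclNorm.comp (continuous_mv y))
  refine (stiefel_fubini P (gam ((Fin p × Fin d) × Fin d)) V hV
    {v | ∃ x, euclNorm (colBlock v k *ᵥ x) < c * euclNorm x}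
    (ex_open_lt (fun x => continuous_block k x) (fun x => continuous_const)).measurableSet
    {q | ∃ y, euclNorm (mv (vG q.1 q.2) y) < (√n - 3 / 2 * (√d + τ₁)) * euclNorm y}
    (ex_open_lt (fun x => continuous_mv_vG x) (fun x => continuous_const)).measurableSet
    ({G | ∃ y, euclNorm (mv G y) < c₂ * euclNorm y} ∪ {G | ∃ y, c₃ * euclNorm y < euclNorm (mv G y)})ᶜ
    (hGo.union hGo2).measurableSet.compl ?_
    (ENNReal.ofReal (Real.exp (-τ₁ ^ 2 / 2))) ?_).trans ?_
  · intro G hG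
    have hG' : ∀ y, c₂ * euclNorm y ≤ euclNorm (mv G y) := by
      intro y
      by_contra hy
      exact hG (Or.inl ⟨y, not_le.1 hy⟩)
    have hG2 : ∀ y, euclNorm (mv G y) ≤ c₃ * euclNorm y := by
      intro y
      by_contra hy
      exact hG (Or.inr ⟨y, not_le.1 hy⟩)
    obtain ⟨O, hO, hO2⟩ := exists_orth' (n := n) G (fun y hy => by
      have := hG' y
      rw [hy, euclNorm_zero] at this
      exact euclNorm_eq_zero (le_antisymm (by nlinarith [euclNorm_nonneg y]) (euclNorm_nonneg y))) k
    refine ⟨O, hO, ?_⟩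
    rintro v ⟨x, hx⟩
    obtain ⟨y, hy1, hy2⟩ := hO2 v x
    refine ⟨y, ?_⟩
    rw [hy2, ← hy1] at hx
    refine lt_of_lt_of_le hx ?_
    calc _ ≤ c * (c₃ * euclNorm y) := mul_le_mul_of_nonneg_left (hG2 y) hc
      _ = c * c₃ * euclNorm y := by ring
      _ ≤ _ := mul_le_mul_of_nonneg_right h (euclNorm_nonneg y)
  · intro v hv
    have h1 := tail_lower (κ := Fin n) (ν := Fin d) τ₁ (√n - 3 / 2 * (√d + τ₁)) hτ₁ (by simp)
    rw [← gam_map_vG v hv] at h1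
    have hm : AEMeasurable (vG (ν := Fin d) v) (gam ((Fin p × Fin d) × Fin d)) := by
      refine Measurable.aemeasurable (measurable_pi_lambda _ fun q => ?_)
      unfold vG
      fun_prop
    exact (Measure.le_map_apply hm _).trans h1
  · rw [compl_compl]
    gcongr
    refine (measure_union_le _ _).trans ?_
    gcongr
    · exact tail_lower (κ := Fin p × Fin d) (ν := Fin d) τ₃ c₂ hτ₃ (by rw [hc₂]; simp)
    · exact tail_upper (κ := Fin p × Fin d) (ν := Fin d) τ₂ c₃ hτ₂ (by rw [hc₃]; simp)

end block

/-! ### Part J: deterministic estimates and conclusion -/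

section determ

lemma norm_toLp {ι : Type*} [Fintype ι] (x : ι → ℝ) :
    ‖(WithLp.toLp 2 x : EuclideanSpace ℝ ι)‖ = euclNorm x := by
  rw [EuclideanSpace.norm_eq]
  simp [euclNorm]

lemma specNorm_le {m n : Type*} [Fintype m] [Fintype n] [DecidableEq n] (A : Matrix m n ℝ) (C : ℝ)
    (hC : 0 ≤ C) (h : ∀ x, euclNorm (A *ᵥ x) ≤ C * euclNorm x) : specNorm A ≤ C := by
  unfold specNorm
  refine ContinuousLinearMap.opNorm_le_bound _ hC fun x => ?_
  have := h (WithLp.ofLp x)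
  rw [← norm_toLp, ← norm_toLp] at this
  exact this

lemma gram_inv {n d : ℕ} (A : Matrix (Fin n) (Fin d) ℝ) (s c σ : ℝ) (hs : 0 ≤ s) (hσ : σ = s * c ^ 2)
    (hσ0 : 0 < σ) (hc : 0 ≤ c) (h : ∀ x, c * euclNorm x ≤ euclNorm (A *ᵥ x)) :
    IsUnit (s • (Aᵀ * A)) ∧ specNorm ((s • (Aᵀ * A))⁻¹) ≤ σ⁻¹ := by
  set M := s • (Aᵀ * A) with hM
  have h1 : ∀ x, σ * euclNorm x ≤ euclNorm (M *ᵥ x) := by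
    intro x
    have e1 : ∑ i, (M *ᵥ x) i * x i = s * euclNorm (A *ᵥ x) ^ 2 := by
      have : (M *ᵥ x) ⬝ᵥ x = s * ((A *ᵥ x) ⬝ᵥ (A *ᵥ x)) := by
        rw [hM, Matrix.smul_mulVec, smul_dotProduct, smul_eq_mul, ← Matrix.mulVec_mulVec,
          dotProduct_comm, Matrix.dotProduct_mulVec, Matrix.vecMul_transpose]
      rw [← ip_self]
      exact this
    have e2 := ip_le (M *ᵥ x) x
    rw [e1] at e2
    have e3 : (c * euclNorm x) ^ 2 ≤ euclNorm (A *ᵥ x) ^ 2 :=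
      pow_le_pow_left₀ (mul_nonneg hc (euclNorm_nonneg x)) (h x) 2
    have e4 : σ * euclNorm x ^ 2 ≤ euclNorm (M *ᵥ x) * euclNorm x := by
      refine le_trans ?_ e2
      rw [hσ]
      calc s * c ^ 2 * euclNorm x ^ 2 = s * (c * euclNorm x) ^ 2 := by ring
        _ ≤ _ := mul_le_mul_of_nonneg_left e3 hs
    rcases (euclNorm_nonneg x).eq_or_lt with h0 | h0
    · rw [← h0, mul_zero]; exact euclNorm_nonneg _
    · refine le_of_mul_le_mul_right ?_ h0
      calc _ = σ * euclNorm x ^ 2 := by ring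
        _ ≤ _ := e4
  have hU : IsUnit M := by
    rw [← Matrix.mulVec_injective_iff_isUnit]
    intro x y hxy
    have h2 := h1 (x - y)
    rw [Matrix.mulVec_sub, hxy, sub_self, euclNorm_zero] at h2
    have h3 : euclNorm (x - y) = 0 := le_antisymm (by nlinarith [euclNorm_nonneg (x - y)]) (euclNorm_nonneg _)
    exact sub_eq_zero.1 (euclNorm_eq_zero h3)
  refine ⟨hU, specNorm_le _ _ (inv_pos.2 hσ0).le fun y => ?_⟩
  have h2 := h1 (M⁻¹ *ᵥ y)
  rw [Matrix.mulVec_mulVec, Matrix.mul_nonsing_inv _ ((Matrix.isUnit_iff_isUnit_det _).1 hU),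
    Matrix.one_mulVec] at h2
  rw [← div_eq_inv_mul, le_div_iff₀ hσ0, mul_comm]
  exact h2

lemma delta_upper (e1 e2 e3 e Δ : ℝ) (h1 : 0 < e1) (h1' : e1 < 1) (he : 0 < e) (h2 : e ≤ e2) (h3 : e ≤ e3)
    (h3' : e3 < 1 / 3) (hΔ : Δ = (3 * e1 + 3 * e2) / (1 - 3 * e3)) :
    (1 + e1) / (1 - 3 / 2 * e) < √(1 + Δ) := by
  have hp : 0 < 1 - 3 / 2 * e := by linarith
  refine Real.lt_sqrt_of_sq_lt ?_
  have hΔ1 : (3 * e1 + 3 * e) / (1 - 3 * e) ≤ Δ := by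
    rw [hΔ]
    refine div_le_div₀ (by linarith) (by linarith) (by linarith) (by linarith)
  have e5 : 1 + (3 * e1 + 3 * e) / (1 - 3 * e) = (1 + 3 * e1) / (1 - 3 * e) := by
    have : 1 - 3 * e ≠ 0 := by linarith
    field_simp; ring
  refine lt_of_lt_of_le ?_ (add_le_add_right hΔ1 1)
  rw [e5, div_pow]
  refine (div_lt_div_iff₀ (by positivity) (by linarith)).2 ?_
  have a1 : (1 + e1) ^ 2 < 1 + 3 * e1 := by nlinarith
  have a2 : 1 - 3 * e < (1 - 3 / 2 * e) ^ 2 := by nlinarith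
  exact mul_lt_mul'' a1 a2 (by positivity) (by linarith)

lemma delta_lower (e1 e2 e3 Δ : ℝ) (h1 : 0 < e1) (h2 : 0 < e2) (h2' : e2 < 1) (h3 : 0 < e3)
    (h3' : e3 < 1 / 3) (hΔ : Δ = (3 * e1 + 3 * e2) / (1 - 3 * e3)) (hΔ1 : Δ < 1) :
    3 * e1 < 1 ∧ 1 - Δ < ((1 - 3 / 2 * e1) / (1 + e2)) ^ 2 := by
  have hp : 0 < 1 - 3 * e3 := by linarith
  have ha : 3 * e1 + 3 * e2 ≤ Δ := by
    rw [hΔ, le_div_iff₀ hp]; nlinarith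
  refine ⟨by linarith, ?_⟩
  rw [div_pow, lt_div_iff₀ (by positivity)]
  have a1 : (1 + e2) ^ 2 < 1 + 3 * e2 := by nlinarith
  have a2 : 1 - 3 * e1 < (1 - 3 / 2 * e1) ^ 2 := by nlinarith
  have a3 : (1 - Δ) * (1 + e2) ^ 2 ≤ (1 - 3 * e1 - 3 * e2) * (1 + 3 * e2) :=
    mul_le_mul (by linarith) a1.le (by positivity) (by linarith)
  nlinarith

end determ

section final

lemma cancel_aux (x y z w : ℝ) (hy : y ≠ 0) (hw : w ≠ 0) :
    x / y * (z / w) * (y * w) = x * z := by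
  field_simp

lemma one_block {Ω : Type*} [MeasurableSpace Ω] (P : Measure Ω) [IsProbabilityMeasure P]
    (n p d : ℕ) (V : Ω → Matrix (Fin n) (Fin p × Fin d) ℝ)
    (hV : IsUniformStiefel P V) (k : Fin p)
    (hpd : n ≤ (p - 1) * d)
    (t₁₁ t₁₂ t₁₃ : ℝ) (ht₁₁ : 0 < t₁₁) (ht₁₂ : 0 < t₁₂) (ht₁₃ : 0 < t₁₃)
    (h₁ : Real.sqrt ((d : ℝ) / n) + t₁₁ < 1)
    (h₂ : Real.sqrt (1 / (p : ℝ)) + t₁₂ < 1)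
    (h₃ : Real.sqrt (1 / (p : ℝ)) + t₁₃ < 1 / 3)
    (Δ : ℝ)
    (hΔ : Δ = (3 * (Real.sqrt ((d : ℝ) / n) + t₁₁) + 3 * (Real.sqrt (1 / (p : ℝ)) + t₁₂))
              / (1 - 3 * (Real.sqrt (1 / (p : ℝ)) + t₁₃))) :
    P {ω | Real.sqrt (1 + Δ)
          ≤ specNorm (Real.sqrt ((p * d : ℕ) / (n : ℝ)) • colBlock (V ω) k)}
      ≤ ENNReal.ofReal (2 * Real.exp (-(n : ℝ) * t₁₁ ^ 2 / 2)
          + 2 * Real.exp (-((p * d : ℕ) : ℝ) * t₁₂ ^ 2 / 2)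
          + Real.exp (-((p * d : ℕ) : ℝ) * t₁₃ ^ 2 / 2))
    ∧ (Δ < 1 →
      P {ω | ¬ IsUnit (((p * d : ℕ) / (n : ℝ)) • ((colBlock (V ω) k)ᵀ * colBlock (V ω) k))
            ∨ (1 - Δ)⁻¹
              ≤ specNorm ((((p * d : ℕ) / (n : ℝ)) •
                  ((colBlock (V ω) k)ᵀ * colBlock (V ω) k))⁻¹)}
        ≤ ENNReal.ofReal (2 * Real.exp (-(n : ℝ) * t₁₁ ^ 2 / 2)
            + 2 * Real.exp (-((p * d : ℕ) : ℝ) * t₁₂ ^ 2 / 2)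
            + Real.exp (-((p * d : ℕ) : ℝ) * t₁₃ ^ 2 / 2))) := by
  rcases Nat.eq_zero_or_pos n with hn | hn
  · have hβ : (1 : ℝ≥0∞) ≤ ENNReal.ofReal (2 * Real.exp (-(n : ℝ) * t₁₁ ^ 2 / 2)
          + 2 * Real.exp (-((p * d : ℕ) : ℝ) * t₁₂ ^ 2 / 2)
          + Real.exp (-((p * d : ℕ) : ℝ) * t₁₃ ^ 2 / 2)) := by
      rw [ENNReal.one_le_ofReal, hn]
      have e1 : Real.exp (-((0 : ℕ) : ℝ) * t₁₁ ^ 2 / 2) = 1 := by simp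
      rw [e1]
      linarith [Real.exp_pos (-((p * d : ℕ) : ℝ) * t₁₂ ^ 2 / 2),
        Real.exp_pos (-((p * d : ℕ) : ℝ) * t₁₃ ^ 2 / 2)]
    exact ⟨prob_le_one.trans hβ, fun _ => prob_le_one.trans hβ⟩
  have hd : 0 < d := by
    rcases Nat.eq_zero_or_pos d with h | h
    · subst h; simp at hpd; omega
    · exact h
  have hp : 0 < p := k.pos
  have hN : 0 < p * d := Nat.mul_pos hp hd
  have hnR : (0:ℝ) < n := by exact_mod_cast hn
  have hdR : (0:ℝ) < d := by exact_mod_cast hd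
  have hpR : (0:ℝ) < p := by exact_mod_cast hp
  have hNR : (0:ℝ) < (p * d : ℕ) := by exact_mod_cast hN
  set N : ℝ := ((p * d : ℕ) : ℝ) with hNdef
  have sn : 0 < √(n : ℝ) := Real.sqrt_pos.2 hnR
  have sN : 0 < √N := Real.sqrt_pos.2 hNR
  have sn2 : √(n : ℝ) ^ 2 = n := Real.sq_sqrt hnR.le
  have sN2 : √N ^ 2 = N := Real.sq_sqrt hNR.le
  have q1 : √(d : ℝ) = √(n : ℝ) * √((d : ℝ) / n) := by
    rw [← Real.sqrt_mul hnR.le]; congr 1; field_simp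
  have q2 : √(d : ℝ) = √N * √(1 / (p : ℝ)) := by
    rw [← Real.sqrt_mul hNR.le]; congr 1; rw [hNdef]; push_cast; field_simp
  have r1 : 0 < √((d : ℝ) / n) := Real.sqrt_pos.2 (by positivity)
  have r2 : 0 < √(1 / (p : ℝ)) := Real.sqrt_pos.2 (by positivity)
  set a := √((d : ℝ) / n)
  set b := √(1 / (p : ℝ))
  have sd : √(N / (n : ℝ)) = √N / √(n : ℝ) := Real.sqrt_div hNR.le _
  have ex1 : Real.exp (-(t₁₁ * √(n : ℝ)) ^ 2 / 2) = Real.exp (-(n : ℝ) * t₁₁ ^ 2 / 2) := by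
    rw [mul_pow, sn2]; congr 1; ring
  have ex2 : ∀ t : ℝ, Real.exp (-(t * √N) ^ 2 / 2) = Real.exp (-N * t ^ 2 / 2) := fun t => by
    rw [mul_pow, sN2]; congr 1; ring
  have p1 := Real.exp_pos (-(n : ℝ) * t₁₁ ^ 2 / 2)
  have p2 := Real.exp_pos (-N * t₁₂ ^ 2 / 2)
  have p3 := Real.exp_pos (-N * t₁₃ ^ 2 / 2)
  constructor
  · set t := min t₁₂ t₁₃ with ht
    have ht0 : 0 < t := lt_min ht₁₂ ht₁₃
    have htl : t ≤ t₁₂ := min_le_left _ _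
    have htr : t ≤ t₁₃ := min_le_right _ _
    have hdel := delta_upper (a + t₁₁) (b + t₁₂) (b + t₁₃) (b + t) Δ (by linarith) h₁ (by linarith)
      (by linarith) (by linarith) h₃ hΔ
    have hpos : 0 < 1 - 3 / 2 * (b + t) := by linarith
    have hb := block_upper P V k hV hn hd
      (√(n : ℝ) / √N * ((1 + (a + t₁₁)) / (1 - 3 / 2 * (b + t)))) (t₁₁ * √(n : ℝ)) (t * √N)
      (√N * (1 - 3 / 2 * (b + t))) (by positivity) (by positivity) (by positivity)
      (by rw [← hNdef, q2]; ring) (by positivity)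
      (le_of_eq (by rw [q1, cancel_aux _ _ _ _ sN.ne' hpos.ne']; ring))
    rw [ex1, ex2, ← ENNReal.ofReal_add (Real.exp_pos _).le (Real.exp_pos _).le] at hb
    refine (measure_mono ?_).trans (hb.trans (ENNReal.ofReal_le_ofReal ?_))
    · intro ω hω
      by_contra hcon
      have hall : ∀ x, euclNorm (colBlock (V ω) k *ᵥ x) ≤
          (√(n : ℝ) / √N * ((1 + (a + t₁₁)) / (1 - 3 / 2 * (b + t)))) * euclNorm x := by
        intro x
        by_contra hx
        exact hcon ⟨x, not_le.1 hx⟩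
      have hle := specNorm_le (√(N / (n : ℝ)) • colBlock (V ω) k)
        ((1 + (a + t₁₁)) / (1 - 3 / 2 * (b + t))) (by positivity) (fun x => by
          rw [Matrix.smul_mulVec]
          have e := euclNorm_smul (√(N / (n : ℝ))) (colBlock (V ω) k *ᵥ x)
          change euclNorm (fun i => √(N / (n : ℝ)) * (colBlock (V ω) k *ᵥ x) i) ≤ _
          rw [e, abs_of_nonneg (Real.sqrt_nonneg _)]
          refine (mul_le_mul_of_nonneg_left (hall x) (Real.sqrt_nonneg _)).trans (le_of_eq ?_)
          rw [sd]
          field_simp)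
      exact absurd (lt_of_le_of_lt hle hdel) (not_lt.2 hω)
    · have : Real.exp (-N * t ^ 2 / 2) ≤ Real.exp (-N * t₁₂ ^ 2 / 2) + Real.exp (-N * t₁₃ ^ 2 / 2) := by
        rcases min_choice t₁₂ t₁₃ with h | h <;> rw [ht, h] <;> linarith
      linarith
  · intro hΔ1
    obtain ⟨ha, hdel⟩ := delta_lower (a + t₁₁) (b + t₁₂) (b + t₁₃) Δ (by linarith) (by linarith) h₂
      (by linarith) h₃ hΔ hΔ1
    have hpos : 0 < 1 - 3 / 2 * (a + t₁₁) := by linarith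
    have hpos3 : 0 < 1 - 3 / 2 * (b + t₁₃) := by linarith
    have hb := block_lower P V k hV hn hd
      (√(n : ℝ) / √N * ((1 - 3 / 2 * (a + t₁₁)) / (1 + (b + t₁₂)))) (t₁₁ * √(n : ℝ)) (t₁₂ * √N) (t₁₃ * √N)
      (√N * (1 - 3 / 2 * (b + t₁₃))) (√N * (1 + (b + t₁₂)))
      (by positivity) (by positivity) (by positivity) (by positivity)
      (by rw [← hNdef, q2]; ring) (by positivity) (by rw [← hNdef, q2]; ring)
      (le_of_eq (by rw [q1]; field_simp))
    rw [ex1, ex2, ex2, ← ENNReal.ofReal_add (Real.exp_pos _).le (Real.exp_pos _).le,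
      ← ENNReal.ofReal_add (by positivity) (Real.exp_pos _).le] at hb
    refine (measure_mono ?_).trans (hb.trans (ENNReal.ofReal_le_ofReal (by linarith)))
    intro ω hω
    by_contra hcon
    have hall : ∀ x, (√(n : ℝ) / √N * ((1 - 3 / 2 * (a + t₁₁)) / (1 + (b + t₁₂)))) * euclNorm x
        ≤ euclNorm (colBlock (V ω) k *ᵥ x) := by
      intro x
      by_contra hx
      exact hcon ⟨x, not_le.1 hx⟩
    obtain ⟨hU, hS⟩ := gram_inv (colBlock (V ω) k) (N / (n : ℝ)) _
      (((1 - 3 / 2 * (a + t₁₁)) / (1 + (b + t₁₂))) ^ 2) (by positivity)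
      (by rw [mul_pow, div_pow (√(n : ℝ)), sn2, sN2]; field_simp)
      (by positivity) (by positivity) hall
    rcases hω with hω | hω
    · exact hω hU
    · have := inv_strictAnti₀ (by linarith : 0 < 1 - Δ) hdel
      linarith

end final

/-- **Lemma S.5.** Uniform single-block Gram concentration over `q` blocks `k ∈ K`
of a uniform Stiefel matrix: bounds on `max_{k∈K} ‖√(pd/n)·V_k‖` and on
`max_{k∈K} ‖((pd/n)·V_kᵀ V_k)⁻¹‖` (the latter with each `V_kᵀ V_k` invertible on the
complementary event, provided `Δ < 1`). -/
theorem stiefel_max_block_gram_concentration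
    {Ω : Type*} [MeasurableSpace Ω] (P : Measure Ω) [IsProbabilityMeasure P]
    (n p d q : ℕ) (V : Ω → Matrix (Fin n) (Fin p × Fin d) ℝ)
    (hV : IsUniformStiefel P V)
    (K : Finset (Fin p)) (hK : K.card = q)
    (hpd : n ≤ (p - 1) * d)
    (t₁₁ t₁₂ t₁₃ : ℝ) (ht₁₁ : 0 < t₁₁) (ht₁₂ : 0 < t₁₂) (ht₁₃ : 0 < t₁₃)
    (h₁ : Real.sqrt ((d : ℝ) / n) + t₁₁ < 1)
    (h₂ : Real.sqrt (1 / (p : ℝ)) + t₁₂ < 1)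
    (h₃ : Real.sqrt (1 / (p : ℝ)) + t₁₃ < 1 / 3)
    (Δ : ℝ)
    (hΔ : Δ = (3 * (Real.sqrt ((d : ℝ) / n) + t₁₁) + 3 * (Real.sqrt (1 / (p : ℝ)) + t₁₂))
              / (1 - 3 * (Real.sqrt (1 / (p : ℝ)) + t₁₃))) :
    P {ω | ∃ k ∈ K, Real.sqrt (1 + Δ)
          ≤ specNorm (Real.sqrt ((p * d : ℕ) / (n : ℝ)) • colBlock (V ω) k)}
      ≤ (q : ℝ≥0∞) * ENNReal.ofReal (2 * Real.exp (-(n : ℝ) * t₁₁ ^ 2 / 2)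
          + 2 * Real.exp (-((p * d : ℕ) : ℝ) * t₁₂ ^ 2 / 2)
          + Real.exp (-((p * d : ℕ) : ℝ) * t₁₃ ^ 2 / 2))
    ∧ (Δ < 1 →
      P {ω | ∃ k ∈ K,
            ¬ IsUnit (((p * d : ℕ) / (n : ℝ)) • ((colBlock (V ω) k)ᵀ * colBlock (V ω) k))
            ∨ (1 - Δ)⁻¹
              ≤ specNorm ((((p * d : ℕ) / (n : ℝ)) •
                  ((colBlock (V ω) k)ᵀ * colBlock (V ω) k))⁻¹)}
        ≤ (q : ℝ≥0∞) * ENNReal.ofReal (2 * Real.exp (-(n : ℝ) * t₁₁ ^ 2 / 2)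
            + 2 * Real.exp (-((p * d : ℕ) : ℝ) * t₁₂ ^ 2 / 2)
            + Real.exp (-((p * d : ℕ) : ℝ) * t₁₃ ^ 2 / 2))) := by
  have key : ∀ (S : Fin p → Set Ω) (c : ℝ≥0∞), (∀ k, P (S k) ≤ c) →
      P {ω | ∃ k ∈ K, ω ∈ S k} ≤ (q : ℝ≥0∞) * c := by
    intro S c hS
    have hsub : {ω | ∃ k ∈ K, ω ∈ S k} ⊆ ⋃ k ∈ K, S k := by
      rintro ω ⟨k, hk, hω⟩
      exact Set.mem_biUnion hk hω
    refine (measure_mono hsub).trans ((measure_biUnion_finset_le K S).trans ?_)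
    refine (Finset.sum_le_sum fun k _ => hS k).trans ?_
    rw [Finset.sum_const, nsmul_eq_mul, hK]
  have ob := fun k => one_block P n p d V hV k hpd t₁₁ t₁₂ t₁₃ ht₁₁ ht₁₂ ht₁₃ h₁ h₂ h₃ Δ hΔ
  exact ⟨key _ _ fun k => (ob k).1, fun hΔ1 => key _ _ fun k => (ob k).2 hΔ1⟩
end
end

section
/- Let V be an n×(p·d) random real matrix uniformly distributed on the Stiefel manifold V(n, p·d), with columns partitioned into p consecutive blocks of d columns, and let K ⊆ {1,…,p} with |K| = q. Suppose (p − 1)·d ≥ n, √(d/n) ≤ 1/120, and √(1/p) ≤ 1/120. Then P[ max_{k∈K} ‖√(p d/n)·V_k‖ ≥ √(8/7) ] ≤ 5 q·exp(−n/28800) and P[ max_{k∈K} ‖((p d/n)·V_kᵀ V_k)^{−1}‖ ≥ 7/6 ] ≤ 5 q·exp(−n/28800) (with each V_kᵀV_k invertible on the complementary event). -/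
open MeasureTheory ProbabilityTheory Filter Matrix
open scoped ENNReal NNReal

noncomputable section

lemma gauss_sq_integrable {s : ℝ} (hs : s < 1 / 2) :
    Integrable (fun x : ℝ => Real.exp (s * x ^ 2)) (gaussianReal 0 1) := by
  rw [gaussianReal_of_var_ne_zero 0 one_ne_zero]
  rw [integrable_withDensity_iff (measurable_gaussianPDF 0 1)
    (Filter.Eventually.of_forall fun x => gaussianPDF_lt_top)]
  have h := (integrable_exp_neg_mul_sq (b := 1 / 2 - s) (by linarith)).const_mul
    ((Real.sqrt (2 * Real.pi))⁻¹)
  refine h.congr (Filter.Eventually.of_forall fun x => ?_)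
  simp only [toReal_gaussianPDF, gaussianPDFReal]
  rw [mul_left_comm, ← Real.exp_add]
  simp
  left
  ring_nf

lemma gauss_sq_integral {s : ℝ} (hs : s < 1 / 2) :
    ∫ x : ℝ, Real.exp (s * x ^ 2) ∂(gaussianReal 0 1) = (Real.sqrt (1 - 2 * s))⁻¹ := by
  rw [integral_gaussianReal_eq_integral_smul one_ne_zero]
  have : ∀ x : ℝ, gaussianPDFReal 0 1 x • Real.exp (s * x ^ 2)
      = (Real.sqrt (2 * Real.pi))⁻¹ * Real.exp (-(1 / 2 - s) * x ^ 2) := by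
    intro x
    simp only [gaussianPDFReal, smul_eq_mul]
    rw [mul_assoc, ← Real.exp_add]
    simp
    left
    ring_nf
  simp_rw [this]
  rw [integral_const_mul, integral_gaussian, ← Real.sqrt_inv, ← Real.sqrt_inv, ← Real.sqrt_mul]
  · congr 1
    have : (1 - 2 * s) ≠ 0 := by linarith
    have : (1 / 2 - s) ≠ 0 := by linarith
    have := Real.pi_ne_zero
    field_simp
  · positivity

lemma std_mgf_integrable {ι : Type*} [Fintype ι] {s : ℝ} (hs : s < 1 / 2) :
    Integrable (fun x : EuclideanSpace ℝ ι => Real.exp (s * ‖x‖ ^ 2))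
      (stdGaussian (EuclideanSpace ℝ ι)) := by
  rw [← map_pi_eq_stdGaussian, integrable_map_measure (by fun_prop) (by fun_prop)]
  have : ((fun x : EuclideanSpace ℝ ι => Real.exp (s * ‖x‖ ^ 2)) ∘ WithLp.toLp 2)
      = fun x : ι → ℝ => ∏ i, Real.exp (s * x i ^ 2) := by
    ext x
    simp [EuclideanSpace.real_norm_sq_eq, Finset.mul_sum, Real.exp_sum]
  rw [this]
  exact Integrable.fintype_prod (fun _ => gauss_sq_integrable hs)

lemma std_mgf {ι : Type*} [Fintype ι] {s : ℝ} (hs : s < 1 / 2) :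
    mgf (fun x : EuclideanSpace ℝ ι => ‖x‖ ^ 2) (stdGaussian (EuclideanSpace ℝ ι)) s
      = ((Real.sqrt (1 - 2 * s))⁻¹) ^ (Fintype.card ι) := by
  rw [mgf, ← map_pi_eq_stdGaussian, integral_map (by fun_prop) (by fun_prop)]
  have : ∀ x : ι → ℝ, Real.exp (s * ‖WithLp.toLp 2 x‖ ^ 2)
      = ∏ i, Real.exp (s * x i ^ 2) := by
    intro x
    simp [EuclideanSpace.real_norm_sq_eq, Finset.mul_sum, Real.exp_sum]
  simp_rw [this]
  rw [integral_fintype_prod_eq_pow (fun x => Real.exp (s * x ^ 2)), gauss_sq_integral hs]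

lemma chi_upper_s11 {ι : Type*} [Fintype ι] :
    (stdGaussian (EuclideanSpace ℝ ι)).real {x | 31 / 30 * (Fintype.card ι : ℝ) ≤ ‖x‖ ^ 2}
      ≤ Real.exp (-(Fintype.card ι : ℝ) / 4500) := by
  refine (measure_ge_le_exp_mul_mgf (t := 1 / 62) _ (by norm_num)
    (std_mgf_integrable (by norm_num))).trans ?_
  rw [std_mgf (by norm_num)]
  set m := Fintype.card ι
  have h1 : (Real.sqrt (1 - 2 * (1 / 62)))⁻¹ ≤ Real.exp (1 / 60 - 1 / 4500) := by
    rw [← Real.sqrt_inv]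
    apply Real.sqrt_le_iff.2 ⟨by positivity, ?_⟩
    rw [← Real.exp_nat_mul]
    refine le_trans ?_ (Real.quadratic_le_exp_of_nonneg (by norm_num))
    norm_num
  calc _ ≤ Real.exp (-(1 / 62) * (31 / 30 * (m : ℝ))) * (Real.exp (1 / 60 - 1 / 4500)) ^ m := by
        gcongr
    _ = _ := by
        rw [← Real.exp_nat_mul, ← Real.exp_add]
        congr 1
        ring

lemma chi_lower_s11 {ι : Type*} [Fintype ι] :
    (stdGaussian (EuclideanSpace ℝ ι)).real {x | ‖x‖ ^ 2 ≤ 29 / 30 * (Fintype.card ι : ℝ)}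
      ≤ Real.exp (-(Fintype.card ι : ℝ) / 4500) := by
  refine (measure_le_le_exp_mul_mgf (t := -1 / 58) _ (by norm_num)
    (std_mgf_integrable (by norm_num))).trans ?_
  rw [std_mgf (by norm_num)]
  set m := Fintype.card ι
  have h1 : (Real.sqrt (1 - 2 * (-1 / 58)))⁻¹ ≤ Real.exp (-(1 / 60 + 1 / 4500)) := by
    rw [← Real.sqrt_inv]
    apply Real.sqrt_le_iff.2 ⟨by positivity, ?_⟩
    rw [← Real.exp_nat_mul]
    have := Real.exp_bound (x := ((2 : ℕ) : ℝ) * -(1 / 60 + 1 / 4500)) (by norm_num [abs_le]) (n := 4) (by norm_num)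
    have := (abs_le.1 this).1
    norm_num [Finset.sum_range_succ, Nat.factorial] at this ⊢
    linarith
  calc _ ≤ Real.exp (-(-1 / 58) * (29 / 30 * (m : ℝ))) * (Real.exp (-(1 / 60 + 1 / 4500))) ^ m := by
        gcongr
    _ = _ := by
        rw [← Real.exp_nat_mul, ← Real.exp_add]
        congr 1
        ring

/-- A coisometry pushes the standard Gaussian forward to the standard Gaussian. -/
lemma std_map_coisometry {ι : Type*} [Fintype ι] [DecidableEq ι] {n : ℕ}
    (A : Matrix (Fin n) ι ℝ) (hA : A * Aᵀ = 1) :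
    (stdGaussian (EuclideanSpace ℝ ι)).map (Matrix.toEuclideanLin A)
      = stdGaussian (EuclideanSpace ℝ (Fin n)) := by
  have hc : Continuous (Matrix.toEuclideanLin A) := LinearMap.continuous_of_finiteDimensional _
  have := Measure.isProbabilityMeasure_map (μ := stdGaussian (EuclideanSpace ℝ ι)) hc.aemeasurable
  apply Measure.ext_of_charFun
  ext t
  have hin : ∀ x, inner ℝ (Matrix.toEuclideanLin A x) t
      = inner ℝ x (Matrix.toEuclideanLin Aᵀ t) := by
    intro x
    rw [← Matrix.conjTranspose_eq_transpose_of_trivial, Matrix.toEuclideanLin_conjTranspose_eq_adjoint,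
      LinearMap.adjoint_inner_right]
  have hn : ‖Matrix.toEuclideanLin Aᵀ t‖ ^ 2 = ‖t‖ ^ 2 := by
    rw [← real_inner_self_eq_norm_sq, ← hin, ← real_inner_self_eq_norm_sq]
    congr 1
    have : Matrix.toEuclideanLin A (Matrix.toEuclideanLin Aᵀ t) = Matrix.toEuclideanLin (A * Aᵀ) t := by
      simp
    rw [this, hA]
    simp [Matrix.toLpLin_apply]
  rw [charFun_stdGaussian, charFun_apply, integral_map hc.aemeasurable (by fun_prop)]
  simp_rw [hin]
  rw [← charFun_apply, charFun_stdGaussian]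
  norm_cast
  rw [hn]

lemma gauss_dev {ι : Type*} [Fintype ι] [DecidableEq ι] {n : ℕ} (hn : 0 < n)
    (hN : n ≤ Fintype.card ι)
    (A : Matrix (Fin n) ι ℝ) (hA : A * Aᵀ = 1) :
    stdGaussian (EuclideanSpace ℝ ι) {x | 1 / 14 * ‖x‖ ^ 2 ≤
      |(Fintype.card ι : ℝ) / n * ‖Matrix.toEuclideanLin A x‖ ^ 2 - ‖x‖ ^ 2|}
      ≤ ENNReal.ofReal (4 * Real.exp (-(n : ℝ) / 4500)) := by
  set γ := stdGaussian (EuclideanSpace ℝ ι) with hγ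
  set N := Fintype.card ι with hNdef
  have hc : Continuous (Matrix.toEuclideanLin A) := LinearMap.continuous_of_finiteDimensional _
  have hn' : (0 : ℝ) < n := by exact_mod_cast hn
  have hN' : (n : ℝ) ≤ N := by exact_mod_cast hN
  have hmap := std_map_coisometry A hA
  have u1 := chi_upper_s11 (ι := Fin n)
  have l1 := chi_lower_s11 (ι := Fin n)
  rw [← hmap, map_measureReal_apply hc.measurable
    (measurableSet_le (by fun_prop) (by fun_prop))] at u1 l1
  have u2 := chi_upper_s11 (ι := ι)
  have l2 := chi_lower_s11 (ι := ι)
  simp only [Fintype.card_fin, ← hγ, ← hNdef] at u1 l1 u2 l2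
  have hexp : Real.exp (-(N : ℝ) / 4500) ≤ Real.exp (-(n : ℝ) / 4500) := by
    apply Real.exp_le_exp.2
    linarith
  have hsub : {x | 1 / 14 * ‖x‖ ^ 2 ≤
      |(N : ℝ) / n * ‖Matrix.toEuclideanLin A x‖ ^ 2 - ‖x‖ ^ 2|} ⊆
      (((Matrix.toEuclideanLin A) ⁻¹' {x | 31 / 30 * (n : ℝ) ≤ ‖x‖ ^ 2}) ∪
      ((Matrix.toEuclideanLin A) ⁻¹' {x | ‖x‖ ^ 2 ≤ 29 / 30 * (n : ℝ)})) ∪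
      ({x | 31 / 30 * (N : ℝ) ≤ ‖x‖ ^ 2} ∪ {x | ‖x‖ ^ 2 ≤ 29 / 30 * (N : ℝ)}) := by
    intro x hx
    by_contra hcon
    simp only [Set.mem_union, Set.mem_preimage, Set.mem_ofPred_eq, not_or, not_le] at hcon hx
    obtain ⟨⟨a1, a2⟩, a3, a4⟩ := hcon
    set y := ‖Matrix.toEuclideanLin A x‖ ^ 2
    have hN0 : (0 : ℝ) < N := by linarith
    have hr : (0 : ℝ) < N / n := by positivity
    have b1 : (N : ℝ) / n * y < 31 / 30 * N := by
      calc (N : ℝ) / n * y < N / n * (31 / 30 * n) := by gcongr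
        _ = _ := by field_simp
    have b2 : 29 / 30 * (N : ℝ) < (N : ℝ) / n * y := by
      calc 29 / 30 * (N : ℝ) = N / n * (29 / 30 * n) := by field_simp
        _ < (N : ℝ) / n * y := by gcongr
    rcases le_abs.1 hx with h | h <;> linarith
  have : γ.real {x | 1 / 14 * ‖x‖ ^ 2 ≤
      |(N : ℝ) / n * ‖Matrix.toEuclideanLin A x‖ ^ 2 - ‖x‖ ^ 2|} ≤
      4 * Real.exp (-(n : ℝ) / 4500) := by
    refine (measureReal_mono hsub).trans ?_
    refine (measureReal_union_le _ _).trans ?_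
    have := measureReal_union_le (μ := γ) ((Matrix.toEuclideanLin A) ⁻¹' {x | 31 / 30 * (n : ℝ) ≤ ‖x‖ ^ 2})
      ((Matrix.toEuclideanLin A) ⁻¹' {x | ‖x‖ ^ 2 ≤ 29 / 30 * (n : ℝ)})
    have := measureReal_union_le (μ := γ) {x | 31 / 30 * (N : ℝ) ≤ ‖x‖ ^ 2} {x | ‖x‖ ^ 2 ≤ 29 / 30 * (N : ℝ)}
    linarith
  rw [← ofReal_measureReal]
  exact ENNReal.ofReal_le_ofReal this

lemma exists_householder {ι : Type*} [Fintype ι] [DecidableEq ι] (a b : ι → ℝ)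
    (h : a ⬝ᵥ a = b ⬝ᵥ b) : ∃ O : Matrix ι ι ℝ, O * Oᵀ = 1 ∧ O *ᵥ a = b := by
  by_cases hab : a = b
  · exact ⟨1, by simp, by simp [hab]⟩
  set w := a - b with hw
  have hw0 : w ⬝ᵥ w ≠ 0 := by
    rw [Ne, dotProduct_self_eq_zero]
    exact sub_ne_zero.2 hab
  have hwa : w ⬝ᵥ a = (w ⬝ᵥ w) / 2 := by
    simp only [hw, sub_dotProduct, dotProduct_sub, dotProduct_comm b a]
    linarith
  refine ⟨1 - (2 / (w ⬝ᵥ w)) • vecMulVec w w, ?_, ?_⟩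
  · rw [transpose_sub, transpose_smul, transpose_vecMulVec, transpose_one]
    simp only [sub_mul, mul_sub, one_mul, mul_one, smul_mul_assoc, mul_smul_comm,
      vecMulVec_mul_vecMulVec]
    ext i j
    simp [vecMulVec_apply]
    field_simp
    ring
  · rw [sub_mulVec, one_mulVec, smul_mulVec, vecMulVec_mulVec, hwa]
    ext i
    simp
    field_simp
    simp [hw]

lemma measurable_mv {n : ℕ} {ι : Type*} [Fintype ι] [DecidableEq ι] :
    Measurable (fun z : Matrix (Fin n) ι ℝ × EuclideanSpace ℝ ι =>
      ‖Matrix.toEuclideanLin z.1 z.2‖ ^ 2) := by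
  have : ∀ z : Matrix (Fin n) ι ℝ × EuclideanSpace ℝ ι, ‖Matrix.toEuclideanLin z.1 z.2‖ ^ 2
      = ∑ i, (∑ j, z.1 i j * z.2 j) ^ 2 := by
    intro z
    simp [EuclideanSpace.real_norm_sq_eq, Matrix.toLpLin_apply, mulVec, dotProduct]
  simp_rw [this]
  have h1 : ∀ i j, Measurable (fun z : Matrix (Fin n) ι ℝ × EuclideanSpace ℝ ι => z.1 i j) := by
    intro i j
    exact (measurable_pi_apply j).comp ((measurable_pi_apply i).comp measurable_fst)
  fun_prop

lemma fixed_dev {Ω ι : Type*} [MeasurableSpace Ω] [Fintype ι] [DecidableEq ι] (P : Measure Ω)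
    [IsProbabilityMeasure P] {n : ℕ} (hn : 0 < n) (hN : n ≤ Fintype.card ι)
    (V : Ω → Matrix (Fin n) ι ℝ) (hV : IsUniformStiefel P V) (x : EuclideanSpace ℝ ι)
    (hx : x ≠ 0) :
    P {ω | 1 / 14 * ‖x‖ ^ 2 ≤
      |(Fintype.card ι : ℝ) / n * ‖Matrix.toEuclideanLin (V ω) x‖ ^ 2 - ‖x‖ ^ 2|}
      ≤ ENNReal.ofReal (4 * Real.exp (-(n : ℝ) / 4500)) := by
  obtain ⟨hVm, hV1, hVO⟩ := hV
  set c := (Fintype.card ι : ℝ) / n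
  let S : Set (Matrix (Fin n) ι ℝ × EuclideanSpace ℝ ι) :=
    {z | 1 / 14 * ‖z.2‖ ^ 2 ≤ |c * ‖Matrix.toEuclideanLin z.1 z.2‖ ^ 2 - ‖z.2‖ ^ 2|}
  have hS : MeasurableSet S := by
    have := measurable_mv (n := n) (ι := ι)
    refine measurableSet_le (by fun_prop) ?_
    simp_rw [← Real.norm_eq_abs]
    fun_prop
  -- the distribution does not depend on the direction
  have key : ∀ g : EuclideanSpace ℝ ι, P {ω | (V ω, x) ∈ S} ≤ P {ω | (V ω, g) ∈ S} := by
    intro g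
    by_cases hg : g = 0
    · have : {ω | (V ω, g) ∈ S} = Set.univ := by
        ext ω
        simp [S, hg]
      rw [this, measure_univ]
      exact prob_le_one
    · have hxn : ‖x‖ ≠ 0 := norm_ne_zero_iff.2 hx
      have hgn : ‖g‖ ≠ 0 := norm_ne_zero_iff.2 hg
      set r := ‖x‖ / ‖g‖ with hr
      have hr0 : 0 < r := by positivity
      have hnorm : ‖r • g‖ = ‖x‖ := by
        rw [norm_smul, Real.norm_eq_abs, abs_of_pos hr0, hr]
        field_simp
      obtain ⟨O, hO, hOx⟩ := exists_householder (x.ofLp) ((r • g).ofLp) (by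
        have e1 := EuclideanSpace.real_norm_sq_eq x
        have e2 := EuclideanSpace.real_norm_sq_eq (r • g)
        simp only [dotProduct, ← sq]
        rw [← e1, ← e2, hnorm])
      have hmeas : MeasurableSet {A : Matrix (Fin n) ι ℝ | (A, x) ∈ S} :=
        measurable_prodMk_right hS
      have hmO : Measurable (fun ω => V ω * O) := by
        have hVe : ∀ i j, Measurable (fun ω => V ω i j) := fun i j =>
          (measurable_pi_apply j).comp ((measurable_pi_apply i).comp hVm)
        refine measurable_pi_iff.2 fun i => measurable_pi_iff.2 fun j => ?_
        simp only [Matrix.mul_apply]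
        fun_prop
      have e := congrArg (fun μ => μ {A : Matrix (Fin n) ι ℝ | (A, x) ∈ S}) (hVO O hO)
      simp only [Measure.map_apply hVm hmeas, Measure.map_apply hmO hmeas] at e
      change P {ω | (V ω * O, x) ∈ S} = P {ω | (V ω, x) ∈ S} at e
      rw [← e]
      apply measure_mono
      intro ω hω
      simp only [S, Set.mem_ofPred_eq] at hω ⊢
      have h2 : Matrix.toEuclideanLin (V ω * O) x = r • Matrix.toEuclideanLin (V ω) g := by
        rw [← map_smul]
        simp only [Matrix.toLpLin_apply, ← Matrix.mulVec_mulVec, hOx]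
      rw [h2, norm_smul, Real.norm_eq_abs, abs_of_pos hr0] at hω
      have h3 : ‖x‖ = r * ‖g‖ := by rw [hr]; field_simp
      rw [h3, mul_pow, mul_pow] at hω
      have h4 : c * (r ^ 2 * ‖Matrix.toEuclideanLin (V ω) g‖ ^ 2) - r ^ 2 * ‖g‖ ^ 2
          = r ^ 2 * (c * ‖Matrix.toEuclideanLin (V ω) g‖ ^ 2 - ‖g‖ ^ 2) := by ring
      rw [h4, abs_mul, abs_of_pos (by positivity : (0 : ℝ) < r ^ 2)] at hω
      have h5 : (0 : ℝ) < r ^ 2 := by positivity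
      refine le_of_mul_le_mul_left ?_ h5
      linarith
  set γ := stdGaussian (EuclideanSpace ℝ ι) with hγ
  have hT : MeasurableSet {z : Ω × EuclideanSpace ℝ ι | (V z.1, z.2) ∈ S} :=
    (by fun_prop : Measurable (fun z : Ω × EuclideanSpace ℝ ι => (V z.1, z.2))) hS
  calc P {ω | (V ω, x) ∈ S} = ∫⁻ _g, P {ω | (V ω, x) ∈ S} ∂γ := by simp
    _ ≤ ∫⁻ g, P {ω | (V ω, g) ∈ S} ∂γ := lintegral_mono key
    _ = (P.prod γ) {z : Ω × EuclideanSpace ℝ ι | (V z.1, z.2) ∈ S} :=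
        (Measure.prod_apply_symm hT).symm
    _ = ∫⁻ ω, γ {g | (V ω, g) ∈ S} ∂P := Measure.prod_apply hT
    _ ≤ ∫⁻ _ω, ENNReal.ofReal (4 * Real.exp (-(n : ℝ) / 4500)) ∂P := by
        apply lintegral_mono_ae
        filter_upwards [hV1] with ω hω
        exact gauss_dev hn hN (V ω) hω
    _ = _ := by simp

lemma colBlock_emb {n p d : ℕ} (A : Matrix (Fin n) (Fin p × Fin d) ℝ) (k : Fin p)
    (x : EuclideanSpace ℝ (Fin d)) :
    ∃ y : EuclideanSpace ℝ (Fin p × Fin d), y = WithLp.toLp 2 (fun z => if z.1 = k then x z.2 else 0) ∧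
      ‖y‖ = ‖x‖ ∧ Matrix.toEuclideanLin (colBlock A k) x = Matrix.toEuclideanLin A y := by
  refine ⟨_, rfl, ?_, ?_⟩
  · rw [EuclideanSpace.norm_eq, EuclideanSpace.norm_eq, Fintype.sum_prod_type]
    congr 1
    rw [Finset.sum_eq_single k]
    · simp
    · intro b _ hb
      simp [hb]
    · simp
  · ext i
    simp only [Matrix.toLpLin_apply, mulVec, dotProduct, Fintype.sum_prod_type]
    symm
    rw [Finset.sum_eq_single k]
    · simp [colBlock]
    · intro b _ hb
      simp [hb]
    · simp

lemma fixed_dev_block {Ω : Type*} [MeasurableSpace Ω] (P : Measure Ω) [IsProbabilityMeasure P]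
    {n p d : ℕ} (V : Ω → Matrix (Fin n) (Fin p × Fin d) ℝ) (hV : IsUniformStiefel P V)
    (hn : 0 < n) (hN : n ≤ p * d) (k : Fin p) (x : EuclideanSpace ℝ (Fin d)) :
    P {ω | 1 / 14 * ‖x‖ ^ 2 <
      |((p * d : ℕ) / (n : ℝ)) * ‖Matrix.toEuclideanLin (colBlock (V ω) k) x‖ ^ 2 - ‖x‖ ^ 2|}
      ≤ ENNReal.ofReal (4 * Real.exp (-(n : ℝ) / 4500)) := by
  by_cases hx : x = 0
  · simp [hx]
  set y : EuclideanSpace ℝ (Fin p × Fin d) :=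
    WithLp.toLp 2 (fun z => if z.1 = k then x z.2 else 0) with hy
  have h : ∀ ω, ‖y‖ = ‖x‖ ∧ Matrix.toEuclideanLin (colBlock (V ω) k) x
      = Matrix.toEuclideanLin (V ω) y := by
    intro ω
    obtain ⟨z, hz, h1, h2⟩ := colBlock_emb (V ω) k x
    rw [hy, ← hz]
    exact ⟨h1, h2⟩
  have hyn : ‖y‖ = ‖x‖ := by
    obtain ⟨z, hz, h1, h2⟩ := colBlock_emb (0 : Matrix (Fin n) _ ℝ) k x
    rw [hy, ← hz]
    exact h1
  have hy0 : y ≠ 0 := by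
    rw [← norm_ne_zero_iff, hyn]
    exact norm_ne_zero_iff.2 hx
  have hcard : Fintype.card (Fin p × Fin d) = p * d := by simp
  have := fixed_dev P hn (by rw [hcard]; exact hN) V hV y hy0
  rw [hcard, hyn] at this
  refine (measure_mono ?_).trans this
  intro ω hω
  simp only [Set.mem_ofPred_eq] at hω ⊢
  rw [← (h ω).2]
  exact hω.le

/-- Continuous version of a net argument. -/
lemma quad_large {d n : ℕ} (hd : 0 < d) (M : EuclideanSpace ℝ (Fin d) →ₗ[ℝ] EuclideanSpace ℝ (Fin n))
    (c : ℝ) :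
    (∃ m : ℝ, 0 ≤ m ∧ m < 1 / 7 ∧ ∀ x, |c * ‖M x‖ ^ 2 - ‖x‖ ^ 2| ≤ m * ‖x‖ ^ 2) ∨
    ∃ x₀, Metric.closedBall x₀ (1 / 8) ⊆ {x | x ∈ Metric.closedBall (0 : EuclideanSpace ℝ (Fin d)) 1 ∧
      1 / 14 * ‖x‖ ^ 2 < |c * ‖M x‖ ^ 2 - ‖x‖ ^ 2|} := by
  have : Nonempty (Fin d) := ⟨⟨0, hd⟩⟩
  have hcM : Continuous M := LinearMap.continuous_of_finiteDimensional _
  obtain ⟨x₀, hx₀, hmax⟩ := (isCompact_sphere (0 : EuclideanSpace ℝ (Fin d)) 1).exists_isMaxOn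
    (NormedSpace.sphere_nonempty.2 zero_le_one)
    (f := fun x => |c * ‖M x‖ ^ 2 - ‖x‖ ^ 2|) (by fun_prop)
  set q : EuclideanSpace ℝ (Fin d) → ℝ := fun x => c * ‖M x‖ ^ 2 - ‖x‖ ^ 2 with hq
  have hsm : ∀ (r : ℝ) x, q (r • x) = r ^ 2 * q x := by
    intro r x
    simp only [hq, map_smul, norm_smul, mul_pow, Real.norm_eq_abs, sq_abs]
    ring
  set m := |q x₀| with hm
  have hx₀n : ‖x₀‖ = 1 := by simpa using hx₀
  have hall : ∀ x, |q x| ≤ m * ‖x‖ ^ 2 := by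
    intro x
    by_cases hx : x = 0
    · simp [hx, hq]
    have hxn : ‖x‖ ≠ 0 := norm_ne_zero_iff.2 hx
    have h1 : ‖x‖⁻¹ • x ∈ Metric.sphere (0 : EuclideanSpace ℝ (Fin d)) 1 := by
      simp [norm_smul, hxn]
    have h2 : |q (‖x‖⁻¹ • x)| ≤ m := hmax h1
    have h3 : q x = ‖x‖ ^ 2 * q (‖x‖⁻¹ • x) := by
      rw [← hsm, smul_smul, mul_inv_cancel₀ hxn, one_smul]
    rw [h3, abs_mul, abs_of_nonneg (sq_nonneg _), mul_comm]
    gcongr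
  by_cases hm7 : m < 1 / 7
  · exact Or.inl ⟨m, abs_nonneg _, hm7, hall⟩
  right
  push Not at hm7
  refine ⟨(7 / 8 : ℝ) • x₀, ?_⟩
  intro x hx
  set y := (8 : ℝ) • (x - (7 / 8 : ℝ) • x₀) with hy
  have hyn : ‖y‖ ≤ 1 := by
    rw [mem_closedBall_iff_norm] at hx
    rw [hy, norm_smul]
    norm_num
    linarith
  have hxy : x = (7 / 8 : ℝ) • x₀ + (1 / 8 : ℝ) • y := by
    rw [hy, smul_smul]
    norm_num
  have hxn : ‖x‖ ≤ 1 := by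
    rw [hxy]
    refine (norm_add_le _ _).trans ?_
    rw [norm_smul, norm_smul, hx₀n]
    norm_num
    linarith
  have hexp : q x = 49 / 64 * q x₀ + 7 / 128 * (q (x₀ + y) - q (x₀ - y)) + 1 / 64 * q y := by
    rw [hxy]
    simp only [hq, map_add, map_sub, map_smul, ← real_inner_self_eq_norm_sq, inner_add_left,
      inner_add_right, inner_sub_left, inner_sub_right, inner_smul_left, inner_smul_right,
      real_inner_comm x₀ y, real_inner_comm (M x₀) (M y)]
    simp
    ring
  have hpar : ‖x₀ + y‖ ^ 2 + ‖x₀ - y‖ ^ 2 ≤ 4 := by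
    have := parallelogram_law_with_norm ℝ x₀ y
    nlinarith [norm_nonneg y]
  have hm0 : 0 ≤ m := abs_nonneg _
  have b1 := abs_le.1 (hall (x₀ + y))
  have b2 := abs_le.1 (hall (x₀ - y))
  have b3 := abs_le.1 (hall y)
  have b4 : m * ‖x₀ + y‖ ^ 2 + m * ‖x₀ - y‖ ^ 2 ≤ m * 4 := by nlinarith
  have b5 : m * ‖y‖ ^ 2 ≤ m :=
    mul_le_of_le_one_right hm0 (pow_le_one₀ (norm_nonneg y) hyn)
  have hxsq : ‖x‖ ^ 2 ≤ 1 := by nlinarith [norm_nonneg x]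
  refine ⟨by simpa using hxn, ?_⟩
  change 1 / 14 * ‖x‖ ^ 2 < |q x|
  rw [lt_abs, hexp]
  rcases abs_cases (q x₀) with ⟨h, _⟩ | ⟨h, _⟩
  · left
    linarith
  · right
    linarith

lemma specNorm_small {n d : ℕ} (A : Matrix (Fin n) (Fin d) ℝ) (c m : ℝ) (hc : 0 ≤ c) (hm0 : 0 ≤ m)
    (hm : m < 1 / 7)
    (h : ∀ x, |c * ‖Matrix.toEuclideanLin A x‖ ^ 2 - ‖x‖ ^ 2| ≤ m * ‖x‖ ^ 2) :
    specNorm (Real.sqrt c • A) < Real.sqrt (8 / 7) := by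
  have : specNorm (Real.sqrt c • A) ≤ Real.sqrt (1 + m) := by
    refine ContinuousLinearMap.opNorm_le_bound _ (Real.sqrt_nonneg _) fun x => ?_
    rw [LinearMap.coe_toContinuousLinearMap', map_smul, LinearMap.smul_apply, norm_smul,
      Real.norm_of_nonneg (Real.sqrt_nonneg _)]
    have h1 := (abs_le.1 (h x)).2
    refine abs_le_of_sq_le_sq' ?_ (by positivity) |>.2
    rw [mul_pow, mul_pow, Real.sq_sqrt hc, Real.sq_sqrt (by linarith)]
    linarith
  refine this.trans_lt (Real.sqrt_lt_sqrt (by linarith) (by linarith))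

lemma gram_small {n d : ℕ} (A : Matrix (Fin n) (Fin d) ℝ) (c m : ℝ)
    (hm : m < 1 / 7)
    (h : ∀ x, |c * ‖Matrix.toEuclideanLin A x‖ ^ 2 - ‖x‖ ^ 2| ≤ m * ‖x‖ ^ 2) :
    IsUnit (c • (Aᵀ * A)) ∧ specNorm ((c • (Aᵀ * A))⁻¹) < 7 / 6 := by
  set G := c • (Aᵀ * A) with hG
  have hlow : ∀ x, (1 - m) * ‖x‖ ≤ ‖Matrix.toEuclideanLin G x‖ := by
    intro x
    by_cases hx : x = 0
    · simp [hx]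
    have hxn : 0 < ‖x‖ := norm_pos_iff.2 hx
    have h1 := (abs_le.1 (h x)).1
    have h2 : inner ℝ (Matrix.toEuclideanLin G x) x = c * ‖Matrix.toEuclideanLin A x‖ ^ 2 := by
      have e : Matrix.toEuclideanLin G x
          = c • Matrix.toEuclideanLin Aᵀ (Matrix.toEuclideanLin A x) := by
        simp [hG]
      rw [e, real_inner_smul_left, ← Matrix.conjTranspose_eq_transpose_of_trivial,
        Matrix.toEuclideanLin_conjTranspose_eq_adjoint, LinearMap.adjoint_inner_left,
        real_inner_self_eq_norm_sq]
    have h3 := real_inner_le_norm (Matrix.toEuclideanLin G x) x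
    refine le_of_mul_le_mul_right ?_ hxn
    nlinarith
  have hunit : IsUnit G := by
    rw [← Matrix.mulVec_injective_iff_isUnit]
    have hz : ∀ v : Fin d → ℝ, G *ᵥ v = 0 → v = 0 := by
      intro v hv
      have := hlow (WithLp.toLp 2 v)
      have e : Matrix.toEuclideanLin G (WithLp.toLp 2 v) = 0 := by
        simp [Matrix.toLpLin_apply, hv]
      rw [e, norm_zero] at this
      have h0 : ‖WithLp.toLp 2 v‖ ≤ 0 := by nlinarith
      have := norm_le_zero_iff.1 h0
      simpa using this
    intro v w hvw
    have := hz (v - w) (by rw [Matrix.mulVec_sub]; exact sub_eq_zero.2 hvw)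
    exact sub_eq_zero.1 this
  refine ⟨hunit, ?_⟩
  have : specNorm G⁻¹ ≤ (1 - m)⁻¹ := by
    refine ContinuousLinearMap.opNorm_le_bound _ (inv_nonneg.2 (by linarith)) fun y => ?_
    rw [LinearMap.coe_toContinuousLinearMap']
    have h1 := hlow (Matrix.toEuclideanLin G⁻¹ y)
    have e : Matrix.toEuclideanLin G (Matrix.toEuclideanLin G⁻¹ y) = y := by
      simp only [Matrix.toLpLin_apply, Matrix.mulVec_mulVec,
        Matrix.mul_nonsing_inv _ ((Matrix.isUnit_iff_isUnit_det _).1 hunit)]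
      simp
    rw [e] at h1
    rw [inv_mul_eq_div, le_div_iff₀ (by linarith)]
    linarith
  refine this.trans_lt ?_
  rw [inv_lt_comm₀ (by linarith) (by norm_num)]
  linarith

/-- The probability that some unit direction of the `k`-th block is distorted by `1/7` or more. -/
lemma block_dev {Ω : Type*} [MeasurableSpace Ω] (P : Measure Ω) [IsProbabilityMeasure P]
    {n p d : ℕ} (V : Ω → Matrix (Fin n) (Fin p × Fin d) ℝ) (hV : IsUniformStiefel P V)
    (hn : 0 < n) (hd : 0 < d) (hN : n ≤ p * d) (hdn : (d : ℝ) / n ≤ 1 / 14400) (k : Fin p) :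
    P {ω | ¬ ∃ m : ℝ, 0 ≤ m ∧ m < 1 / 7 ∧ ∀ x,
      |((p * d : ℕ) / (n : ℝ)) * ‖Matrix.toEuclideanLin (colBlock (V ω) k) x‖ ^ 2 - ‖x‖ ^ 2|
        ≤ m * ‖x‖ ^ 2}
      ≤ ENNReal.ofReal (5 * Real.exp (-(n : ℝ) / 28800)) := by
  set c : ℝ := (p * d : ℕ) / (n : ℝ) with hc
  set E := EuclideanSpace ℝ (Fin d)
  let B : Set E := Metric.closedBall 0 1
  let T : Set (Ω × E) := {z | z.2 ∈ B ∧ 1 / 14 * ‖z.2‖ ^ 2 <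
      |c * ‖Matrix.toEuclideanLin (colBlock (V z.1) k) z.2‖ ^ 2 - ‖z.2‖ ^ 2|}
  have hT : MeasurableSet T := by
    have hVb : Measurable (fun ω => colBlock (V ω) k) := by
      refine measurable_pi_iff.2 fun i => measurable_pi_iff.2 fun j => ?_
      exact (measurable_pi_apply (k, j)).comp ((measurable_pi_apply i).comp hV.1)
    have hm := (measurable_mv (n := n) (ι := Fin d)).comp
      ((hVb.comp measurable_fst).prodMk (measurable_snd (α := Ω) (β := E)))
    simp only [Function.comp_def] at hm
    refine (measurable_snd Metric.isClosed_closedBall.measurableSet).inter ?_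
    have h1 : Measurable (fun z : Ω × E => 1 / 14 * ‖z.2‖ ^ 2) := by fun_prop
    have h2 : Measurable (fun z : Ω × E =>
        |c * ‖Matrix.toEuclideanLin (colBlock (V z.1) k) z.2‖ ^ 2 - ‖z.2‖ ^ 2|) := by
      simp_rw [← Real.norm_eq_abs]
      fun_prop
    exact measurableSet_lt h1 h2
  let b : ℝ≥0∞ := volume (Metric.ball (0 : E) 1)
  have hb0 : b ≠ 0 := (Metric.measure_ball_pos _ _ one_pos).ne'
  have hbt : b ≠ ∞ := measure_ball_lt_top.ne
  have hfin : Module.finrank ℝ E = d := by simp [E]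
  let r : ℝ≥0∞ := ENNReal.ofReal ((1 / 8 : ℝ) ^ d)
  have hsmall : ∀ x₀ : E, volume (Metric.closedBall x₀ (1 / 8)) = r * b := by
    intro x₀
    rw [Measure.addHaar_closedBall _ _ (by norm_num), hfin]
  have hBvol : volume B = b := by
    simp only [B]
    rw [Measure.addHaar_closedBall _ _ (by norm_num)]
    simp [b]
  let t : ℝ≥0∞ := ENNReal.ofReal (4 * Real.exp (-(n : ℝ) / 4500))
  -- bad events force a large set of bad directions
  have hsub : {ω | ¬ ∃ m : ℝ, 0 ≤ m ∧ m < 1 / 7 ∧ ∀ x,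
      |c * ‖Matrix.toEuclideanLin (colBlock (V ω) k) x‖ ^ 2 - ‖x‖ ^ 2|
        ≤ m * ‖x‖ ^ 2} ⊆ {ω | r * b ≤ volume (Prod.mk ω ⁻¹' T)} := by
    intro ω hω
    rcases quad_large hd (Matrix.toEuclideanLin (colBlock (V ω) k)) c with h | ⟨x₀, h⟩
    · exact absurd h hω
    · change r * b ≤ _
      rw [← hsmall x₀]
      exact measure_mono h
  have hmark := mul_meas_ge_le_lintegral (μ := P) (measurable_measure_prodMk_left (ν := (volume : Measure E)) hT) (r * b)
  have hint : ∫⁻ ω, volume (Prod.mk ω ⁻¹' T) ∂P ≤ t * b := by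
    rw [← Measure.prod_apply hT, Measure.prod_apply_symm hT]
    calc ∫⁻ x : E, P ((fun ω => (ω, x)) ⁻¹' T) ≤ ∫⁻ x : E, B.indicator (fun _ => t) x := by
          apply lintegral_mono
          intro x
          by_cases hx : x ∈ B
          · rw [Set.indicator_of_mem hx]
            refine (measure_mono ?_).trans (fixed_dev_block P V hV hn hN k x)
            intro ω hω
            exact hω.2
          · rw [Set.indicator_of_notMem hx]
            have : (fun ω => (ω, x)) ⁻¹' T = ∅ := by
              ext ω
              simp only [Set.mem_preimage, Set.mem_empty_iff_false, iff_false]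
              exact fun h => hx h.1
            simp [this]
      _ = t * b := by
          rw [lintegral_indicator_const Metric.isClosed_closedBall.measurableSet, hBvol]
  have h1 := (mul_le_mul_right (measure_mono (μ := P) hsub) (r * b)).trans (hmark.trans hint)
  set X := P {ω | ¬ ∃ m : ℝ, 0 ≤ m ∧ m < 1 / 7 ∧ ∀ x,
      |c * ‖Matrix.toEuclideanLin (colBlock (V ω) k) x‖ ^ 2 - ‖x‖ ^ 2|
        ≤ m * ‖x‖ ^ 2}
  have h2 : r * X ≤ t := by
    rw [mul_right_comm] at h1
    exact (ENNReal.mul_le_mul_iff_left hb0 hbt).1 h1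
  have hX : X = ENNReal.ofReal (8 ^ d) * (r * X) := by
    rw [← mul_assoc, ← ENNReal.ofReal_mul (by positivity), ← mul_pow]
    norm_num
  rw [hX]
  refine (mul_le_mul_right h2 _).trans ?_
  rw [← ENNReal.ofReal_mul (by positivity)]
  apply ENNReal.ofReal_le_ofReal
  have hn' : (0 : ℝ) < n := by exact_mod_cast hn
  have h8 : (8 : ℝ) ^ d ≤ Real.exp ((n : ℝ) * (2.08 / 14400)) := by
    have e8 : (8 : ℝ) ≤ Real.exp 2.08 := by
      rw [← Real.log_le_iff_le_exp (by norm_num)]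
      have : (8 : ℝ) = 2 ^ 3 := by norm_num
      rw [this, Real.log_pow]
      have := Real.log_two_lt_d9
      norm_num
      linarith
    calc (8 : ℝ) ^ d ≤ Real.exp 2.08 ^ d := by gcongr
      _ = Real.exp (d * 2.08) := by rw [← Real.exp_nat_mul]
      _ ≤ _ := by
        apply Real.exp_le_exp.2
        rw [div_le_iff₀ hn'] at hdn
        linarith
  calc (8 : ℝ) ^ d * (4 * Real.exp (-(n : ℝ) / 4500))
      ≤ Real.exp ((n : ℝ) * (2.08 / 14400)) * (4 * Real.exp (-(n : ℝ) / 4500)) := by gcongr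
    _ = 4 * Real.exp ((n : ℝ) * (2.08 / 14400) + -(n : ℝ) / 4500) := by
        rw [Real.exp_add]
        ring
    _ ≤ 4 * Real.exp (-(n : ℝ) / 28800) := by
        gcongr
        linarith
    _ ≤ _ := by
        gcongr
        norm_num

lemma union_bound {Ω α : Type*} [MeasurableSpace Ω] (P : Measure Ω) (K : Finset α)
    (E : α → Ω → Prop) (b : ℝ≥0∞) (h : ∀ k ∈ K, P {ω | E k ω} ≤ b) :
    P {ω | ∃ k ∈ K, E k ω} ≤ (K.card : ℝ≥0∞) * b := by
  have : {ω | ∃ k ∈ K, E k ω} = ⋃ k ∈ K, {ω | E k ω} := by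
    ext ω
    simp
  rw [this]
  refine (measure_biUnion_finset_le K _).trans ?_
  refine (Finset.sum_le_card_nsmul K _ b h).trans ?_
  rw [nsmul_eq_mul]

/-- **Lemma S.5, specialized.** With `t₁₁ = 1/60 − √(d/n)`, `t₁₂ = 1/60 − √(1/p)`,
`t₁₃ = 1/10 − √(1/p)`: `P[max_{k∈K} ‖√(pd/n)·V_k‖ ≥ √(8/7)] ≤ 5q exp(−n/28800)` and
`P[max_{k∈K} ‖((pd/n)·V_kᵀ V_k)⁻¹‖ ≥ 7/6] ≤ 5q exp(−n/28800)`, with each `V_kᵀ V_k`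
invertible on the complementary event. -/
theorem stiefel_max_block_gram_concentration_specialized
    {Ω : Type*} [MeasurableSpace Ω] (P : Measure Ω) [IsProbabilityMeasure P]
    (n p d q : ℕ) (V : Ω → Matrix (Fin n) (Fin p × Fin d) ℝ)
    (hV : IsUniformStiefel P V)
    (K : Finset (Fin p)) (hK : K.card = q)
    (hpd : n ≤ (p - 1) * d)
    (h₁ : Real.sqrt ((d : ℝ) / n) ≤ 1 / 120)
    (h₂ : Real.sqrt (1 / (p : ℝ)) ≤ 1 / 120) :
    P {ω | ∃ k ∈ K, Real.sqrt (8 / 7)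
          ≤ specNorm (Real.sqrt ((p * d : ℕ) / (n : ℝ)) • colBlock (V ω) k)}
      ≤ (q : ℝ≥0∞) * ENNReal.ofReal (5 * Real.exp (-(n : ℝ) / 28800))
    ∧ P {ω | ∃ k ∈ K,
            ¬ IsUnit (((p * d : ℕ) / (n : ℝ)) • ((colBlock (V ω) k)ᵀ * colBlock (V ω) k))
            ∨ (7 : ℝ) / 6
              ≤ specNorm ((((p * d : ℕ) / (n : ℝ)) •
                  ((colBlock (V ω) k)ᵀ * colBlock (V ω) k))⁻¹)}
        ≤ (q : ℝ≥0∞) * ENNReal.ofReal (5 * Real.exp (-(n : ℝ) / 28800)) := by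
  subst hK
  by_cases hn0 : n = 0
  · have hone : (1 : ℝ≥0∞) ≤ ENNReal.ofReal (5 * Real.exp (-(n : ℝ) / 28800)) := by
      rw [ENNReal.one_le_ofReal, hn0]
      simp
    exact ⟨union_bound P K _ _ fun k _ => prob_le_one.trans hone,
      union_bound P K _ _ fun k _ => prob_le_one.trans hone⟩
  have hn : 0 < n := Nat.pos_of_ne_zero hn0
  have hd : 0 < d := by
    rcases Nat.eq_zero_or_pos d with h | h
    · subst h
      simp at hpd
      omega
    · exact h
  have hN : n ≤ p * d := hpd.trans (Nat.mul_le_mul_right d (Nat.sub_le p 1))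
  have hdn : (d : ℝ) / n ≤ 1 / 14400 := by
    have := (Real.sqrt_le_left (by norm_num)).1 h₁
    norm_num at this ⊢
    exact this
  constructor
  · apply union_bound
    intro k _
    refine (measure_mono ?_).trans (block_dev P V hV hn hd hN hdn k)
    rintro ω hω ⟨m, hm0, hm, h⟩
    exact absurd hω (not_le.2 (specNorm_small _ _ m (by positivity) hm0 hm h))
  · apply union_bound
    intro k _
    refine (measure_mono ?_).trans (block_dev P V hV hn hd hN hdn k)
    rintro ω hω ⟨m, hm0, hm, h⟩
    obtain ⟨h1, h2⟩ := gram_small _ _ m hm h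
    rcases hω with hω | hω
    · exact hω h1
    · exact absurd hω (not_le.2 h2)
end
end
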